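/- arXiv:1208.6159 — 2 statements merged into one kernel-verified Lean document; each statement's English description precedes it below -/
import Mathlib

section
/- There exist an effectively computable constant a₀ > 0 and T₀ > 0 such that for every real T ≥ T₀ the following holds. Let Z_T be the set of all zeros ρ = β + iγ with 0 < β < 1 and |γ| ≤ T of the Dirichlet L-functions L(s,χ) taken over all primitive Dirichlet characters χ of modulus q ≤ T. Then all elements of Z_T satisfy β < 1 − a₀/log T, with the possible exception of a single zero β_T, which is real and simple, belongs to the L-function of a unique primitive character χ_T, which is real, and which satisfies 1 − a₀/log T ≤ β_T ≤ 1 − 1/(√T (log T)³). -/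
section

open Complex Metric

/-- A nonzero entire function factors out its zero at a given point. -/
lemma exists_eq_pow_mul_of_differentiable {f : ℂ → ℂ} (hf : Differentiable ℂ f) {c : ℂ}
    (hc : f c ≠ 0) (a : ℂ) :
    ∃ (n : ℕ) (g : ℂ → ℂ), Differentiable ℂ g ∧ g a ≠ 0 ∧ ∀ z, f z = (z - a) ^ n * g z := by
  have key : ∀ n : ℕ, ∀ f : ℂ → ℂ, Differentiable ℂ f → analyticOrderAt f a = n →
      ∃ (n : ℕ) (g : ℂ → ℂ), Differentiable ℂ g ∧ g a ≠ 0 ∧ ∀ z, f z = (z - a) ^ n * g z := by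
    intro n
    induction n with
    | zero =>
      intro f hf hn
      refine ⟨0, f, hf, ?_, by simp⟩
      exact ((hf.analyticAt a).analyticOrderAt_eq_zero).1 (by simpa using hn)
    | succ n ih =>
      intro f hf hn
      have hfa : f a = 0 := by
        by_contra h
        have := ((hf.analyticAt a).analyticOrderAt_eq_zero).2 h
        rw [this] at hn
        norm_cast at hn
      have hd : Differentiable ℂ (dslope f a) := by
        rw [← differentiableOn_univ]
        exact (Complex.differentiableOn_dslope Filter.univ_mem).2 hf.differentiableOn
      have he : f = (fun z ↦ z - a) * dslope f a := by
        ext z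
        have := sub_smul_dslope f a z
        simp [smul_eq_mul, hfa] at this
        simp [this]
      have ho : analyticOrderAt (dslope f a) a = n := by
        have h1 : analyticOrderAt (fun z : ℂ ↦ z - a) a = 1 := by
          have : AnalyticAt ℂ (fun z : ℂ ↦ z - a) a := by fun_prop
          refine (this.analyticOrderAt_eq_natCast (n := 1)).2 ⟨fun _ ↦ 1, by fun_prop, by simp, ?_⟩
          simp
        rw [he, analyticOrderAt_mul (by fun_prop) (hd.analyticAt a), h1] at hn
        push_cast at hn
        rw [add_comm] at hn
        exact ENat.add_left_injective_of_ne_top (n := 1) (by simp) hn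
      obtain ⟨m, g, hg, hga, hm⟩ := ih _ hd ho
      refine ⟨m + 1, g, hg, hga, fun z ↦ ?_⟩
      conv_lhs => rw [he]
      simp only [Pi.mul_apply, hm z]
      ring
  have hne : analyticOrderAt f a ≠ ⊤ := by
    intro h
    have h0 := analyticOrderAt_eq_top.1 h
    have := (AnalyticOnNhd.eqOn_zero_of_preconnected_of_eventuallyEq_zero
      (fun z _ ↦ hf.analyticAt z) isPreconnected_univ (Set.mem_univ a) h0) (Set.mem_univ c)
    exact hc this
  obtain ⟨n, hn⟩ := ENat.ne_top_iff_exists.1 hne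
  exact key n f hf hn.symm

/-- The zeros of an entire function in a finite set can be divided out. -/
lemma exists_eq_prod_mul_of_differentiable {c : ℂ} (Z : Finset ℂ) :
    ∀ f : ℂ → ℂ, Differentiable ℂ f → f c ≠ 0 →
    ∃ (n : ℂ → ℕ) (g : ℂ → ℂ), Differentiable ℂ g ∧ (∀ a ∈ Z, g a ≠ 0) ∧
      ∀ z, f z = (∏ a ∈ Z, (z - a) ^ n a) * g z := by
  classical
  induction Z using Finset.induction_on with
  | empty => intro f hf hc; exact ⟨fun _ ↦ 0, f, hf, by simp, by simp⟩
  | insert b Z hb ih =>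
    intro f hf hc
    obtain ⟨n, g, hg, hgb, hn⟩ := exists_eq_pow_mul_of_differentiable hf hc b
    obtain ⟨m, h, hh, hh0, hm⟩ := ih g hg (fun h ↦ hc (by rw [hn, h, mul_zero]))
    refine ⟨Function.update m b n, h, hh, ?_, ?_⟩
    · intro a ha
      rcases Finset.mem_insert.1 ha with rfl | ha
      · intro h0
        exact hgb (by rw [hm, h0, mul_zero])
      · exact hh0 a ha
    · intro z
      rw [Finset.prod_insert hb, Function.update_self, hn, hm z, ← mul_assoc]
      congr 2
      refine Finset.prod_congr rfl fun a ha ↦ ?_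
      rw [Function.update_of_ne]
      rintro rfl
      exact hb ha

/-- Bound for the logarithmic derivative at the centre of a zero-free disc. -/
lemma norm_logDeriv_le_of_ne_zero {h : ℂ → ℂ} (hh : Differentiable ℂ h) {c : ℂ} {R M : ℝ}
    (hR : 0 < R) (hM : 0 < M) (h0 : ∀ z ∈ ball c R, h z ≠ 0)
    (hb : ∀ z ∈ ball c R, ‖h z‖ ≤ Real.exp M * ‖h c‖) :
    ‖logDeriv h c‖ ≤ 4 * M / R := by
  have hcmem : c ∈ ball c R := mem_ball_self hR
  have hd : DifferentiableOn ℂ (logDeriv h) (ball c R) := by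
    intro z hz
    exact ((hh.deriv z).div (hh z) (h0 z hz)).differentiableWithinAt
  obtain ⟨L, hL⟩ := hd.isExactOn_ball
  set E : ℂ → ℂ := fun z ↦ h z * cexp (-(L z - L c)) with hE
  have hE' : ∀ z ∈ ball c R, HasDerivAt E 0 z := by
    intro z hz
    have h1 := (hh z).hasDerivAt.mul ((((hL z hz).sub_const (L c)).neg).cexp)
    refine h1.congr_deriv ?_
    rw [logDeriv_apply]
    have := h0 z hz
    field_simp
    ring
  have hEc : ∀ z ∈ ball c R, E z = h c := by
    intro z hz
    have := (convex_ball c R).is_const_of_fderivWithin_eq_zero (𝕜 := ℂ) (f := E)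
      (fun w hw ↦ (hE' w hw).differentiableAt.differentiableWithinAt)
      (fun w hw ↦ by
        rw [fderivWithin_of_isOpen isOpen_ball hw]
        have := (hE' w hw).hasFDerivAt.fderiv
        rw [this]; ext; simp) hz hcmem
    rw [this]; simp [hE]
  have hre : ∀ z ∈ ball c R, (L z - L c).re ≤ M := by
    intro z hz
    have h1 : h z = h c * cexp (L z - L c) := by
      rw [← hEc z hz, hE]
      simp only
      rw [mul_assoc, ← Complex.exp_add]
      simp
    have h2 := hb z hz
    rw [h1, norm_mul, Complex.norm_exp, mul_comm] at h2
    have h3 := le_of_mul_le_mul_right h2 (norm_pos_iff.2 (h0 c hcmem))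
    exact Real.exp_le_exp.1 h3
  set F : ℂ → ℂ := fun w ↦ L (c + w) - L c with hF
  have hmaps : ∀ w ∈ ball (0 : ℂ) R, c + w ∈ ball c R := by
    intro w hw; simpa using hw
  have hFd : ∀ w ∈ ball (0 : ℂ) R, HasDerivAt F (logDeriv h (c + w)) w := by
    intro w hw
    have := (hL (c + w) (hmaps w hw)).comp_const_add c w
    exact this.sub_const _
  have hbound : ∀ w ∈ sphere (0 : ℂ) (R / 2), ‖F w‖ ≤ 2 * M := by
    intro w hw
    have hw' : ‖w‖ = R / 2 := by simpa using hw
    have := Complex.borelCaratheodory_zero (f := F) (R := R) (z := w) hM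
      (fun w hw ↦ (hFd w hw).differentiableAt.differentiableWithinAt)
      (fun w hw ↦ hre _ (hmaps w hw)) hR (by simp [hw']; linarith) (by simp [hF])
    rw [hw'] at this
    refine this.trans (le_of_eq ?_)
    field_simp
    ring
  have hdc : DiffContOnCl ℂ F (ball 0 (R / 2)) := by
    apply DifferentiableOn.diffContOnCl
    rw [closure_ball _ (by positivity)]
    intro w hw
    refine (hFd w ?_).differentiableAt.differentiableWithinAt
    exact closedBall_subset_ball (by linarith) hw
  have := Complex.norm_deriv_le_of_forall_mem_sphere_norm_le (by positivity : 0 < R / 2) hdc hbound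
  rw [(hFd 0 (mem_ball_self hR)).deriv, add_zero] at this
  refine this.trans (le_of_eq ?_)
  field_simp
  ring

/-- Landau's local formula for the logarithmic derivative. -/
lemma exists_logDeriv_eq_sum {f : ℂ → ℂ} (hf : Differentiable ℂ f) {c : ℂ} {r M : ℝ}
    (hr : 0 < r) (hM : 0 < M) (hc : f c ≠ 0)
    (hb : ∀ z ∈ closedBall c r, ‖f z‖ ≤ Real.exp M * ‖f c‖) :
    ∃ (Z : Finset ℂ) (n : ℂ → ℕ), (∀ a, a ∈ Z ↔ f a = 0 ∧ a ∈ closedBall c (r / 2)) ∧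
      (∀ a ∈ Z, 1 ≤ n a) ∧ (∀ a ∈ Z, deriv f a = 0 → 2 ≤ n a) ∧
      ‖logDeriv f c - ∑ a ∈ Z, n a / (c - a)‖ ≤ 8 * M / r := by
  classical
  have hfin : {a | f a = 0 ∧ a ∈ closedBall c (r / 2)}.Finite := by
    have hA : AnalyticOnNhd ℂ f Set.univ := fun z _ ↦ hf.analyticAt z
    have h1 := hA.preimage_zero_mem_codiscrete (x := c) hc
    have h2 : (f ⁻¹' {0}) ∩ closedBall c (r / 2) = {a | f a = 0 ∧ a ∈ closedBall c (r / 2)} := by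
      ext; simp
    rw [← h2]
    rw [mem_codiscrete'] at h1
    have h3 : (f ⁻¹' {0}ᶜ)ᶜ = f ⁻¹' {0} := by ext; simp
    rw [h3] at h1
    exact ((isCompact_closedBall c (r / 2)).inter_left
      (isClosed_singleton.preimage hf.continuous)).finite (h1.2.mono Set.inter_subset_left)
  set Z := hfin.toFinset with hZ
  have hZm : ∀ a, a ∈ Z ↔ f a = 0 ∧ a ∈ closedBall c (r / 2) := by simp [hZ]
  obtain ⟨n, g, hg, hgZ, hn⟩ := exists_eq_prod_mul_of_differentiable Z f hf hc
  have hcZ : ∀ a ∈ Z, c - a ≠ 0 := by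
    intro a ha h
    rw [sub_eq_zero] at h
    exact hc (h ▸ ((hZm a).1 ha).1)
  have hgc : g c ≠ 0 := fun h ↦ hc (by rw [hn, h, mul_zero])
  refine ⟨Z, n, hZm, ?_, ?_, ?_⟩
  · intro a ha
    by_contra h
    have h0 : n a = 0 := by omega
    have hfa := ((hZm a).1 ha).1
    rw [hn a, mul_eq_zero, or_iff_left (hgZ a ha), Finset.prod_eq_zero_iff] at hfa
    obtain ⟨b, hb, hb0⟩ := hfa
    have hab := sub_eq_zero.1 (eq_zero_of_pow_eq_zero hb0)
    subst hab
    simp [h0] at hb0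
  · intro a ha hd
    by_contra h
    set P : ℂ → ℂ := fun z ↦ (∏ b ∈ Z.erase a, (z - b) ^ n b) * g z with hP
    have hPd : Differentiable ℂ P := by
      apply Differentiable.mul _ hg
      fun_prop
    have hPa : P a ≠ 0 := by
      apply mul_ne_zero _ (hgZ a ha)
      refine Finset.prod_ne_zero_iff.2 fun b hb ↦ pow_ne_zero _ ?_
      exact sub_ne_zero.2 (Finset.ne_of_mem_erase hb).symm
    have hfP : ∀ z, f z = (z - a) ^ n a * P z := by
      intro z
      rw [hn z, ← Finset.mul_prod_erase Z _ ha, mul_assoc]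
    have hfa := ((hZm a).1 ha).1
    interval_cases hna : n a
    · rw [hfP a] at hfa
      simp [hPa] at hfa
    · have h1 : HasDerivAt f (1 * P a + (a - a) * deriv P a) a := by
        have : f = fun z ↦ (z - a) * P z := by ext z; rw [hfP z, pow_one]
        rw [this]
        exact ((hasDerivAt_id a).sub_const a).mul (hPd a).hasDerivAt
      rw [h1.deriv] at hd
      simp [hPa] at hd
  · have hlog : logDeriv f c - ∑ a ∈ Z, n a / (c - a) = logDeriv g c := by
      have : f = fun z ↦ (∏ a ∈ Z, (z - a) ^ n a) * g z := by ext z; exact hn z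
      rw [this, logDeriv_mul c (Finset.prod_ne_zero_iff.2 fun a ha ↦ pow_ne_zero _ (hcZ a ha)) hgc
        (by fun_prop) (hg c), logDeriv_prod (f := fun a z ↦ (z - a) ^ n a)
          (fun a ha ↦ pow_ne_zero _ (hcZ a ha))
        (fun a ha ↦ by fun_prop), add_comm, add_sub_assoc, add_eq_left, sub_eq_zero]
      refine Finset.sum_congr rfl fun a ha ↦ ?_
      have h1 : DifferentiableAt ℂ (fun z ↦ z - a) c := by fun_prop
      have h2 := logDeriv_fun_pow h1 (n a)
      refine h2.trans ?_
      simp [logDeriv_apply, div_eq_mul_inv]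
    rw [hlog]
    have hsph : ∀ z ∈ sphere c r, ‖g z‖ ≤ Real.exp M * ‖g c‖ := by
      intro z hz
      have h1 := hb z (sphere_subset_closedBall hz)
      rw [hn z, hn c, norm_mul, norm_mul] at h1
      have hle : ‖∏ a ∈ Z, (c - a) ^ n a‖ ≤ ‖∏ a ∈ Z, (z - a) ^ n a‖ := by
        rw [norm_prod, norm_prod]
        refine Finset.prod_le_prod (fun _ _ ↦ norm_nonneg _) fun a ha ↦ ?_
        rw [norm_pow, norm_pow]
        refine pow_le_pow_left₀ (norm_nonneg _) ?_ _
        have ha' := ((hZm a).1 ha).2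
        rw [mem_closedBall, dist_eq_norm] at ha'
        rw [mem_sphere, dist_eq_norm] at hz
        have : ‖z - c‖ ≤ ‖z - a‖ + ‖a - c‖ := norm_sub_le_norm_sub_add_norm_sub _ _ _
        rw [norm_sub_rev c a]
        linarith
      have hpos : 0 < ‖∏ a ∈ Z, (c - a) ^ n a‖ :=
        norm_pos_iff.2 (Finset.prod_ne_zero_iff.2 fun a ha ↦ pow_ne_zero _ (hcZ a ha))
      have h2 : ‖∏ a ∈ Z, (c - a) ^ n a‖ * ‖g z‖ ≤
          ‖∏ a ∈ Z, (c - a) ^ n a‖ * (Real.exp M * ‖g c‖) := by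
        calc _ ≤ ‖∏ a ∈ Z, (z - a) ^ n a‖ * ‖g z‖ := by gcongr
          _ ≤ _ := h1.trans (le_of_eq (by ring))
      exact le_of_mul_le_mul_left h2 hpos
    have hball : ∀ z ∈ closedBall c r, ‖g z‖ ≤ Real.exp M * ‖g c‖ := by
      intro z hz
      refine Complex.norm_le_of_forall_mem_frontier_norm_le (U := ball c r) isBounded_ball
        hg.diffContOnCl ?_ (by rwa [closure_ball _ hr.ne'])
      intro w hw
      rw [frontier_ball _ hr.ne'] at hw
      exact hsph w hw
    have := norm_logDeriv_le_of_ne_zero hg (R := r / 2) (by positivity) hM (c := c) ?_ ?_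
    · refine this.trans (le_of_eq ?_)
      field_simp
      ring
    · intro z hz hz0
      have hzZ : z ∈ Z := (hZm z).2 ⟨by rw [hn, hz0, mul_zero], ball_subset_closedBall hz⟩
      exact hgZ z hzZ hz0
    · intro z hz
      exact hball z (closedBall_subset_closedBall (by linarith) (ball_subset_closedBall hz))

end

section

open Complex Metric MeasureTheory Set Filter Topology

/-- The Mellin-type integral `∫_1^∞ g(t) t^{-s-1} dt` of a bounded function is holomorphic for
`Re s > 0`. -/
lemma differentiableAt_integral_mul_cpow {g : ℝ → ℂ} (hg : Measurable g) {B : ℝ}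
    (hB : ∀ t, 1 < t → ‖g t‖ ≤ B) {s : ℂ} (hs : 0 < s.re) :
    DifferentiableAt ℂ (fun s ↦ ∫ t in Ioi (1 : ℝ), g t * (t : ℂ) ^ (-(s + 1))) s := by
  set f : ℝ → ℂ := (Ioi (1 : ℝ)).indicator g with hf
  have hfm : Measurable f := hg.indicator measurableSet_Ioi
  have hfb : ∀ t, ‖f t‖ ≤ |B| := by
    intro t
    by_cases ht : t ∈ Ioi (1 : ℝ)
    · rw [hf, indicator_of_mem ht]; exact (hB t ht).trans (le_abs_self B)
    · rw [hf, indicator_of_notMem ht]; simp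
  have h1 : (fun s : ℂ ↦ ∫ t in Ioi (1 : ℝ), g t * (t : ℂ) ^ (-(s + 1))) =
      fun s ↦ mellin f (-s) := by
    ext s
    rw [mellin, ← integral_indicator measurableSet_Ioi, ← integral_indicator measurableSet_Ioi]
    congr 1
    ext t
    by_cases ht : t ∈ Ioi (1 : ℝ)
    · have ht0 : t ∈ Ioi (0 : ℝ) := lt_trans one_pos (mem_Ioi.1 ht)
      rw [indicator_of_mem ht, indicator_of_mem ht0, hf, indicator_of_mem ht, smul_eq_mul,
        mul_comm, neg_add']
    · rw [indicator_of_notMem ht]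
      simp [indicator, hf, ht]
  rw [h1]
  have h2 : DifferentiableAt ℂ (mellin f) (-s) := by
    refine mellin_differentiableAt_of_isBigO_rpow (a := 0) (b := -s.re - 1) ?_ ?_ (by simpa) ?_
      (by simp)
    · refine (MeasureTheory.LocallyIntegrable.locallyIntegrableOn ?_ _)
      intro x
      refine ⟨ball x 1, ball_mem_nhds x one_pos, ?_⟩
      refine Measure.integrableOn_of_bounded (M := |B|) measure_ball_lt_top.ne
        hfm.aestronglyMeasurable (Eventually.of_forall hfb)
    · refine Asymptotics.IsBigO.of_bound |B| (Eventually.of_forall fun t ↦ ?_)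
      simpa using hfb t
    · refine Asymptotics.IsBigO.of_bound 1 ?_
      have : Ioo (0 : ℝ) 1 ∈ 𝓝[>] (0 : ℝ) := Ioo_mem_nhdsGT one_pos
      filter_upwards [this] with t ht
      have : t ∉ Ioi (1 : ℝ) := by simpa using ht.2.le
      rw [hf, indicator_of_notMem this]
      simp
  exact h2.comp s differentiableAt_id.neg

lemma norm_integral_mul_cpow_le {g : ℝ → ℂ} {B : ℝ}
    (hB : ∀ t, 1 < t → ‖g t‖ ≤ B) {s : ℂ} (hs : 0 < s.re) {a : ℝ} (ha : 1 ≤ a) :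
    ‖∫ t in Ioi a, g t * (t : ℂ) ^ (-(s + 1))‖ ≤ B * a ^ (-s.re) / s.re := by
  have ha0 : 0 < a := by linarith
  have h1 : ∫ t in Ioi a, B * t ^ (-s.re - 1) = B * a ^ (-s.re) / s.re := by
    rw [integral_const_mul, integral_Ioi_rpow_of_lt (by linarith) ha0]
    simp [neg_div_neg_eq, mul_div_assoc]
  rw [← h1]
  refine norm_integral_le_of_norm_le ((integrableOn_Ioi_rpow_of_lt (by linarith) ha0).const_mul _)
    ?_
  filter_upwards [ae_restrict_mem measurableSet_Ioi] with t ht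
  have ht1 : 1 < t := lt_of_le_of_lt ha ht
  rw [norm_mul, norm_cpow_eq_rpow_re_of_pos (by linarith)]
  have : (-(s + 1)).re = -s.re - 1 := by simp; ring
  rw [this]
  exact mul_le_mul_of_nonneg_right (hB t ht1) (Real.rpow_nonneg (by linarith) _)

lemma eqOn_of_eqOn_one_lt_re {F G : ℂ → ℂ} (hF : ∀ s : ℂ, 0 < s.re → DifferentiableAt ℂ F s)
    (hG : ∀ s : ℂ, 0 < s.re → DifferentiableAt ℂ G s) (h : ∀ s : ℂ, 1 < s.re → F s = G s)
    {s : ℂ} (hs : 0 < s.re) : F s = G s := by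
  have ho : IsOpen {s : ℂ | 0 < s.re} := isOpen_lt continuous_const continuous_re
  have hF' : AnalyticOnNhd ℂ F {s : ℂ | 0 < s.re} :=
    DifferentiableOn.analyticOnNhd (fun z hz ↦ (hF z hz).differentiableWithinAt) ho
  have hG' : AnalyticOnNhd ℂ G {s : ℂ | 0 < s.re} :=
    DifferentiableOn.analyticOnNhd (fun z hz ↦ (hG z hz).differentiableWithinAt) ho
  refine hF'.eqOn_of_preconnected_of_eventuallyEq hG' (convex_halfSpace_re_gt 0).isPreconnected
    (z₀ := 2) (by simp) ?_ hs
  have : {s : ℂ | 1 < s.re} ∈ 𝓝 (2 : ℂ) :=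
    (isOpen_lt continuous_const continuous_re).mem_nhds (by simp)
  filter_upwards [this] with z hz using h z hz

/-- Partial sums of a nontrivial Dirichlet character. -/
lemma norm_sum_Icc_le {N : ℕ} [NeZero N] {χ : DirichletCharacter ℂ N} (hχ : χ ≠ 1) (n : ℕ) :
    ‖∑ k ∈ Finset.Icc 1 n, χ k‖ ≤ N := by
  have hN1 : N ≠ 1 := by
    rintro rfl
    exact hχ (DirichletCharacter.level_one χ)
  have h0 : χ ((0 : ℕ) : ZMod N) = 0 := by
    have : Fact (1 < N) := ⟨by have := NeZero.ne N; omega⟩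
    rw [Nat.cast_zero]
    exact χ.map_nonunit not_isUnit_zero
  have hI : ∑ k ∈ Finset.Icc 1 n, χ k = ∑ k ∈ Finset.range (n + 1), χ k := by
    rw [Finset.range_eq_Ico, Finset.sum_eq_sum_Ico_succ_bot (by omega), h0, zero_add]
    rfl
  have hper : ∑ k ∈ Finset.range N, χ k = 0 := by
    rw [← MulChar.sum_eq_zero_of_ne_one hχ]
    refine Finset.sum_bij (fun k _ ↦ (k : ZMod N)) (by simp) ?_ ?_ (by simp)
    · intro a ha b hb hab
      rw [ZMod.natCast_eq_natCast_iff] at hab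
      exact Nat.ModEq.eq_of_lt_of_lt hab (Finset.mem_range.1 ha) (Finset.mem_range.1 hb)
    · intro b _
      exact ⟨b.val, Finset.mem_range.2 (ZMod.val_lt b), ZMod.natCast_zmod_val b⟩
  have hm : ∀ m : ℕ, ∀ r : ℕ, ∑ k ∈ Finset.range (N * m + r), χ k = ∑ k ∈ Finset.range r, χ k := by
    intro m r
    induction m with
    | zero => simp
    | succ m ih =>
      rw [show N * (m + 1) + r = N + (N * m + r) by ring, Finset.sum_range_add, hper, zero_add,
        ← ih]
      simp
  rw [hI, ← Nat.div_add_mod (n + 1) N, hm]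
  refine (norm_sum_le _ _).trans ?_
  refine (Finset.sum_le_sum (g := fun _ ↦ (1 : ℝ)) fun (k : ℕ) _ ↦ χ.norm_le_one k).trans ?_
  simp
  exact (Nat.mod_lt _ (NeZero.pos N)).le

lemma norm_sum_Icc_floor_le {N : ℕ} (χ : DirichletCharacter ℂ N) {t : ℝ} (ht : 0 ≤ t) :
    ‖∑ k ∈ Finset.Icc 1 ⌊t⌋₊, χ k‖ ≤ t := by
  refine (norm_sum_le _ _).trans ?_
  refine (Finset.sum_le_sum (g := fun _ ↦ (1 : ℝ)) fun (k : ℕ) _ ↦ χ.norm_le_one k).trans ?_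
  simpa using Nat.floor_le ht

lemma measurable_sum_Icc_floor (f : ℕ → ℂ) :
    Measurable fun t : ℝ ↦ ∑ k ∈ Finset.Icc 1 ⌊t⌋₊, f k :=
  (measurable_from_nat (f := fun n ↦ ∑ k ∈ Finset.Icc 1 n, f k)).comp Nat.measurable_floor

lemma DirichletCharacter.LFunction_eq_mul_integral {N : ℕ} [NeZero N]
    {χ : DirichletCharacter ℂ N} (hχ : χ ≠ 1) {s : ℂ} (hs : 0 < s.re) :
    χ.LFunction s =
      s * ∫ t in Ioi (1 : ℝ), (∑ k ∈ Finset.Icc 1 ⌊t⌋₊, χ k) * (t : ℂ) ^ (-(s + 1)) := by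
  refine eqOn_of_eqOn_one_lt_re (F := χ.LFunction)
    (G := fun s ↦ s * ∫ t in Ioi (1 : ℝ), (∑ k ∈ Finset.Icc 1 ⌊t⌋₊, χ k) * (t : ℂ) ^ (-(s + 1)))
    (fun s _ ↦ χ.differentiable_LFunction hχ s)
    (fun s hs ↦ differentiableAt_id.mul (differentiableAt_integral_mul_cpow
      (measurable_sum_Icc_floor _) (fun t _ ↦ norm_sum_Icc_le hχ _) hs)) ?_ hs
  intro s hs
  rw [χ.LFunction_eq_LSeries hs]
  refine LSeries_eq_mul_integral _ le_rfl (by linarith)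
    (DirichletCharacter.LSeriesSummable_of_one_lt_re χ hs) ?_
  refine Asymptotics.IsBigO.of_bound N (Eventually.of_forall fun n ↦ ?_)
  simpa using norm_sum_Icc_le hχ n

lemma DirichletCharacter.norm_LFunction_le {N : ℕ} [NeZero N]
    {χ : DirichletCharacter ℂ N} (hχ : χ ≠ 1) {s : ℂ} (hs : 0 < s.re) :
    ‖χ.LFunction s‖ ≤ N * ‖s‖ / s.re := by
  rw [χ.LFunction_eq_mul_integral hχ hs, norm_mul]
  have := norm_integral_mul_cpow_le (g := fun t ↦ ∑ k ∈ Finset.Icc 1 ⌊t⌋₊, χ k)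
    (fun t _ ↦ norm_sum_Icc_le hχ _) hs le_rfl
  calc _ ≤ ‖s‖ * _ := mul_le_mul_of_nonneg_left this (norm_nonneg _)
    _ = _ := by simp; ring

/-- `(s - 1) ζ(s)` in the half plane `Re s > 0`. -/
lemma norm_sub_one_mul_riemannZeta_le {s : ℂ} (hs : 0 < s.re) (hs1 : s ≠ 1) :
    ‖(s - 1) * riemannZeta s‖ ≤ ‖s‖ + ‖s - 1‖ * ‖s‖ / s.re := by
  set g : ℝ → ℂ := fun t ↦ (∑ k ∈ Finset.Icc 1 ⌊t⌋₊, (1 : ℂ)) - t with hg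
  have hgm : Measurable g := (measurable_sum_Icc_floor _).sub measurable_ofReal
  have hgb : ∀ t, 1 < t → ‖g t‖ ≤ 1 := by
    intro t ht
    have h1 := Nat.floor_le (by linarith : 0 ≤ t)
    have h2 := Nat.lt_floor_add_one t
    have : g t = ((⌊t⌋₊ - t : ℝ) : ℂ) := by simp [hg]
    rw [this, norm_real, Real.norm_eq_abs, abs_le]
    constructor <;> linarith
  have key : ∀ s : ℂ, 0 < s.re → (DirichletCharacter.LFunctionTrivChar₁ 1) s =
      s + (s - 1) * (s * ∫ t in Ioi (1 : ℝ), g t * (t : ℂ) ^ (-(s + 1))) := by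
    intro s hs
    refine eqOn_of_eqOn_one_lt_re (F := DirichletCharacter.LFunctionTrivChar₁ 1)
      (G := fun s ↦ s + (s - 1) * (s * ∫ t in Ioi (1 : ℝ), g t * (t : ℂ) ^ (-(s + 1))))
      (fun s _ ↦ DirichletCharacter.differentiable_LFunctionTrivChar₁ 1 s)
      (fun s hs ↦ differentiableAt_id.add ((differentiableAt_id.sub_const _).mul
        (differentiableAt_id.mul (differentiableAt_integral_mul_cpow hgm hgb hs)))) ?_ hs
    intro s hs
    have hs0 : s ≠ 0 := by rintro rfl; simp at hs; linarith
    have hs1 : s ≠ 1 := by rintro rfl; simp at hs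
    have h1 : DirichletCharacter.LFunctionTrivChar₁ 1 s = (s - 1) * riemannZeta s := by
      rw [DirichletCharacter.LFunctionTrivChar₁, Function.update_of_ne hs1,
        ← DirichletCharacter.LFunction_modOne_eq (χ := 1)]

    rw [h1, ← LSeries_one_eq_riemannZeta hs, LSeries_eq_mul_integral' 1 zero_le_one hs]
    · have h2 : ∫ t in Ioi (1 : ℝ), (t : ℂ) * (t : ℂ) ^ (-(s + 1)) = 1 / (s - 1) := by
        have : ∫ t in Ioi (1 : ℝ), (t : ℂ) * (t : ℂ) ^ (-(s + 1)) =
            ∫ t in Ioi (1 : ℝ), (t : ℂ) ^ (-s) := by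
          refine setIntegral_congr_fun measurableSet_Ioi fun t ht ↦ ?_
          have : (t : ℂ) ≠ 0 := by
            have : (0 : ℝ) < t := lt_trans one_pos ht
            exact_mod_cast this.ne'
          rw [neg_add', cpow_sub _ _ this, cpow_one]
          field_simp
        rw [this, integral_Ioi_cpow_of_lt (by simpa using hs) one_pos]
        have : s - 1 ≠ 0 := sub_ne_zero.2 hs1
        have : -s + 1 ≠ 0 := by intro h; apply this; linear_combination -h
        simp
        field_simp
        ring
      have h3 : ∫ t in Ioi (1 : ℝ), (∑ k ∈ Finset.Icc 1 ⌊t⌋₊, (1 : ℕ → ℂ) k) *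
            (t : ℂ) ^ (-(s + 1)) = (∫ t in Ioi (1 : ℝ), g t * (t : ℂ) ^ (-(s + 1))) +
          ∫ t in Ioi (1 : ℝ), (t : ℂ) * (t : ℂ) ^ (-(s + 1)) := by
        rw [← integral_add]
        · refine setIntegral_congr_fun measurableSet_Ioi fun t ht ↦ ?_
          simp only [hg, Pi.one_apply]
          ring
        · refine Integrable.mono' (integrableOn_Ioi_rpow_of_lt (a := -s.re - 1)
            (by linarith) one_pos) ?_ ?_
          · exact (hgm.mul (by fun_prop)).aestronglyMeasurable
          · filter_upwards [ae_restrict_mem measurableSet_Ioi] with t ht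
            rw [norm_mul, norm_cpow_eq_rpow_re_of_pos (lt_trans one_pos ht)]
            have : (-(s + 1)).re = -s.re - 1 := by simp; ring
            rw [this]
            exact mul_le_of_le_one_left (Real.rpow_nonneg (lt_trans one_pos ht).le _) (hgb t ht)
        · refine Integrable.mono' (integrableOn_Ioi_rpow_of_lt (a := -s.re)
            (by linarith) one_pos) ?_ ?_
          · exact (measurable_ofReal.mul (by fun_prop)).aestronglyMeasurable
          · filter_upwards [ae_restrict_mem measurableSet_Ioi] with t ht
            have ht0 : 0 < t := lt_trans one_pos ht
            rw [norm_mul, norm_cpow_eq_rpow_re_of_pos ht0, norm_real, Real.norm_of_nonneg ht0.le]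
            have : (-(s + 1)).re = -s.re - 1 := by simp; ring
            rw [this, Real.rpow_sub_one ht0.ne']
            apply le_of_eq
            field_simp
      rw [h3, h2]
      have : s - 1 ≠ 0 := sub_ne_zero.2 hs1
      field_simp
      ring
    · refine Asymptotics.IsBigO.of_bound 1 (Eventually.of_forall fun n ↦ ?_)
      simp
  have h1 : DirichletCharacter.LFunctionTrivChar₁ 1 s = (s - 1) * riemannZeta s := by
    rw [DirichletCharacter.LFunctionTrivChar₁, Function.update_of_ne hs1,
      ← DirichletCharacter.LFunction_modOne_eq (χ := 1)]
  rw [← h1, key s hs]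
  refine (norm_add_le _ _).trans ?_
  have := norm_integral_mul_cpow_le hgb hs le_rfl
  rw [norm_mul, norm_mul, mul_div_assoc]
  gcongr
  simpa [mul_div_assoc, div_eq_mul_inv] using mul_le_mul_of_nonneg_left this (norm_nonneg s)

end

section

open Complex Metric MeasureTheory Set Filter Topology

lemma norm_LSeries_le_of_norm_le_one {f : ℕ → ℂ} (hf : ∀ n, ‖f n‖ ≤ 1) {s : ℂ} (hs : 1 < s.re) :
    ‖LSeries f s‖ ≤ ‖riemannZeta (s.re : ℂ)‖ := by
  have hsum : Summable fun n : ℕ ↦ 1 / (n : ℝ) ^ s.re := Real.summable_one_div_nat_rpow.2 hs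
  have hz : riemannZeta (s.re : ℂ) = ((∑' n : ℕ, 1 / (n : ℝ) ^ s.re : ℝ) : ℂ) := by
    rw [zeta_eq_tsum_one_div_nat_cpow (by simpa using hs), ofReal_tsum]
    refine tsum_congr fun n ↦ ?_
    rw [ofReal_div, ofReal_cpow (Nat.cast_nonneg n)]
    simp
  have hnn : 0 ≤ ∑' n : ℕ, 1 / (n : ℝ) ^ s.re := tsum_nonneg fun n ↦ by positivity
  rw [hz, norm_real, Real.norm_of_nonneg hnn]
  refine tsum_of_norm_bounded hsum.hasSum fun n ↦ ?_
  rw [LSeries.norm_term_eq]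
  split_ifs with h
  · positivity
  · gcongr
    exact hf n

lemma norm_riemannZeta_ofReal_le {σ : ℝ} (h1 : 1 < σ) (h2 : σ ≤ 2) :
    ‖riemannZeta (σ : ℂ)‖ ≤ 4 / (σ - 1) := by
  have h := norm_sub_one_mul_riemannZeta_le (s := (σ : ℂ)) (by simp; linarith)
    (by intro h; rw [← ofReal_one, ofReal_inj] at h; linarith)
  have h3 : (σ : ℂ) - 1 = ((σ - 1 : ℝ) : ℂ) := by simp
  rw [h3, norm_mul, norm_real, norm_real, ofReal_re, Real.norm_of_nonneg (by linarith),
    Real.norm_of_nonneg (by linarith), mul_div_assoc, div_self (by linarith)] at h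
  rw [le_div_iff₀ (by linarith)]
  nlinarith

namespace DirichletCharacter

/-- The real part of the negative logarithmic derivative of `L(s, χ)` for `Re s > 1`. -/
noncomputable def reNegLogDeriv {N : ℕ} (χ : DirichletCharacter ℂ N) (s : ℂ) : ℝ :=
  (LSeries ((fun n : ℕ => χ n) * fun n => (ArithmeticFunction.vonMangoldt n : ℂ)) s).re

variable {N : ℕ} [NeZero N]

lemma le_norm_LFunction (χ : DirichletCharacter ℂ N) {s : ℂ} (h1 : 1 < s.re) (h2 : s.re ≤ 2) :
    (s.re - 1) / 4 ≤ ‖χ.LFunction s‖ := by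
  have h := LSeries.mul_mu_eq_one χ h1
  have hb : ‖LSeries ((fun n : ℕ => χ n) * fun n => (ArithmeticFunction.moebius n : ℂ)) s‖
      ≤ 4 / (s.re - 1) := by
    refine (norm_LSeries_le_of_norm_le_one (fun n ↦ ?_) h1).trans (norm_riemannZeta_ofReal_le h1 h2)
    rw [Pi.mul_apply, norm_mul]
    refine mul_le_one₀ (χ.norm_le_one _) (norm_nonneg _) ?_
    rw [Complex.norm_intCast]
    exact_mod_cast ArithmeticFunction.abs_moebius_le_one
  rw [χ.LFunction_eq_LSeries h1]
  have h' := congrArg norm h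
  rw [norm_mul, norm_one] at h'
  have h3 : 1 ≤ ‖LSeries (fun n : ℕ ↦ χ n) s‖ * (4 / (s.re - 1)) :=
    h'.ge.trans (mul_le_mul_of_nonneg_left hb (norm_nonneg _))
  have h4 : 0 < s.re - 1 := by linarith
  rw [← mul_div_assoc, le_div_iff₀ h4] at h3
  linarith


lemma norm_LFunctionTrivChar₁_le {s : ℂ} (hs : 0 < s.re) :
    ‖LFunctionTrivChar₁ N s‖ ≤ N * (‖s‖ + ‖s - 1‖ * ‖s‖ / s.re) := by
  have hp : ∀ s : ℂ, 0 < s.re → ‖∏ p ∈ N.primeFactors, (1 - (p : ℂ) ^ (-s))‖ ≤ N := by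
    intro s hs
    have h2 : ∏ p ∈ N.primeFactors, p ≤ N :=
      Nat.le_of_dvd (NeZero.pos N) (Nat.prod_primeFactors_dvd N)
    refine le_trans ?_ (Nat.cast_le.2 h2)
    rw [norm_prod, Nat.cast_prod]
    refine Finset.prod_le_prod (fun _ _ ↦ norm_nonneg _) fun p hp ↦ ?_
    have hp' := Nat.prime_of_mem_primeFactors hp
    have h3 : ‖(p : ℂ) ^ (-s)‖ ≤ 1 := by
      rw [norm_natCast_cpow_of_pos hp'.pos]
      exact Real.rpow_le_one_of_one_le_of_nonpos (by exact_mod_cast hp'.one_le)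
        (by simpa using hs.le)
    have h4 : (2 : ℝ) ≤ p := by exact_mod_cast hp'.two_le
    calc _ ≤ ‖(1 : ℂ)‖ + ‖(p : ℂ) ^ (-s)‖ := norm_sub_le _ _
      _ ≤ 2 := by rw [norm_one]; linarith
      _ ≤ p := h4
  have hne : ∀ s : ℂ, 0 < s.re → s ≠ 1 →
      ‖LFunctionTrivChar₁ N s‖ ≤ N * (‖s‖ + ‖s - 1‖ * ‖s‖ / s.re) := by
    intro s hs hs1
    rw [LFunctionTrivChar₁, Function.update_of_ne hs1, LFunctionTrivChar_eq_mul_riemannZeta hs1,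
      mul_left_comm, norm_mul]
    gcongr
    · exact hp s hs
    · exact norm_sub_one_mul_riemannZeta_le hs hs1
  by_cases hs1 : s = 1
  · subst hs1
    have hl : Tendsto (fun s ↦ ‖LFunctionTrivChar₁ N s‖) (𝓝[≠] 1) (𝓝 ‖LFunctionTrivChar₁ N 1‖) :=
      ((differentiable_LFunctionTrivChar₁ N).continuous.norm.tendsto 1).mono_left nhdsWithin_le_nhds
    have hr : ContinuousAt (fun s : ℂ ↦ N * (‖s‖ + ‖s - 1‖ * ‖s‖ / s.re)) 1 := by
      refine ContinuousAt.mul continuousAt_const (ContinuousAt.add (by fun_prop)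
        (ContinuousAt.div (by fun_prop) (by fun_prop) (by simp)))
    refine le_of_tendsto_of_tendsto hl (hr.tendsto.mono_left nhdsWithin_le_nhds) ?_
    have : {s : ℂ | 0 < s.re} ∈ 𝓝 (1 : ℂ) :=
      (isOpen_lt continuous_const continuous_re).mem_nhds (by simp)
    filter_upwards [self_mem_nhdsWithin, mem_nhdsWithin_of_mem_nhds this] with z hz hz'
    exact hne z hz' hz
  · exact hne s hs hs1

lemma reNegLogDeriv_eq (χ : DirichletCharacter ℂ N) {s : ℂ} (hs : 1 < s.re) :
    χ.reNegLogDeriv s = (-logDeriv χ.LFunction s).re := by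
  rw [reNegLogDeriv, LSeries_twist_vonMangoldt_eq χ hs, logDeriv_apply,
    deriv_LFunction_eq_deriv_LSeries χ hs, LFunction_eq_LSeries χ hs, neg_div]

end DirichletCharacter

lemma re_neg_logDeriv_le {f : ℂ → ℂ} (hf : Differentiable ℂ f) {c : ℂ} {M : ℝ}
    (hM : 0 < M) (hc : f c ≠ 0)
    (hb : ∀ z ∈ closedBall c (1 / 2), ‖f z‖ ≤ Real.exp M * ‖f c‖)
    (hz : ∀ a, f a = 0 → a.re ≤ c.re) {W : Finset ℂ} {m : ℂ → ℕ}
    (hW : ∀ a ∈ W, f a = 0 ∧ ‖c - a‖ ≤ 1 / 4 ∧ (m a ≤ 1 ∨ m a ≤ 2 ∧ deriv f a = 0)) :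
    (-logDeriv f c).re ≤ 16 * M - ∑ a ∈ W, m a * (1 / (c - a)).re := by
  obtain ⟨Z, n, hZ, h1, h2, h⟩ := exists_logDeriv_eq_sum hf (by norm_num) hM hc hb
  have hWZ : W ⊆ Z := by
    intro a ha
    obtain ⟨h3, h4, -⟩ := hW a ha
    refine (hZ a).2 ⟨h3, ?_⟩
    rw [mem_closedBall, dist_comm, dist_eq_norm]
    linarith
  have hnn : ∀ a ∈ Z, 0 ≤ (1 / (c - a)).re := by
    intro a ha
    rw [one_div, inv_re]
    refine div_nonneg ?_ (normSq_nonneg _)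
    have := hz a ((hZ a).1 ha).1
    simpa using this
  have h3 : ∑ a ∈ W, m a * (1 / (c - a)).re ≤ (∑ a ∈ Z, n a / (c - a)).re := by
    rw [re_sum]
    have h4 : ∀ a, ((n a : ℂ) / (c - a)).re = n a * (1 / (c - a)).re := by
      intro a
      rw [div_eq_mul_one_div, ← re_ofReal_mul]
      simp
    simp only [h4]
    refine (Finset.sum_le_sum fun a ha ↦ ?_).trans
      (Finset.sum_le_sum_of_subset_of_nonneg hWZ fun a ha _ ↦
        mul_nonneg (Nat.cast_nonneg _) (hnn a ha))
    refine mul_le_mul_of_nonneg_right ?_ (hnn a (hWZ ha))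
    obtain ⟨-, -, h5⟩ := hW a ha
    rcases h5 with h5 | ⟨h5, h6⟩
    · exact_mod_cast h5.trans (h1 a (hWZ ha))
    · exact_mod_cast h5.trans (h2 a (hWZ ha) h6)
  have h5 := (abs_re_le_norm (logDeriv f c - ∑ a ∈ Z, n a / (c - a))).trans h
  rw [sub_re, abs_le] at h5
  rw [neg_re]
  have := h5.1
  linarith [show 8 * M / (1 / 2) = 16 * M by ring]

namespace DirichletCharacter

variable {N : ℕ} [NeZero N]

lemma reNegLogDeriv_le {χ : DirichletCharacter ℂ N} (hχ : χ ≠ 1) {T : ℝ} (hT : 100 ≤ T)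
    (hN : (N : ℝ) ≤ T ^ 2) {c : ℂ} (h1 : 1 + 1 / T ≤ c.re) (h2 : c.re ≤ 2) (h3 : |c.im| ≤ 2 * T)
    {W : Finset ℂ} {m : ℂ → ℕ} (hW : ∀ a ∈ W, χ.LFunction a = 0 ∧ ‖c - a‖ ≤ 1 / 4 ∧
      (m a ≤ 1 ∨ m a ≤ 2 ∧ deriv χ.LFunction a = 0)) :
    χ.reNegLogDeriv c ≤ 160 * Real.log T - ∑ a ∈ W, m a * (1 / (c - a)).re := by
  have hT0 : 0 < T := by linarith
  have hT1 : 0 < 1 / T := by positivity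
  have hlog : 0 < Real.log T := Real.log_pos (by linarith)
  have hlow := le_norm_LFunction χ (by linarith) h2
  have hlow' : 1 / T / 4 ≤ ‖χ.LFunction c‖ := by linarith
  rw [reNegLogDeriv_eq χ (by linarith)]
  refine (re_neg_logDeriv_le (χ.differentiable_LFunction hχ) (M := 10 * Real.log T)
    (by positivity) ?_ ?_ ?_ hW).trans (le_of_eq (by ring))
  · exact χ.LFunction_ne_zero_of_one_le_re (.inl hχ) (by linarith)
  · intro z hz
    rw [mem_closedBall, dist_eq_norm] at hz
    have h4 := (abs_re_le_norm (z - c)).trans hz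
    rw [sub_re, abs_le] at h4
    have h5 : 1 / 2 ≤ z.re := by linarith [h4.1]
    have h6 : ‖c‖ ≤ 2 + 2 * T := by
      refine (norm_le_abs_re_add_abs_im c).trans ?_
      rw [abs_of_nonneg (by linarith)]
      linarith
    have h7 : ‖z‖ ≤ 3 * T := by
      have := norm_le_norm_add_norm_sub' z c
      linarith
    have h8 := norm_LFunction_le hχ (s := z) (by linarith)
    have h9 : Real.exp (10 * Real.log T) = T ^ 10 := by
      rw [mul_comm, Real.exp_mul, Real.exp_log hT0]
      norm_cast
    rw [h9]
    calc _ ≤ N * ‖z‖ / z.re := h8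
      _ ≤ T ^ 2 * (3 * T) / (1 / 2) := by gcongr
      _ = 6 * T ^ 3 := by ring
      _ ≤ T ^ 6 * T ^ 3 / 4 := by
        have : (24 : ℝ) ≤ T ^ 6 := by
          calc (24 : ℝ) ≤ 100 ^ 6 := by norm_num
            _ ≤ T ^ 6 := by gcongr
        nlinarith [pow_pos hT0 3]
      _ = T ^ 10 * (1 / T / 4) := by field_simp
      _ ≤ _ := by gcongr
  · intro a ha
    by_contra! h
    exact χ.LFunction_ne_zero_of_one_le_re (.inl hχ) (by linarith) ha

lemma reNegLogDeriv_one_le {T : ℝ} (hT : 100 ≤ T)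
    (hN : (N : ℝ) ≤ T ^ 2) {c : ℂ} (h1 : 1 + 1 / T ≤ c.re) (h2 : c.re ≤ 2) (h3 : |c.im| ≤ 2 * T)
    {W : Finset ℂ} {m : ℂ → ℕ} (hW : ∀ a ∈ W, LFunctionTrivChar₁ N a = 0 ∧ ‖c - a‖ ≤ 1 / 4 ∧
      (m a ≤ 1 ∨ m a ≤ 2 ∧ deriv (LFunctionTrivChar₁ N) a = 0)) :
    (1 : DirichletCharacter ℂ N).reNegLogDeriv c ≤
      (1 / (c - 1)).re + 160 * Real.log T - ∑ a ∈ W, m a * (1 / (c - a)).re := by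
  have hT0 : 0 < T := by linarith
  have hT1 : 0 < 1 / T := by positivity
  have hlog : 0 < Real.log T := Real.log_pos (by linarith)
  have hne : ∀ c : ℂ, 1 ≤ c.re → LFunctionTrivChar₁ N c ≠ 0 := by
    intro c hc
    by_cases hc1 : c = 1
    · rw [hc1]; exact LFunctionTrivChar₁_apply_one_ne_zero N
    · rw [LFunctionTrivChar₁, Function.update_of_ne hc1]
      exact mul_ne_zero (sub_ne_zero.2 hc1) (LFunction_ne_zero_of_one_le_re _ (.inr hc1) hc)
  have hlow := le_norm_LFunction (1 : DirichletCharacter ℂ N) (by linarith) h2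
  have hlow' : 1 / T / 4 ≤ ‖(1 : DirichletCharacter ℂ N).LFunction c‖ := by linarith
  have hc1 : c ≠ 1 := by rintro rfl; simp at h1; linarith
  have hc1' : c - 1 ≠ 0 := sub_ne_zero.2 hc1
  have hL0 : LFunctionTrivChar N c ≠ 0 := LFunction_ne_zero_of_one_le_re _ (.inr hc1) (by linarith)
  have hfc : LFunctionTrivChar₁ N c = (c - 1) * LFunctionTrivChar N c := by
    rw [LFunctionTrivChar₁, Function.update_of_ne hc1]
  have hc1n : 1 / T ≤ ‖c - 1‖ := by
    have := (le_abs_self _).trans (abs_re_le_norm (c - 1))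
    rw [sub_re, one_re] at this
    linarith
  have hd : -logDeriv (1 : DirichletCharacter ℂ N).LFunction c =
      1 / (c - 1) + -logDeriv (LFunctionTrivChar₁ N) c := by
    rw [logDeriv_apply, logDeriv_apply, deriv_LFunctionTrivChar₁_apply_of_ne_one N hc1, hfc]
    change -(deriv (LFunctionTrivChar N) c / LFunctionTrivChar N c) = _
    field_simp
    ring
  rw [reNegLogDeriv_eq _ (by linarith), hd, add_re, add_sub_assoc]
  refine add_le_add_right ((re_neg_logDeriv_le (differentiable_LFunctionTrivChar₁ N)
    (M := 10 * Real.log T)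
    (by positivity) (hne c (by linarith)) ?_ ?_ hW).trans (le_of_eq (by ring))) _
  · intro z hz
    rw [mem_closedBall, dist_eq_norm] at hz
    have h4 := (abs_re_le_norm (z - c)).trans hz
    rw [sub_re, abs_le] at h4
    have h5 : 1 / 2 ≤ z.re := by linarith [h4.1]
    have h6 : ‖c‖ ≤ 2 + 2 * T := by
      refine (norm_le_abs_re_add_abs_im c).trans ?_
      rw [abs_of_nonneg (by linarith)]
      linarith
    have h7 : ‖z‖ ≤ 3 * T := by
      have := norm_le_norm_add_norm_sub' z c
      linarith
    have h7' : ‖z - 1‖ ≤ 4 * T := by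
      have := norm_sub_le z 1
      rw [norm_one] at this
      linarith
    have h8 := norm_LFunctionTrivChar₁_le (N := N) (s := z) (by linarith)
    have h9 : Real.exp (10 * Real.log T) = T ^ 10 := by
      rw [mul_comm, Real.exp_mul, Real.exp_log hT0]
      norm_cast
    rw [h9, hfc, norm_mul]
    have h10 : 1 ≤ T := by linarith
    calc _ ≤ N * (‖z‖ + ‖z - 1‖ * ‖z‖ / z.re) := h8
      _ ≤ T ^ 2 * (3 * T + 4 * T * (3 * T) / (1 / 2)) := by gcongr
      _ ≤ T ^ 2 * (27 * T ^ 2) := by gcongr; nlinarith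
      _ = 27 * T ^ 4 := by ring
      _ ≤ T ^ 4 * T ^ 4 / 4 := by
        have : (108 : ℝ) ≤ T ^ 4 := by
          calc (108 : ℝ) ≤ 100 ^ 4 := by norm_num
            _ ≤ T ^ 4 := by gcongr
        nlinarith [pow_pos hT0 4]
      _ = T ^ 10 * (1 / T * (1 / T / 4)) := by field_simp
      _ ≤ _ := by gcongr
  · intro a ha
    by_contra! h
    exact hne a (by linarith) ha

end DirichletCharacter

/-- Nonnegativity of combinations of logarithmic derivatives. -/
lemma DirichletCharacter.sum_reNegLogDeriv_nonneg {N : ℕ} {ι : Type*} (S : Finset ι) (w : ι → ℝ)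
    (χ : ι → DirichletCharacter ℂ N) (s : ι → ℂ) {σ : ℝ} (hσ : 1 < σ) (hs : ∀ i ∈ S, (s i).re = σ)
    (h : ∀ n : ℕ, n ≠ 0 → 0 ≤ ∑ i ∈ S, w i * (χ i n * (n : ℂ) ^ (-((s i).im * I))).re) :
    0 ≤ ∑ i ∈ S, w i * (χ i).reNegLogDeriv (s i) := by
  have hsum : ∀ i ∈ S, HasSum (fun n ↦ w i * (LSeries.term ((fun n : ℕ => χ i n) *
      fun n => (ArithmeticFunction.vonMangoldt n : ℂ)) (s i) n).re)
      (w i * (χ i).reNegLogDeriv (s i)) := by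
    intro i hi
    exact (hasSum_re (LSeriesSummable_twist_vonMangoldt (χ i)
      (by rw [hs i hi]; exact hσ)).hasSum).mul_left _
  refine (hasSum_sum hsum).nonneg fun n ↦ ?_
  rcases eq_or_ne n 0 with rfl | hn
  · simp
  have hn0 : (n : ℂ) ≠ 0 := by exact_mod_cast hn
  have hterm : ∀ i ∈ S, w i * (LSeries.term ((fun n : ℕ => χ i n) *
      fun n => (ArithmeticFunction.vonMangoldt n : ℂ)) (s i) n).re =
      (ArithmeticFunction.vonMangoldt n * (n : ℝ) ^ (-σ)) *
        (w i * (χ i n * (n : ℂ) ^ (-((s i).im * I))).re) := by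
    intro i hi
    have h1 : LSeries.term ((fun n : ℕ => χ i n) *
        fun n => (ArithmeticFunction.vonMangoldt n : ℂ)) (s i) n =
        ((ArithmeticFunction.vonMangoldt n * (n : ℝ) ^ (-σ) : ℝ) : ℂ) *
        (χ i n * (n : ℂ) ^ (-((s i).im * I))) := by
      rw [LSeries.term_of_ne_zero hn, Pi.mul_apply, div_eq_mul_inv, ← cpow_neg]
      have h2 : -(s i) = ((-σ : ℝ) : ℂ) + -((s i).im * I) := by
        rw [← hs i hi]
        conv_lhs => rw [← re_add_im (s i)]
        push_cast
        ring
      rw [h2, cpow_add _ _ hn0, ofReal_mul, ofReal_cpow (Nat.cast_nonneg n)]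
      push_cast
      ring
    rw [h1, re_ofReal_mul]
    ring
  rw [Finset.sum_congr rfl hterm, ← Finset.mul_sum]
  exact mul_nonneg (mul_nonneg ArithmeticFunction.vonMangoldt_nonneg
    (Real.rpow_nonneg (Nat.cast_nonneg n) _)) (h n hn)

end

section

open Complex Metric MeasureTheory Set Filter Topology

namespace DirichletCharacter

lemma reNegLogDeriv_three_four_one {N : ℕ} (χ : DirichletCharacter ℂ N) {σ : ℝ} (hσ : 1 < σ)
    (t : ℝ) :
    0 ≤ 3 * (1 : DirichletCharacter ℂ N).reNegLogDeriv σ + 4 * χ.reNegLogDeriv (σ + t * I) +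
      (χ ^ 2).reNegLogDeriv (σ + (2 * t : ℝ) * I) := by
  have := sum_reNegLogDeriv_nonneg (N := N) Finset.univ ![3, 4, 1] ![1, χ, χ ^ 2]
    ![(σ : ℂ), σ + t * I, σ + (2 * t : ℝ) * I] hσ
    (by intro i _; fin_cases i <;> simp) ?_
  · simpa [Fin.sum_univ_succ, add_assoc] using this
  intro n hn
  by_cases hu : IsUnit (n : ZMod N)
  · have hn0 : (n : ℂ) ≠ 0 := by exact_mod_cast hn
    set z : ℂ := χ n * (n : ℂ) ^ (-(t * I)) with hz
    have hz1 : ‖z‖ = 1 := by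
      have h1 := χ.unit_norm_eq_one hu.unit
      rw [IsUnit.unit_spec] at h1
      rw [hz, norm_mul, h1, norm_natCast_cpow_of_pos (Nat.pos_of_ne_zero hn)]
      simp
    have h2 : (χ ^ 2) n * (n : ℂ) ^ (-((2 * t : ℝ) * I)) = z ^ 2 := by
      rw [hz, mul_pow, ← cpow_nat_mul, MulChar.pow_apply' _ two_ne_zero]
      congr 2
      push_cast
      ring
    have h3 : z.re ^ 2 + z.im ^ 2 = 1 := by
      have := Complex.sq_norm z
      rw [hz1, normSq_apply] at this
      linarith
    have h4 : (z ^ 2).re = z.re ^ 2 - z.im ^ 2 := by rw [sq, mul_re]; ring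
    simp only [Fin.sum_univ_succ, Matrix.cons_val_zero, Matrix.cons_val_succ]
    simp only [ofReal_re, ofReal_im, add_im, mul_im, I_re, I_im, mul_one, mul_zero, add_zero,
      zero_add, ofReal_zero, zero_mul, neg_zero, cpow_zero, MulChar.one_apply hu,
      Finset.univ_eq_empty, Finset.sum_empty, ← hz, h2, h4, one_re]
    nlinarith [sq_nonneg (z.re + 1)]
  · refine Finset.sum_nonneg fun i _ ↦ ?_
    rw [MulChar.map_nonunit _ hu]
    simp

lemma reNegLogDeriv_one_add {N : ℕ} (χ : DirichletCharacter ℂ N) {σ : ℝ} (hσ : 1 < σ) :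
    0 ≤ (1 : DirichletCharacter ℂ N).reNegLogDeriv σ + χ.reNegLogDeriv σ := by
  have := sum_reNegLogDeriv_nonneg (N := N) Finset.univ ![1, 1] ![1, χ]
    ![(σ : ℂ), σ] hσ (by intro i _; fin_cases i <;> simp) ?_
  · simpa [Fin.sum_univ_succ, add_assoc] using this
  intro n hn
  by_cases hu : IsUnit (n : ZMod N)
  · have := (abs_re_le_norm (χ n)).trans (χ.norm_le_one n)
    rw [abs_le] at this
    simp [Fin.sum_univ_succ, MulChar.one_apply hu]
    linarith [this.1]
  · refine Finset.sum_nonneg fun i _ ↦ ?_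
    rw [MulChar.map_nonunit _ hu]
    simp

lemma eq_real_of_sq_eq_one {N : ℕ} {χ : DirichletCharacter ℂ N} (h : χ ^ 2 = 1) (a : ZMod N) :
    χ a = 0 ∨ χ a = 1 ∨ χ a = -1 :=
  MulChar.isQuadratic_iff_sq_eq_one.2 h a

lemma LFunction_conj {N : ℕ} [NeZero N] {χ : DirichletCharacter ℂ N} (hχ : χ ≠ 1) (h : χ ^ 2 = 1)
    {s : ℂ} (hs : 0 < s.re) :
    χ.LFunction ((starRingEnd ℂ) s) = (starRingEnd ℂ) (χ.LFunction s) := by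
  have key := eqOn_of_eqOn_one_lt_re (F := χ.LFunction)
    (G := (starRingEnd ℂ) ∘ χ.LFunction ∘ (starRingEnd ℂ))
    (fun s _ ↦ χ.differentiable_LFunction hχ s)
    (fun s _ ↦ by simpa using (χ.differentiable_LFunction hχ ((starRingEnd ℂ) s)).conj_conj)
    (fun s hs ↦ ?_)
    (s := (starRingEnd ℂ) s) (by simpa)
  · simpa using key
  have hs' : 1 < ((starRingEnd ℂ) s).re := by simpa
  rw [Function.comp_apply, Function.comp_apply, χ.LFunction_eq_LSeries hs,
    χ.LFunction_eq_LSeries hs', LSeries, LSeries, conj_tsum]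
  refine tsum_congr fun n ↦ ?_
  rcases eq_or_ne n 0 with rfl | hn
  · simp
  rw [LSeries.term_of_ne_zero hn, LSeries.term_of_ne_zero hn, map_div₀,
    cpow_conj _ _ (by simp [natCast_arg, Real.pi_ne_zero.symm])]
  rcases eq_real_of_sq_eq_one h n with h | h | h <;> simp [h]

lemma reNegLogDeriv_one_add_add_add_mul {N : ℕ} {χ ψ : DirichletCharacter ℂ N}
    (hχ : χ ^ 2 = 1) (hψ : ψ ^ 2 = 1) {σ : ℝ} (hσ : 1 < σ) :
    0 ≤ (1 : DirichletCharacter ℂ N).reNegLogDeriv σ + χ.reNegLogDeriv σ + ψ.reNegLogDeriv σ +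
      (χ * ψ).reNegLogDeriv σ := by
  have := sum_reNegLogDeriv_nonneg (N := N) Finset.univ ![1, 1, 1, 1] ![1, χ, ψ, χ * ψ]
    ![(σ : ℂ), σ, σ, σ] hσ (by intro i _; fin_cases i <;> simp) ?_
  · simpa [Fin.sum_univ_succ, add_assoc] using this
  intro n hn
  by_cases hu : IsUnit (n : ZMod N)
  · rcases eq_real_of_sq_eq_one hχ n with h | h | h <;>
    rcases eq_real_of_sq_eq_one hψ n with h' | h' | h' <;>
    norm_num [Fin.sum_univ_succ, MulChar.one_apply hu, h, h']
  · refine Finset.sum_nonneg fun i _ ↦ ?_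
    rw [MulChar.map_nonunit _ hu]
    simp

/-- The parameters of the zero-free region argument. -/
structure ZeroFreeParams (T δ : ℝ) : Prop where
  le_T : 100 ≤ T
  inv_le : 1 / T ≤ δ
  le_small : δ ≤ 1 / 100
  log_mul : 160 * Real.log T * δ = 1 / 80

variable {T δ : ℝ}

lemma ZeroFreeParams.pos (h : ZeroFreeParams T δ) : 0 < δ := by
  have := h.le_T
  exact lt_of_lt_of_le (by positivity) h.inv_le

lemma ZeroFreeParams.log_eq (h : ZeroFreeParams T δ) : 160 * Real.log T = 1 / 80 / δ := by
  rw [eq_div_iff h.pos.ne', h.log_mul]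

lemma reNegLogDeriv_one_ofReal_le {N : ℕ} [NeZero N] (h : ZeroFreeParams T δ)
    (hN : (N : ℝ) ≤ T ^ 2) :
    (1 : DirichletCharacter ℂ N).reNegLogDeriv ((1 + δ : ℝ) : ℂ) ≤ (1 + 1 / 80) / δ := by
  have h0 := h.pos
  have h1 := h.le_small
  have := reNegLogDeriv_one_le (N := N) h.le_T hN (c := ((1 + δ : ℝ) : ℂ)) (W := ∅)
    (m := fun _ ↦ 0)
    (by rw [ofReal_re]; linarith [h.inv_le]) (by rw [ofReal_re]; linarith)
    (by rw [ofReal_im, abs_zero]; linarith [h.le_T]) (by simp)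
  rw [h.log_eq] at this
  refine this.trans (le_of_eq ?_)
  have h2 : (1 / (((1 + δ : ℝ) : ℂ) - 1)) = ((1 / δ : ℝ) : ℂ) := by push_cast; ring
  rw [h2, ofReal_re, Finset.sum_empty]
  ring

lemma le_one_div_re {x δ : ℝ} (h1 : 0 < x) (h2 : x ≤ 21 / 20 * δ) :
    19 / 20 / δ ≤ 1 / x := by
  have : 0 < δ := by linarith
  rw [div_div, div_le_div_iff₀ (by positivity) h1]
  linarith

lemma three_four_one_bound {N : ℕ} [NeZero N] (h : ZeroFreeParams T δ)
    (hN : (N : ℝ) ≤ T ^ 2) {χ : DirichletCharacter ℂ N} {ρ : ℂ} {P Q : ℝ}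
    (hρ : 1 - δ / 20 ≤ ρ.re) (hρ' : ρ.re < 1)
    (hχ : χ.reNegLogDeriv ((1 + δ : ℝ) + ρ.im * I) ≤ Q + 160 * Real.log T - 1 / (1 + δ - ρ.re))
    (hP : (χ ^ 2).reNegLogDeriv ((1 + δ : ℝ) + (2 * ρ.im : ℝ) * I) ≤ P + 160 * Real.log T) :
    3 / 5 / δ ≤ P + 4 * Q := by
  have h0 := h.pos
  have h1 := reNegLogDeriv_three_four_one χ (σ := 1 + δ) (by linarith) ρ.im
  have h2 := reNegLogDeriv_one_ofReal_le (N := N) h hN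
  have h3 := le_one_div_re (x := 1 + δ - ρ.re) (δ := δ) (by linarith) (by linarith)
  rw [h.log_eq] at hχ hP
  have e1 : 1 / 80 / δ = (1 / 80) * (1 / δ) := by ring
  have e2 : (1 + 1 / 80) / δ = (1 + 1 / 80) * (1 / δ) := by ring
  have e3 : 19 / 20 / δ = (19 / 20) * (1 / δ) := by ring
  have e4 : 3 / 5 / δ = (3 / 5) * (1 / δ) := by ring
  rw [e1] at hχ hP
  rw [e2] at h2
  rw [e3] at h3
  rw [e4]
  have : 0 < 1 / δ := by positivity
  linarith

lemma one_add_bound {N : ℕ} [NeZero N] (h : ZeroFreeParams T δ)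
    (hN : (N : ℝ) ≤ T ^ 2) {χ : DirichletCharacter ℂ N} (hχ : χ ≠ 1)
    {W : Finset ℂ} {m : ℂ → ℕ} (hW : ∀ a ∈ W, χ.LFunction a = 0 ∧ ‖((1 + δ : ℝ) : ℂ) - a‖ ≤ 1 / 4 ∧
      (m a ≤ 1 ∨ m a ≤ 2 ∧ deriv χ.LFunction a = 0)) :
    ∑ a ∈ W, m a * (1 / (((1 + δ : ℝ) : ℂ) - a)).re ≤ (1 + 1 / 40) / δ := by
  have h0 := h.pos
  have h1 := reNegLogDeriv_one_add χ (σ := 1 + δ) (by linarith)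
  have h2 := reNegLogDeriv_one_ofReal_le (N := N) h hN
  have h3 := reNegLogDeriv_le hχ h.le_T hN (c := ((1 + δ : ℝ) : ℂ)) (W := W) (m := m)
    (by rw [ofReal_re]; linarith [h.inv_le]) (by rw [ofReal_re]; linarith [h.le_small])
    (by rw [ofReal_im, abs_zero]; linarith [h.le_T]) hW
  rw [h.log_eq] at h3
  have : (1 + 1 / 40) / δ = (1 + 1 / 80) / δ + 1 / 80 / δ := by ring
  linarith

/-- A zero close to the line `Re s = 1` of a nontrivial character forces the character to be
quadratic and the zero to be real. -/
lemma sq_eq_one_and_im_eq_zero {N : ℕ} [NeZero N] (h : ZeroFreeParams T δ)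
    (hN : (N : ℝ) ≤ T ^ 2) {χ : DirichletCharacter ℂ N} (hχ : χ ≠ 1) {ρ : ℂ}
    (hρ : 1 - δ / 20 ≤ ρ.re) (hρ' : ρ.re < 1) (hi : |ρ.im| ≤ T) (h0 : χ.LFunction ρ = 0) :
    χ ^ 2 = 1 ∧ ρ.im = 0 := by
  have hδ := h.pos
  have hδ' := h.le_small
  have hTT := h.inv_le
  have hT := h.le_T
  have hre : ∀ t : ℝ, (((1 + δ : ℝ) : ℂ) + t * I).re = 1 + δ := by intro t; simp
  have him : ∀ t : ℝ, (((1 + δ : ℝ) : ℂ) + t * I).im = t := by intro t; simp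
  have hdiff : ((1 + δ : ℝ) : ℂ) + ρ.im * I - ρ = ((1 + δ - ρ.re : ℝ) : ℂ) := by
    apply Complex.ext <;> simp
  have hχb : χ.reNegLogDeriv ((1 + δ : ℝ) + ρ.im * I) ≤
      0 + 160 * Real.log T - 1 / (1 + δ - ρ.re) := by
    have := reNegLogDeriv_le hχ hT hN (c := ((1 + δ : ℝ) : ℂ) + ρ.im * I) (W := {ρ})
      (m := fun _ ↦ 1) (by rw [hre]; linarith) (by rw [hre]; linarith) (by rw [him]; linarith)
      (by
        intro a ha
        rw [Finset.mem_singleton] at ha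
        subst ha
        refine ⟨h0, ?_, .inl le_rfl⟩
        rw [hdiff, norm_real, Real.norm_of_nonneg (by linarith)]
        linarith)
    rw [Finset.sum_singleton, hdiff, ← ofReal_one, ← ofReal_div, ofReal_re] at this
    simpa using this
  have habs2 : |2 * ρ.im| ≤ 2 * T := by
    rw [abs_mul, abs_two]; linarith
  have hsq : χ ^ 2 = 1 := by
    by_contra hsq
    have hP := reNegLogDeriv_le hsq hT hN (c := ((1 + δ : ℝ) : ℂ) + (2 * ρ.im : ℝ) * I) (W := ∅)
      (m := fun _ ↦ 1) (by rw [hre]; linarith) (by rw [hre]; linarith) (by rw [him]; linarith)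
      (by simp)
    have := three_four_one_bound h hN (P := 0) hρ hρ' hχb (by simpa using hP)
    have : 0 < 3 / 5 / δ := by positivity
    linarith
  refine ⟨hsq, ?_⟩
  by_contra hne
  by_cases hlarge : δ / 2 < |ρ.im|
  · have hP := reNegLogDeriv_one_le (N := N) hT hN (c := ((1 + δ : ℝ) : ℂ) + (2 * ρ.im : ℝ) * I)
      (W := ∅) (m := fun _ ↦ 1) (by rw [hre]; linarith) (by rw [hre]; linarith)
      (by rw [him]; linarith) (by simp)
    have h2 : (((1 + δ : ℝ) : ℂ) + (2 * ρ.im : ℝ) * I - 1)⁻¹.re = δ / (δ ^ 2 + (2 * ρ.im) ^ 2) := by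
      rw [inv_re, normSq_apply]
      simp
      ring
    rw [← hsq, Finset.sum_empty, sub_zero, one_div, h2] at hP
    have h1 := three_four_one_bound h hN hρ hρ' hχb hP
    have h3 : δ ^ 2 ≤ (2 * ρ.im) ^ 2 := by
      rw [← sq_abs (2 * ρ.im), abs_mul, abs_two]
      gcongr
      linarith
    rw [mul_zero, add_zero, div_le_div_iff₀ hδ (by positivity)] at h1
    nlinarith
  · push Not at hlarge
    have hconj : χ.LFunction ((starRingEnd ℂ) ρ) = 0 := by
      rw [LFunction_conj hχ hsq (by linarith), h0, map_zero]
    have hd : ∀ a : ℂ, a.re = ρ.re → a.im ^ 2 = ρ.im ^ 2 →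
        ‖((1 + δ : ℝ) : ℂ) - a‖ ≤ 1 / 4 ∧ 3 / 4 / δ ≤ (1 / (((1 + δ : ℝ) : ℂ) - a)).re := by
      intro a h1 h2
      have h3 : a.im ^ 2 ≤ δ ^ 2 / 4 := by
        rw [h2, ← sq_abs]
        calc |ρ.im| ^ 2 ≤ (δ / 2) ^ 2 := by gcongr
          _ = _ := by ring
      constructor
      · refine (norm_le_abs_re_add_abs_im _).trans ?_
        have h4 : |(((1 + δ : ℝ) : ℂ) - a).re| ≤ 21 / 20 * δ := by
          rw [sub_re, ofReal_re, h1, abs_of_nonneg (by linarith)]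
          linarith
        have h5 : |(((1 + δ : ℝ) : ℂ) - a).im| ≤ δ / 2 := by
          rw [sub_im, ofReal_im, zero_sub, abs_neg]
          exact abs_le_of_sq_le_sq (by linarith) (by linarith)
        linarith
      · rw [one_div, inv_re, normSq_apply, sub_re, ofReal_re, sub_im, ofReal_im, h1]
        have h4 : 1 + δ - ρ.re ≤ 21 / 20 * δ := by linarith
        have h5 : δ ≤ 1 + δ - ρ.re := by linarith
        rw [div_le_div_iff₀ hδ (by nlinarith)]
        nlinarith
    have hne' : ρ ≠ (starRingEnd ℂ) ρ := fun h ↦ hne (conj_eq_iff_im.1 h.symm)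
    have hd1 := hd ρ rfl rfl
    have hd2 := hd ((starRingEnd ℂ) ρ) (by simp) (by simp)
    have := one_add_bound h hN hχ (W := {ρ, (starRingEnd ℂ) ρ}) (m := fun _ ↦ 1) (by
      intro a ha
      rw [Finset.mem_insert, Finset.mem_singleton] at ha
      rcases ha with rfl | rfl
      · exact ⟨h0, hd1.1, .inl le_rfl⟩
      · exact ⟨hconj, hd2.1, .inl le_rfl⟩)
    rw [Finset.sum_pair hne'] at this
    have h6 : (1 + 1 / 40) / δ < 3 / 4 / δ + 3 / 4 / δ := by
      rw [← add_div]
      exact div_lt_div_of_pos_right (by norm_num) hδ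
    simp only [Nat.cast_one, one_mul] at this
    linarith [hd1.2, hd2.2]

end DirichletCharacter

end

section

open Complex Metric MeasureTheory Set Filter Topology

namespace DirichletCharacter

variable {T δ : ℝ}

/-- Zero-free region for `ζ`. -/
lemma exists_riemannZeta_ne_zero : ∃ δ₀ : ℝ, 0 < δ₀ ∧ ∀ T δ : ℝ, ZeroFreeParams T δ → δ ≤ δ₀ →
    ∀ ρ : ℂ, 1 - δ / 20 ≤ ρ.re → ρ.re < 1 → |ρ.im| ≤ T → riemannZeta ρ ≠ 0 := by
  have hcont := (differentiable_LFunctionTrivChar₁ 1).continuous.continuousAt (x := 1)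
  obtain ⟨η, hη, hball⟩ := Metric.eventually_nhds_iff.1
    (hcont.eventually_ne (LFunctionTrivChar₁_apply_one_ne_zero 1))
  refine ⟨η / 6, by positivity, ?_⟩
  intro T δ h hδη ρ hρ hρ' hi hz
  have hδ := h.pos
  have hδ' := h.le_small
  have hTT := h.inv_le
  have hT := h.le_T
  have hρ1 : ρ ≠ 1 := by rintro rfl; simp at hρ'
  have h0 : LFunctionTrivChar₁ 1 ρ = 0 := by
    rw [LFunctionTrivChar₁, Function.update_of_ne hρ1, ← LFunction_modOne_eq (χ := 1)] at *
    rw [LFunctionTrivChar, hz, mul_zero]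
  have hlarge : 4 * δ ≤ |ρ.im| := by
    by_contra! hlt
    refine hball ?_ h0
    rw [dist_eq_norm]
    refine (norm_le_abs_re_add_abs_im _).trans_lt ?_
    rw [sub_re, sub_im, one_re, one_im, sub_zero, abs_of_nonpos (by linarith)]
    linarith
  have hre : ∀ t : ℝ, (((1 + δ : ℝ) : ℂ) + t * I).re = 1 + δ := by intro t; simp
  have him : ∀ t : ℝ, (((1 + δ : ℝ) : ℂ) + t * I).im = t := by intro t; simp
  have hinv : ∀ t : ℝ, (((1 + δ : ℝ) : ℂ) + t * I - 1)⁻¹.re = δ / (δ ^ 2 + t ^ 2) := by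
    intro t
    rw [inv_re, normSq_apply]
    simp
    ring
  have hdiff : ((1 + δ : ℝ) : ℂ) + ρ.im * I - ρ = ((1 + δ - ρ.re : ℝ) : ℂ) := by
    apply Complex.ext <;> simp
  have hN : ((1 : ℕ) : ℝ) ≤ T ^ 2 := by rw [Nat.cast_one]; nlinarith
  have h1 := reNegLogDeriv_one_le (N := 1) hT hN (c := ((1 + δ : ℝ) : ℂ) + ρ.im * I) (W := {ρ})
      (m := fun _ ↦ 1) (by rw [hre]; linarith) (by rw [hre]; linarith) (by rw [him]; linarith)
      (by
        intro a ha
        rw [Finset.mem_singleton] at ha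
        subst ha
        refine ⟨h0, ?_, .inl le_rfl⟩
        rw [hdiff, norm_real, Real.norm_of_nonneg (by linarith)]
        linarith)
  rw [Finset.sum_singleton, hdiff, ← ofReal_one, ← ofReal_div, ofReal_re, Nat.cast_one, one_mul,
    ofReal_one, one_div (_ - _), hinv] at h1
  have h2 := reNegLogDeriv_one_le (N := 1) hT hN (c := ((1 + δ : ℝ) : ℂ) + (2 * ρ.im : ℝ) * I)
      (W := ∅) (m := fun _ ↦ 1) (by rw [hre]; linarith) (by rw [hre]; linarith)
      (by rw [him, abs_mul, abs_two]; linarith) (by simp)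
  rw [Finset.sum_empty, sub_zero, one_div, hinv] at h2
  have h3 := three_four_one_bound h hN (χ := 1) hρ hρ' h1 (by rwa [one_pow])
  have h4 : (4 * δ) ^ 2 ≤ ρ.im ^ 2 := by
    rw [← sq_abs ρ.im]
    gcongr
  have h5 : δ / (δ ^ 2 + ρ.im ^ 2) ≤ 1 / 17 / δ := by
    rw [div_le_div_iff₀ (by positivity) hδ]
    nlinarith
  have h6 : δ / (δ ^ 2 + (2 * ρ.im) ^ 2) ≤ 1 / 17 / δ := by
    rw [div_le_div_iff₀ (by positivity) hδ]
    nlinarith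
  have h7 : 1 / 17 / δ + 4 * (1 / 17 / δ) < 3 / 5 / δ := by
    rw [← mul_div_assoc, ← add_div]
    exact div_lt_div_of_pos_right (by norm_num) hδ
  linarith

lemma ofReal_zero_bounds (h : ZeroFreeParams T δ) {β : ℝ} (hβ : 1 - δ / 20 ≤ β) (hβ' : β < 1) :
    ‖((1 + δ : ℝ) : ℂ) - β‖ ≤ 1 / 4 ∧ 19 / 20 / δ ≤ (1 / (((1 + δ : ℝ) : ℂ) - β)).re := by
  have hδ := h.pos
  have hδ' := h.le_small
  rw [← ofReal_sub, norm_real, Real.norm_of_nonneg (by linarith), ← ofReal_one, ← ofReal_div,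
    ofReal_re]
  exact ⟨by linarith, le_one_div_re (by linarith) (by linarith)⟩

lemma deriv_ne_zero_of_zero {N : ℕ} [NeZero N] (h : ZeroFreeParams T δ)
    (hN : (N : ℝ) ≤ T ^ 2) {χ : DirichletCharacter ℂ N} (hχ : χ ≠ 1) {β : ℝ}
    (hβ : 1 - δ / 20 ≤ β) (hβ' : β < 1) (h0 : χ.LFunction β = 0) :
    deriv χ.LFunction β ≠ 0 := by
  intro hd
  have hδ := h.pos
  obtain ⟨h1, h2⟩ := ofReal_zero_bounds h hβ hβ'
  have := one_add_bound h hN hχ (W := {(β : ℂ)}) (m := fun _ ↦ 2) (by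
    intro a ha
    rw [Finset.mem_singleton] at ha
    subst ha
    exact ⟨h0, h1, .inr ⟨le_rfl, hd⟩⟩)
  rw [Finset.sum_singleton] at this
  have h3 : (1 + 1 / 40) / δ < 19 / 20 / δ + 19 / 20 / δ := by
    rw [← add_div]
    exact div_lt_div_of_pos_right (by norm_num) hδ
  push_cast at this
  push_cast at h2
  linarith

lemma zero_unique {N : ℕ} [NeZero N] (h : ZeroFreeParams T δ)
    (hN : (N : ℝ) ≤ T ^ 2) {χ : DirichletCharacter ℂ N} (hχ : χ ≠ 1) {β β' : ℝ}
    (hβ : 1 - δ / 20 ≤ β) (hβ1 : β < 1) (h0 : χ.LFunction β = 0)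
    (hβ' : 1 - δ / 20 ≤ β') (hβ1' : β' < 1) (h0' : χ.LFunction β' = 0) : β = β' := by
  by_contra hne
  have hne' : (β : ℂ) ≠ β' := by exact_mod_cast hne
  have hδ := h.pos
  obtain ⟨h1, h2⟩ := ofReal_zero_bounds h hβ hβ1
  obtain ⟨h1', h2'⟩ := ofReal_zero_bounds h hβ' hβ1'
  have := one_add_bound h hN hχ (W := {(β : ℂ), (β' : ℂ)}) (m := fun _ ↦ 1) (by
    intro a ha
    rw [Finset.mem_insert, Finset.mem_singleton] at ha
    rcases ha with rfl | rfl
    · exact ⟨h0, h1, .inl le_rfl⟩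
    · exact ⟨h0', h1', .inl le_rfl⟩)
  rw [Finset.sum_pair hne'] at this
  have h3 : (1 + 1 / 40) / δ < 19 / 20 / δ + 19 / 20 / δ := by
    rw [← add_div]
    exact div_lt_div_of_pos_right (by norm_num) hδ
  simp only [Nat.cast_one, one_mul] at this
  linarith

/-- Two distinct quadratic characters of the same level cannot both have a zero close to `1`. -/
lemma eq_of_zeros {N : ℕ} [NeZero N] (h : ZeroFreeParams T δ)
    (hN : (N : ℝ) ≤ T ^ 2) {χ ψ : DirichletCharacter ℂ N} (hχ : χ ≠ 1) (hψ : ψ ≠ 1)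
    (hχ2 : χ ^ 2 = 1) (hψ2 : ψ ^ 2 = 1) {β β' : ℝ}
    (hβ : 1 - δ / 20 ≤ β) (hβ1 : β < 1) (h0 : χ.LFunction β = 0)
    (hβ' : 1 - δ / 20 ≤ β') (hβ1' : β' < 1) (h0' : ψ.LFunction β' = 0) : χ = ψ := by
  by_contra hne
  have hχψ : χ * ψ ≠ 1 := by
    intro h1
    apply hne
    calc χ = χ * ψ ^ 2 := by rw [hψ2, mul_one]
      _ = χ * ψ * ψ := by rw [sq, mul_assoc]
      _ = ψ := by rw [h1, one_mul]
  have hδ := h.pos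
  have hδ' := h.le_small
  obtain ⟨h1, h2⟩ := ofReal_zero_bounds h hβ hβ1
  obtain ⟨h1', h2'⟩ := ofReal_zero_bounds h hβ' hβ1'
  have key : ∀ (φ : DirichletCharacter ℂ N), φ ≠ 1 → ∀ γ : ℝ, φ.LFunction γ = 0 →
      ‖((1 + δ : ℝ) : ℂ) - γ‖ ≤ 1 / 4 → 19 / 20 / δ ≤ (1 / (((1 + δ : ℝ) : ℂ) - γ)).re →
      φ.reNegLogDeriv ((1 + δ : ℝ) : ℂ) ≤ 1 / 80 / δ - 19 / 20 / δ := by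
    intro φ hφ γ hγ h3 h4
    have := reNegLogDeriv_le hφ h.le_T hN (c := ((1 + δ : ℝ) : ℂ)) (W := {(γ : ℂ)})
      (m := fun _ ↦ 1)
      (by rw [ofReal_re]; linarith [h.inv_le]) (by rw [ofReal_re]; linarith)
      (by rw [ofReal_im, abs_zero]; linarith [h.le_T]) (by
        intro a ha
        rw [Finset.mem_singleton] at ha
        subst ha
        exact ⟨hγ, h3, .inl le_rfl⟩)
    rw [Finset.sum_singleton, Nat.cast_one, one_mul, h.log_eq] at this
    linarith
  have a1 := key χ hχ β h0 h1 h2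
  have a2 := key ψ hψ β' h0' h1' h2'
  have a3 := reNegLogDeriv_le hχψ h.le_T hN (c := ((1 + δ : ℝ) : ℂ)) (W := ∅)
      (m := fun _ ↦ 1)
      (by rw [ofReal_re]; linarith [h.inv_le]) (by rw [ofReal_re]; linarith)
      (by rw [ofReal_im, abs_zero]; linarith [h.le_T]) (by simp)
  rw [Finset.sum_empty, sub_zero, h.log_eq] at a3
  have a4 := reNegLogDeriv_one_ofReal_le (N := N) h hN
  have a5 := reNegLogDeriv_one_add_add_add_mul hχ2 hψ2 (σ := 1 + δ) (by linarith)
  have a6 : (1 + 1 / 80) / δ + (1 / 80 / δ - 19 / 20 / δ) + (1 / 80 / δ - 19 / 20 / δ) +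
      1 / 80 / δ < 0 := by
    rw [← sub_div, ← add_div, ← add_div, ← add_div]
    exact div_neg_of_neg_of_pos (by norm_num) hδ
  linarith

lemma heq_of_zeros {q q' : ℕ} [NeZero q] [NeZero q'] (h : ZeroFreeParams T δ)
    (hq : (q : ℝ) ≤ T) (hq' : (q' : ℝ) ≤ T) {χ : DirichletCharacter ℂ q}
    {χ' : DirichletCharacter ℂ q'} (hp : χ.IsPrimitive) (hp' : χ'.IsPrimitive)
    (hχ : χ ≠ 1) (hχ' : χ' ≠ 1) (hχ2 : χ ^ 2 = 1) (hχ2' : χ' ^ 2 = 1) {β β' : ℝ}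
    (hβ : 1 - δ / 20 ≤ β) (hβ1 : β < 1) (h0 : χ.LFunction β = 0)
    (hβ' : 1 - δ / 20 ≤ β') (hβ1' : β' < 1) (h0' : χ'.LFunction β' = 0) : q' = q ∧ HEq χ' χ := by
  have hd : q ∣ q * q' := dvd_mul_right q q'
  have hd' : q' ∣ q * q' := dvd_mul_left q' q
  have hqq : NeZero (q * q') := ⟨mul_ne_zero (NeZero.ne q) (NeZero.ne q')⟩
  have hT := h.le_T
  have hN : ((q * q' : ℕ) : ℝ) ≤ T ^ 2 := by
    rw [Nat.cast_mul, sq]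
    gcongr
  have key := eq_of_zeros h hN (χ := changeLevel hd χ) (ψ := changeLevel hd' χ')
    (by rwa [Ne, changeLevel_eq_one_iff]) (by rwa [Ne, changeLevel_eq_one_iff])
    (by rw [← map_pow, hχ2, map_one]) (by rw [← map_pow, hχ2', map_one]) hβ hβ1
    (by rw [LFunction_changeLevel hd χ (.inl hχ), h0, zero_mul]) hβ' hβ1'
    (by rw [LFunction_changeLevel hd' χ' (.inl hχ'), h0', zero_mul])
  have hc := congrArg conductor key
  rw [conductor_changeLevel, conductor_changeLevel] at hc
  rw [isPrimitive_def] at hp hp'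
  rw [hp, hp'] at hc
  subst hc
  refine ⟨rfl, heq_of_eq ?_⟩
  exact (changeLevel_injective hd key).symm

end DirichletCharacter

end

section

open Complex Metric MeasureTheory Set Filter Topology

namespace DirichletCharacter

lemma norm_LFunction_le_log {q : ℕ} [NeZero q] {χ : DirichletCharacter ℂ q} (hχ : χ ≠ 1) {T : ℝ}
    (hT : 100 ≤ T) (hq : (q : ℝ) ≤ T) {s : ℂ} (hs : ‖s - 1‖ ≤ 1 / Real.log T) :
    ‖χ.LFunction s‖ ≤ 9 * Real.log T := by
  have hT0 : 0 < T := by linarith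
  have hlog : 4 ≤ Real.log T := by
    rw [Real.le_log_iff_exp_le hT0]
    refine le_trans ?_ hT
    have := Real.exp_one_lt_d9.le
    calc Real.exp 4 = Real.exp 1 ^ 4 := by rw [← Real.exp_nat_mul]; norm_num
      _ ≤ 2.7182818286 ^ 4 := by gcongr
      _ ≤ 100 := by norm_num
  have hinv : 1 / Real.log T ≤ 1 / 4 := one_div_le_one_div_of_le (by norm_num) hlog
  have hre := (abs_re_le_norm (s - 1)).trans hs
  rw [sub_re, one_re, abs_le] at hre
  have hσ : 3 / 4 ≤ s.re := by linarith [hre.1]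
  have hsn : ‖s‖ ≤ 5 / 4 := by
    have := norm_le_norm_add_norm_sub' s 1
    rw [norm_one] at this
    linarith
  have hpow : ∀ t : ℝ, 1 ≤ t → t ≤ T → t ^ (-s.re) ≤ Real.exp 1 * t⁻¹ := by
    intro t h1 h2
    have ht0 : 0 < t := by linarith
    calc t ^ (-s.re) ≤ t ^ (1 / Real.log T + -1) :=
          Real.rpow_le_rpow_of_exponent_le h1 (by linarith)
      _ = t ^ (1 / Real.log T) * t⁻¹ := by rw [Real.rpow_add ht0, Real.rpow_neg_one]
      _ ≤ T ^ (1 / Real.log T) * t⁻¹ := by gcongr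
      _ = Real.exp 1 * t⁻¹ := by
        rw [Real.rpow_def_of_pos hT0, mul_one_div_cancel (by linarith)]
  set g : ℝ → ℂ := fun t ↦ ∑ k ∈ Finset.Icc 1 ⌊t⌋₊, χ k with hg
  have hgm : Measurable g := measurable_sum_Icc_floor _
  have hgb : ∀ t, ‖g t‖ ≤ q := fun t ↦ norm_sum_Icc_le hχ _
  have hgt : IntegrableOn (fun t : ℝ ↦ g t * (t : ℂ) ^ (-(s + 1))) (Ioi 1) := by
    refine Integrable.mono' ((integrableOn_Ioi_rpow_of_lt (a := -s.re - 1)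
      (by linarith) one_pos).const_mul (q : ℝ)) ?_ ?_
    · exact (hgm.mul (by fun_prop)).aestronglyMeasurable
    · filter_upwards [ae_restrict_mem measurableSet_Ioi] with t ht
      rw [norm_mul, norm_cpow_eq_rpow_re_of_pos (lt_trans one_pos ht)]
      have : (-(s + 1)).re = -s.re - 1 := by simp; ring
      rw [this]
      exact mul_le_mul_of_nonneg_right (hgb t) (Real.rpow_nonneg (lt_trans one_pos ht).le _)
  rw [χ.LFunction_eq_mul_integral hχ (by linarith), norm_mul,
    ← Ioc_union_Ioi_eq_Ioi (show (1 : ℝ) ≤ T by linarith),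
    setIntegral_union Ioc_disjoint_Ioi_same measurableSet_Ioi
      (hgt.mono_set Ioc_subset_Ioi_self) (hgt.mono_set (Ioi_subset_Ioi (by linarith)))]
  have h1 : ‖∫ t in Ioc 1 T, g t * (t : ℂ) ^ (-(s + 1))‖ ≤ Real.exp 1 * Real.log T := by
    have hi : IntervalIntegrable (fun t : ℝ ↦ Real.exp 1 * t⁻¹) volume 1 T := by
      refine (intervalIntegrable_inv_iff.2 (.inr ?_)).const_mul _
      rw [uIcc_of_le (by linarith)]
      intro h
      linarith [h.1]
    have h2 : ∫ t in (1 : ℝ)..T, Real.exp 1 * t⁻¹ = Real.exp 1 * Real.log T := by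
      rw [intervalIntegral.integral_const_mul, integral_inv_of_pos one_pos hT0, div_one]
    rw [← h2, ← intervalIntegral.integral_of_le (by linarith)]
    refine intervalIntegral.norm_integral_le_of_norm_le (by linarith) ?_ hi
    refine Eventually.of_forall fun t ht ↦ ?_
    have ht0 : 0 < t := lt_trans one_pos ht.1
    rw [norm_mul, norm_cpow_eq_rpow_re_of_pos ht0]
    have : (-(s + 1)).re = -s.re - 1 := by simp; ring
    rw [this, Real.rpow_sub_one ht0.ne']
    calc _ ≤ t * (t ^ (-s.re) / t) :=
          mul_le_mul_of_nonneg_right (norm_sum_Icc_floor_le χ ht0.le) (by positivity)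
      _ = t ^ (-s.re) := by field_simp
      _ ≤ _ := hpow t ht.1.le ht.2
  have h2 : ‖∫ t in Ioi T, g t * (t : ℂ) ^ (-(s + 1))‖ ≤ Real.exp 1 * (4 / 3) := by
    refine (norm_integral_mul_cpow_le (fun t _ ↦ hgb t) (by linarith) (by linarith)).trans ?_
    calc _ ≤ T * (Real.exp 1 * T⁻¹) / (3 / 4) := by
          gcongr
          exact hpow T (by linarith) le_rfl
      _ = _ := by field_simp
  have he := Real.exp_one_lt_d9.le
  have he0 := Real.exp_pos 1
  calc _ ≤ 5 / 4 * (Real.exp 1 * Real.log T + Real.exp 1 * (4 / 3)) := by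
        gcongr
        exact (norm_add_le _ _).trans (add_le_add h1 h2)
    _ ≤ 5 / 4 * (2.7182818286 * Real.log T + 2.7182818286 * (4 / 3)) := by gcongr
    _ ≤ _ := by linarith

/-- A real zero of `L(s, χ)` near `1` forces `L(1, χ)` to be small. -/
lemma norm_LFunction_one_le {q : ℕ} [NeZero q] {χ : DirichletCharacter ℂ q} (hχ : χ ≠ 1) {T : ℝ}
    (hT : 100 ≤ T) (hq : (q : ℝ) ≤ T) {β : ℝ} (hβ : 1 - 1 / (2 * Real.log T) ≤ β) (hβ1 : β < 1)
    (h0 : χ.LFunction β = 0) :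
    ‖χ.LFunction 1‖ ≤ 18 * Real.log T ^ 2 * (1 - β) := by
  have hlog : 0 < Real.log T := Real.log_pos (by linarith)
  have hd : ∀ z ∈ closedBall (1 : ℂ) (1 / (2 * Real.log T)),
      ‖deriv χ.LFunction z‖ ≤ 18 * Real.log T ^ 2 := by
    intro z hz
    have hr : 0 < 1 / (2 * Real.log T) := by positivity
    refine (norm_deriv_le_of_forall_mem_sphere_norm_le hr
      (χ.differentiable_LFunction hχ).diffContOnCl (C := 9 * Real.log T) fun w hw ↦ ?_).trans
      (le_of_eq (by field_simp; ring))
    refine norm_LFunction_le_log hχ hT hq ?_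
    rw [mem_closedBall, dist_eq_norm] at hz
    rw [mem_sphere, dist_eq_norm] at hw
    calc ‖w - 1‖ ≤ ‖w - z‖ + ‖z - 1‖ := norm_sub_le_norm_sub_add_norm_sub _ _ _
      _ ≤ 1 / (2 * Real.log T) + 1 / (2 * Real.log T) := by rw [hw]; gcongr
      _ = _ := by field_simp; ring
  have h1 : ‖(1 : ℂ) - β‖ = 1 - β := by
    rw [← ofReal_one, ← ofReal_sub, norm_real, Real.norm_of_nonneg (by linarith)]
  have := (convex_closedBall (1 : ℂ) (1 / (2 * Real.log T))).norm_image_sub_le_of_norm_deriv_le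
    (f := χ.LFunction) (x := (β : ℂ)) (y := 1)
    (fun z _ ↦ χ.differentiable_LFunction hχ z) hd
    (by rw [mem_closedBall, dist_eq_norm, norm_sub_rev, h1]; linarith)
    (mem_closedBall_self (by positivity))
  rwa [h0, sub_zero, h1] at this

end DirichletCharacter

end

section

open Set Filter Topology

/-- The function `1/v - coth v`, extended by `0` at `0`. -/
noncomputable def invSubCoth (v : ℝ) : ℝ := v⁻¹ - Real.cosh v / Real.sinh v

@[simp] lemma invSubCoth_zero : invSubCoth 0 = 0 := by simp [invSubCoth]

lemma Real.sinh_le_mul_cosh {v : ℝ} (hv : 0 ≤ v) : Real.sinh v ≤ v * Real.cosh v := by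
  have hm : MonotoneOn (fun v ↦ v * Real.cosh v - Real.sinh v) (Ici 0) := by
    refine monotoneOn_of_deriv_nonneg (convex_Ici 0) (by fun_prop) (by fun_prop) ?_
    intro x hx
    rw [interior_Ici] at hx
    have h : HasDerivAt (fun v ↦ v * Real.cosh v - Real.sinh v)
        (1 * Real.cosh x + x * Real.sinh x - Real.cosh x) x :=
      ((hasDerivAt_id x).mul (Real.hasDerivAt_cosh x)).sub (Real.hasDerivAt_sinh x)
    rw [h.deriv]
    have := mul_pos (mem_Ioi.1 hx) (Real.sinh_pos_iff.2 hx)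
    linarith
  have := hm self_mem_Ici hv hv
  simp at this
  linarith

lemma Real.mul_cosh_le {v : ℝ} (hv : 0 ≤ v) :
    v * Real.cosh v ≤ (1 + v ^ 2) * Real.sinh v := by
  have hm : MonotoneOn (fun v ↦ (1 + v ^ 2) * Real.sinh v - v * Real.cosh v) (Ici 0) := by
    refine monotoneOn_of_deriv_nonneg (convex_Ici 0) (by fun_prop) (by fun_prop) ?_
    intro x hx
    rw [interior_Ici] at hx
    have h : HasDerivAt (fun v ↦ (1 + v ^ 2) * Real.sinh v - v * Real.cosh v)
        ((2 * x) * Real.sinh x + (1 + x ^ 2) * Real.cosh x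
          - (1 * Real.cosh x + x * Real.sinh x)) x := by
      refine (HasDerivAt.mul ?_ (Real.hasDerivAt_sinh x)).sub
        ((hasDerivAt_id x).mul (Real.hasDerivAt_cosh x))
      simpa using ((hasDerivAt_id x).pow 2).const_add 1
    rw [h.deriv]
    have h1 := mul_pos (mem_Ioi.1 hx) (Real.sinh_pos_iff.2 hx)
    have h2 := mul_nonneg (sq_nonneg x) (Real.cosh_pos x).le
    nlinarith
  have := hm self_mem_Ici hv hv
  simp at this
  linarith

lemma hasDerivAt_invSubCoth {v : ℝ} (hv : 0 < v) :
    HasDerivAt invSubCoth ((Real.sinh v ^ 2)⁻¹ - (v ^ 2)⁻¹) v := by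
  have hs := Real.sinh_pos_iff.2 hv
  have h := (hasDerivAt_inv hv.ne').sub
    ((Real.hasDerivAt_cosh v).div (Real.hasDerivAt_sinh v) hs.ne')
  refine h.congr_deriv ?_
  have := Real.cosh_sq v
  field_simp
  rw [this]
  ring

lemma invSubCoth_nonpos {v : ℝ} (hv : 0 ≤ v) : invSubCoth v ≤ 0 := by
  rcases hv.eq_or_lt with rfl | hv
  · simp
  have hs := Real.sinh_pos_iff.2 hv
  rw [invSubCoth, sub_nonpos, inv_eq_one_div, div_le_div_iff₀ hv hs]
  linarith [Real.sinh_le_mul_cosh hv.le]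

lemma neg_le_invSubCoth {v : ℝ} (hv : 0 ≤ v) : -v ≤ invSubCoth v := by
  rcases hv.eq_or_lt with rfl | hv
  · simp
  have hs := Real.sinh_pos_iff.2 hv
  have h : Real.cosh v / Real.sinh v ≤ v⁻¹ + v := by
    rw [div_le_iff₀ hs]
    have := Real.mul_cosh_le hv.le
    have h2 : v * Real.cosh v ≤ v * ((v⁻¹ + v) * Real.sinh v) := by
      refine this.trans_eq ?_
      field_simp
    exact le_of_mul_le_mul_left h2 hv
  rw [invSubCoth]
  linarith

lemma continuousOn_invSubCoth : ContinuousOn invSubCoth (Ici 0) := by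
  intro v hv
  rcases (mem_Ici.1 hv).eq_or_lt with rfl | hv
  · rw [ContinuousWithinAt, invSubCoth_zero]
    refine tendsto_of_tendsto_of_tendsto_of_le_of_le' (g := fun v ↦ -v) (h := fun _ ↦ 0) ?_
      tendsto_const_nhds ?_ ?_
    · have : Tendsto (fun v : ℝ ↦ -v) (𝓝 0) (𝓝 (-0)) := (continuous_neg.tendsto 0)
      rw [neg_zero] at this
      exact this.mono_left nhdsWithin_le_nhds
    · filter_upwards [self_mem_nhdsWithin] with v hv using neg_le_invSubCoth hv
    · filter_upwards [self_mem_nhdsWithin] with v hv using invSubCoth_nonpos hv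
  · exact (hasDerivAt_invSubCoth hv).continuousAt.continuousWithinAt

/-- The inequality of Lazarević. -/
lemma Real.pow_three_mul_cosh_le {v : ℝ} (hv : 0 ≤ v) :
    v ^ 3 * Real.cosh v ≤ Real.sinh v ^ 3 := by
  have hm : MonotoneOn (fun v ↦ Real.sinh v * Real.cosh v ^ (-(1 / 3) : ℝ) - v) (Ici 0) := by
    have hd : ∀ x : ℝ, HasDerivAt (fun v ↦ Real.sinh v * Real.cosh v ^ (-(1 / 3) : ℝ) - v)
        (Real.cosh x * Real.cosh x ^ (-(1 / 3) : ℝ) + Real.sinh x *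
          (Real.sinh x * (-(1 / 3)) * Real.cosh x ^ (-(1 / 3) - 1 : ℝ)) - 1) x := fun x ↦
      ((Real.hasDerivAt_sinh x).mul ((Real.hasDerivAt_cosh x).rpow_const
        (.inl (Real.cosh_pos x).ne'))).sub (hasDerivAt_id x)
    refine monotoneOn_of_deriv_nonneg (convex_Ici 0)
      (fun x _ ↦ (hd x).continuousAt.continuousWithinAt)
      (fun x _ ↦ (hd x).differentiableAt.differentiableWithinAt) ?_
    intro x _
    rw [(hd x).deriv]
    have hc := Real.cosh_pos x
    set w := Real.cosh x ^ (-(1 / 3) : ℝ) with hw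
    have hw0 : 0 < w := Real.rpow_pos_of_pos hc _
    have hw3 : w ^ 3 * Real.cosh x = 1 := by
      rw [hw, ← Real.rpow_natCast, ← Real.rpow_mul hc.le]
      norm_num [Real.rpow_neg_one]
      field_simp
    rw [Real.rpow_sub_one hc.ne', ← hw]
    have hs : Real.sinh x * Real.sinh x = Real.cosh x ^ 2 - 1 := by
      have := Real.cosh_sq x
      linarith [sq (Real.sinh x)]
    have hc' : Real.cosh x = (w ^ 3)⁻¹ := by
      field_simp
      linarith
    have e : Real.cosh x * w + Real.sinh x * (Real.sinh x * (-(1 / 3)) * (w / Real.cosh x)) - 1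
        = Real.cosh x * w - (Real.sinh x * Real.sinh x) * (w / Real.cosh x) / 3 - 1 := by ring
    rw [e, hs, hc']
    have e2 : (w ^ 3)⁻¹ * w - ((w ^ 3)⁻¹ ^ 2 - 1) * (w / (w ^ 3)⁻¹) / 3 - 1
        = (w ^ 2 - 1) ^ 2 * (w ^ 2 + 2) / (3 * w ^ 2) := by
      field_simp
      ring
    rw [e2]
    positivity
  have h := hm self_mem_Ici hv hv
  simp only [Real.sinh_zero, zero_mul, sub_zero] at h
  have hc := Real.cosh_pos v
  have h3 := pow_le_pow_left₀ hv (show v ≤ Real.sinh v * Real.cosh v ^ (-(1 / 3) : ℝ) by linarith) 3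
  rw [mul_pow, ← Real.rpow_natCast (Real.cosh v ^ _), ← Real.rpow_mul hc.le] at h3
  norm_num [Real.rpow_neg_one] at h3
  rwa [← div_eq_mul_inv, le_div_iff₀ hc] at h3

lemma convexOn_invSubCoth : ConvexOn ℝ (Ici 0) invSubCoth := by
  refine MonotoneOn.convexOn_of_deriv (convex_Ici 0) continuousOn_invSubCoth ?_ ?_
  · rw [interior_Ici]
    exact fun v hv ↦ (hasDerivAt_invSubCoth hv).differentiableAt.differentiableWithinAt
  · rw [interior_Ici]
    have hd : ∀ x : ℝ, 0 < x → HasDerivAt (fun v : ℝ ↦ (Real.sinh v ^ 2)⁻¹ - (v ^ 2)⁻¹)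
        (-(2 * Real.sinh x * Real.cosh x) / (Real.sinh x ^ 2) ^ 2 -
          (-(2 * x) / (x ^ 2) ^ 2)) x := by
      intro x hx
      have hs := Real.sinh_pos_iff.2 hx
      refine HasDerivAt.sub ?_ ?_
      · refine HasDerivAt.inv (c := fun v ↦ Real.sinh v ^ 2) ?_ (by positivity)
        simpa using (Real.hasDerivAt_sinh x).fun_pow 2
      · refine HasDerivAt.inv (c := fun v : ℝ ↦ v ^ 2) ?_ (by positivity)
        simpa using (hasDerivAt_id x).fun_pow 2
    have hm : MonotoneOn (fun v : ℝ ↦ (Real.sinh v ^ 2)⁻¹ - (v ^ 2)⁻¹) (Ioi 0) := by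
      refine monotoneOn_of_deriv_nonneg (convex_Ioi 0)
        (fun x hx ↦ (hd x hx).continuousAt.continuousWithinAt)
        (fun x hx ↦ (hd x (interior_subset hx)).differentiableAt.differentiableWithinAt) ?_
      intro x hx
      rw [interior_Ioi] at hx
      have hx : 0 < x := hx
      rw [(hd x hx).deriv]
      have hs := Real.sinh_pos_iff.2 hx
      have := Real.pow_three_mul_cosh_le hx.le
      have e : -(2 * Real.sinh x * Real.cosh x) / (Real.sinh x ^ 2) ^ 2 - (-(2 * x) / (x ^ 2) ^ 2)
          = 2 * (Real.sinh x ^ 3 - x ^ 3 * Real.cosh x) / (x ^ 3 * Real.sinh x ^ 3) := by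
        field_simp
        ring
      rw [e]
      exact div_nonneg (by linarith) (by positivity)
    exact hm.congr fun v hv ↦ (hasDerivAt_invSubCoth hv).deriv.symm

lemma neg_one_le_invSubCoth {v : ℝ} (hv : 0 ≤ v) : -1 ≤ invSubCoth v := by
  rcases hv.eq_or_lt with rfl | hv
  · simp
  have hs := Real.sinh_pos_iff.2 hv
  have h : Real.cosh v / Real.sinh v ≤ v⁻¹ + 1 := by
    rw [div_le_iff₀ hs]
    have h1 : Real.cosh v - Real.sinh v = Real.exp (-v) := Real.cosh_sub_sinh v
    have h2 : Real.exp (-v) ≤ 1 := Real.exp_le_one_iff.2 (by linarith)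
    have h3 : v ≤ Real.sinh v := Real.self_le_sinh_iff.2 hv.le
    have h4 : 1 ≤ v⁻¹ * Real.sinh v := by
      rw [inv_mul_eq_div, le_div_iff₀ hv]
      linarith
    linarith
  rw [invSubCoth]
  linarith

lemma one_add_invSubCoth_le {v : ℝ} (hv : 0 < v) : 1 + invSubCoth v ≤ v⁻¹ := by
  have hs := Real.sinh_pos_iff.2 hv
  have : 1 ≤ Real.cosh v / Real.sinh v := by
    rw [le_div_iff₀ hs]
    linarith [Real.cosh_sub_sinh v, Real.exp_pos (-v)]
  rw [invSubCoth]
  linarith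

/-- A second order difference of samples of a convex function. -/
lemma invSubCoth_second_difference_nonneg {y : ℝ} (hy : 0 ≤ y) (n : ℕ) :
    0 ≤ invSubCoth (n * y) - 2 * invSubCoth ((n + 1 : ℕ) * y) + invSubCoth ((n + 2 : ℕ) * y) := by
  have h0 : ((n : ℝ) * y) ∈ Ici (0 : ℝ) := mem_Ici.2 (by positivity)
  have h2 : (((n + 2 : ℕ) : ℝ) * y) ∈ Ici (0 : ℝ) := mem_Ici.2 (by positivity)
  have h := convexOn_invSubCoth.2 h0 h2 (show (0 : ℝ) ≤ 1 / 2 by norm_num)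
    (show (0 : ℝ) ≤ 1 / 2 by norm_num) (by norm_num)
  have e : (1 / 2 : ℝ) • ((n : ℝ) * y) + (1 / 2 : ℝ) • (((n + 2 : ℕ) : ℝ) * y)
      = ((n + 1 : ℕ) : ℝ) * y := by
    push_cast
    simp only [smul_eq_mul]
    ring
  rw [e] at h
  simp only [smul_eq_mul] at h
  linarith

/-- `1 / sinh v - 1 / v` in terms of `invSubCoth`. -/
lemma invSubCoth_sub {v : ℝ} (hv : 0 < v) :
    invSubCoth v - invSubCoth (v / 2) = (Real.sinh v)⁻¹ - v⁻¹ := by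
  have hs := Real.sinh_pos_iff.2 (half_pos hv)
  have e1 : Real.sinh v = 2 * Real.sinh (v / 2) * Real.cosh (v / 2) := by
    rw [← Real.sinh_two_mul]; ring_nf
  have e2 : Real.cosh v = 2 * Real.cosh (v / 2) ^ 2 - 1 := by
    have := Real.cosh_two_mul (v / 2)
    rw [show 2 * (v / 2) = v by ring] at this
    linarith [Real.cosh_sq (v / 2)]
  have hc := Real.cosh_pos (v / 2)
  rw [invSubCoth, invSubCoth, e1, e2]
  field_simp
  ring

end

section

open Complex Set Filter Topology

/-- Summation by parts, twice. -/
lemma one_sub_sq_mul_sum (ω : ℂ) (p : ℕ → ℂ) (N : ℕ) :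
    (1 - ω) ^ 2 * ∑ d ∈ Finset.range N, ω ^ d * p d =
      (1 - ω) * p 0 - ω * (p 0 - p 1)
        + ω * ∑ d ∈ Finset.range N, ω ^ (d + 1) * (p d - 2 * p (d + 1) + p (d + 2))
        + ω ^ (N + 1) * (p N - p (N + 1)) - (1 - ω) * ω ^ N * p N := by
  induction N with
  | zero => simp
  | succ n ih =>
    rw [Finset.sum_range_succ, Finset.sum_range_succ, mul_add, ih]
    ring

lemma norm_one_sub_sq_mul_sum_sub_le {ω : ℂ} (hω : ‖ω‖ = 1) {p : ℕ → ℝ} (hp : ∀ n, 0 ≤ p n)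
    (hc : ∀ n, 0 ≤ p n - 2 * p (n + 1) + p (n + 2)) (N : ℕ) :
    ‖(1 - ω) ^ 2 * ∑ d ∈ Finset.range N, ω ^ d * (p d : ℂ) - (1 - ω) * p 0‖
      ≤ |p 0 - p 1| + (p 0 - p 1) + 3 * p N + 2 * p (N + 1) := by
  have hs : ∀ N, ∑ d ∈ Finset.range N, (p d - 2 * p (d + 1) + p (d + 2))
      = (p 0 - p 1) - (p N - p (N + 1)) := by
    intro N
    induction N with
    | zero => simp
    | succ n ih => rw [Finset.sum_range_succ, ih]; ring
  have h1 : ‖∑ d ∈ Finset.range N, ω ^ (d + 1) *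
      ((p d : ℂ) - 2 * p (d + 1) + p (d + 2))‖ ≤ (p 0 - p 1) - (p N - p (N + 1)) := by
    rw [← hs]
    refine norm_sum_le_of_le _ fun d _ ↦ ?_
    rw [norm_mul, norm_pow, hω, one_pow, one_mul]
    have : ((p d : ℂ) - 2 * p (d + 1) + p (d + 2)) =
        ((p d - 2 * p (d + 1) + p (d + 2) : ℝ) : ℂ) := by
      push_cast; ring
    rw [this, Complex.norm_real, Real.norm_of_nonneg (hc d)]
  rw [one_sub_sq_mul_sum ω (fun n ↦ (p n : ℂ))]
  have e : (1 - ω) * (p 0 : ℂ) - ω * (p 0 - p 1)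
        + ω * ∑ d ∈ Finset.range N, ω ^ (d + 1) * ((p d : ℂ) - 2 * p (d + 1) + p (d + 2))
        + ω ^ (N + 1) * (p N - p (N + 1)) - (1 - ω) * ω ^ N * p N - (1 - ω) * p 0
      = - (ω * ((p 0 - p 1 : ℝ) : ℂ))
        + ω * ∑ d ∈ Finset.range N, ω ^ (d + 1) * ((p d : ℂ) - 2 * p (d + 1) + p (d + 2))
        - ω ^ (N + 1) * p (N + 1) + (2 * ω - 1) * ω ^ N * p N := by
    push_cast; ring
  rw [e]
  have h2 : ‖2 * ω - 1‖ ≤ 3 := by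
    refine (norm_sub_le _ _).trans ?_
    rw [norm_mul, hω]; norm_num
  have n1 : ‖-(ω * ((p 0 - p 1 : ℝ) : ℂ))‖ = |p 0 - p 1| := by
    rw [norm_neg, norm_mul, hω, Complex.norm_real, one_mul, Real.norm_eq_abs]
  have n2 : ‖ω ^ (N + 1) * (p (N + 1) : ℂ)‖ = p (N + 1) := by
    rw [norm_mul, norm_pow, hω, Complex.norm_real, one_pow, one_mul, Real.norm_of_nonneg (hp _)]
  have n3 : ‖(2 * ω - 1) * ω ^ N * (p N : ℂ)‖ ≤ 3 * p N := by
    rw [norm_mul, norm_mul, norm_pow, hω, Complex.norm_real, one_pow, mul_one,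
      Real.norm_of_nonneg (hp _)]
    exact mul_le_mul_of_nonneg_right h2 (hp N)
  have n4 : ‖ω * ∑ d ∈ Finset.range N, ω ^ (d + 1) * ((p d : ℂ) - 2 * p (d + 1) + p (d + 2))‖
      ≤ (p 0 - p 1) - (p N - p (N + 1)) := by
    rw [norm_mul, hω, one_mul]; exact h1
  have t1 := norm_add_le (- (ω * ((p 0 - p 1 : ℝ) : ℂ))
        + ω * ∑ d ∈ Finset.range N, ω ^ (d + 1) * ((p d : ℂ) - 2 * p (d + 1) + p (d + 2))
        - ω ^ (N + 1) * p (N + 1)) ((2 * ω - 1) * ω ^ N * p N)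
  have t2 := norm_sub_le (- (ω * ((p 0 - p 1 : ℝ) : ℂ))
        + ω * ∑ d ∈ Finset.range N, ω ^ (d + 1) * ((p d : ℂ) - 2 * p (d + 1) + p (d + 2)))
        (ω ^ (N + 1) * p (N + 1))
  have t3 := norm_add_le (- (ω * ((p 0 - p 1 : ℝ) : ℂ)))
        (ω * ∑ d ∈ Finset.range N, ω ^ (d + 1) * ((p d : ℂ) - 2 * p (d + 1) + p (d + 2)))
  have := hp N
  linarith

/-- The exponential sum with coefficients `1 / sinh (d y) - 1 / (d y)`. -/
lemma norm_one_sub_sq_mul_sum_inv_sinh_sub_le {ω : ℂ} (hω : ‖ω‖ = 1) {y : ℝ} (hy : 0 < y)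
    {N : ℕ} (hN : 0 < N) :
    ‖(1 - ω) ^ 2 * ∑ d ∈ Finset.range N,
        ω ^ d * (((Real.sinh (d * y))⁻¹ - (d * y)⁻¹ : ℝ) : ℂ)‖ ≤ 3 * y + 15 / (N * y) := by
  have key : ∀ y : ℝ, 0 < y →
      ‖(1 - ω) ^ 2 * ∑ d ∈ Finset.range N, ω ^ d * ((1 + invSubCoth (d * y) : ℝ) : ℂ) - (1 - ω)‖
        ≤ 2 * y + 5 / (N * y) := by
    intro y hy
    have hN' : (0 : ℝ) < N := by exact_mod_cast hN
    have hb : ∀ n : ℕ, 0 ≤ 1 + invSubCoth (n * y) := fun n ↦ by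
      linarith [neg_one_le_invSubCoth (v := n * y) (by positivity)]
    have h := norm_one_sub_sq_mul_sum_sub_le hω (p := fun n ↦ 1 + invSubCoth (n * y)) hb
      (fun n ↦ by linarith [invSubCoth_second_difference_nonneg hy.le n]) N
    simp only [Nat.cast_zero, zero_mul, invSubCoth_zero, Nat.cast_one, one_mul, add_zero,
      ofReal_one, mul_one] at h
    refine h.trans ?_
    have h1 := neg_le_invSubCoth hy.le
    have h2 := invSubCoth_nonpos hy.le
    have h3 := one_add_invSubCoth_le (v := N * y) (by positivity)
    have h4 := one_add_invSubCoth_le (v := (N + 1 : ℕ) * y) (by positivity)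
    have h5 : (((N + 1 : ℕ) : ℝ) * y)⁻¹ ≤ (N * y)⁻¹ := by
      gcongr
      simp
    rw [abs_of_nonneg (by linarith), div_eq_mul_inv]
    linarith
  have h1 := key y hy
  have h2 := key (y / 2) (half_pos hy)
  have e : (1 - ω) ^ 2 * ∑ d ∈ Finset.range N,
        ω ^ d * (((Real.sinh (d * y))⁻¹ - (d * y)⁻¹ : ℝ) : ℂ)
      = ((1 - ω) ^ 2 * ∑ d ∈ Finset.range N, ω ^ d * ((1 + invSubCoth (d * y) : ℝ) : ℂ) - (1 - ω))
      - ((1 - ω) ^ 2 * ∑ d ∈ Finset.range N,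
          ω ^ d * ((1 + invSubCoth (d * (y / 2)) : ℝ) : ℂ) - (1 - ω)) := by
    rw [sub_sub_sub_cancel_right, ← mul_sub, ← Finset.sum_sub_distrib]
    congr 1
    refine Finset.sum_congr rfl fun d _ ↦ ?_
    rw [← mul_sub, ← ofReal_sub]
    congr 2
    rcases Nat.eq_zero_or_pos d with rfl | hd
    · simp
    have hd' : (0 : ℝ) < d := by exact_mod_cast hd
    rw [← invSubCoth_sub (by positivity), mul_div_assoc]
    ring
  rw [e]
  refine (norm_sub_le _ _).trans ((add_le_add h1 h2).trans (le_of_eq ?_))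
  field_simp
  ring

end

section

open Complex Set Filter Topology

lemma sum_range_inv_succ_sq_le (n : ℕ) :
    ∑ k ∈ Finset.range n, (((k : ℝ) + 1) ^ 2)⁻¹ ≤ 2 - (n : ℝ)⁻¹ := by
  induction n with
  | zero => simp
  | succ n ih =>
    rw [Finset.sum_range_succ]
    rcases Nat.eq_zero_or_pos n with rfl | hn
    · norm_num
    have hn' : (0 : ℝ) < n := by exact_mod_cast hn
    have : (((n : ℝ) + 1) ^ 2)⁻¹ ≤ (n : ℝ)⁻¹ - ((n : ℝ) + 1)⁻¹ := by
      rw [inv_sub_inv (by positivity) (by positivity), inv_eq_one_div]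
      rw [div_le_div_iff₀ (by positivity) (by positivity)]
      nlinarith
    push_cast
    linarith

lemma sum_range_inv_sq_le (n : ℕ) : ∑ k ∈ Finset.range n, ((k : ℝ) ^ 2)⁻¹ ≤ 2 := by
  cases n with
  | zero => simp
  | succ n =>
    rw [Finset.sum_range_succ']
    have := sum_range_inv_succ_sq_le n
    have h : (0 : ℝ) ≤ (n : ℝ)⁻¹ := by positivity
    push_cast
    norm_num
    linarith

lemma sum_range_inv_sub_sq_le (q : ℕ) :
    ∑ k ∈ Finset.range q, (((q : ℝ) - k) ^ 2)⁻¹ ≤ 2 := by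
  rw [← Finset.sum_range_reflect]
  refine (Finset.sum_le_sum (g := fun k : ℕ ↦ (((k : ℝ) + 1) ^ 2)⁻¹) ?_).trans
    ((sum_range_inv_succ_sq_le q).trans (by simp))
  intro k hk
  have hk := Finset.mem_range.1 hk
  rw [Nat.sub_sub, Nat.cast_sub (by omega)]
  push_cast
  apply le_of_eq
  ring_nf

/-- Nontrivial `q`-th roots of unity are not too close to `1`. -/
lemma inv_norm_one_sub_stdAddChar_sq_le {q : ℕ} [NeZero q] {h : ZMod q} (hh : h ≠ 0) :
    (‖1 - ZMod.stdAddChar h‖ ^ 2)⁻¹ ≤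
      (q : ℝ) ^ 2 / 16 * (((h.val : ℝ) ^ 2)⁻¹ + (((q : ℝ) - h.val) ^ 2)⁻¹) := by
  have hq : (0 : ℝ) < q := by exact_mod_cast Nat.pos_of_ne_zero (NeZero.ne q)
  set k := h.val with hk
  have hk0 : 0 < k := Nat.pos_of_ne_zero (by rw [hk, Ne, ZMod.val_eq_zero]; exact hh)
  have hkq : k < q := ZMod.val_lt h
  have hk0' : (0 : ℝ) < k := by exact_mod_cast hk0
  have hkq' : (k : ℝ) < q := by exact_mod_cast hkq
  set θ : ℝ := Real.pi * k / q with hθ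
  have e1 : ZMod.stdAddChar h = exp ((2 * θ : ℝ) * I) := by
    have : h = ((k : ℤ) : ZMod q) := by simp [hk]
    rw [this, ZMod.stdAddChar_coe]
    congr 1
    rw [hθ]
    push_cast
    ring
  have e2 : ‖1 - ZMod.stdAddChar h‖ ^ 2 = 4 * Real.sin θ ^ 2 := by
    rw [e1, Complex.sq_norm, exp_mul_I, normSq_apply]
    simp only [← ofReal_cos, ← ofReal_sin, sub_re, one_re, add_re, ofReal_re, mul_re, I_re,
      mul_zero, ofReal_im, I_im, sub_im, one_im, add_im, mul_im]
    rw [Real.cos_two_mul, Real.sin_two_mul]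
    have := Real.sin_sq_add_cos_sq θ
    have h2 : Real.cos θ ^ 2 = 1 - Real.sin θ ^ 2 := by linarith
    ring_nf
    rw [show Real.cos θ ^ 4 = (Real.cos θ ^ 2) ^ 2 by ring, h2]
    ring
  have key : ∀ m : ℝ, 0 < m → 2 * m / q ≤ Real.sin θ →
      (‖1 - ZMod.stdAddChar h‖ ^ 2)⁻¹ ≤ (q : ℝ) ^ 2 / 16 * (m ^ 2)⁻¹ := by
    intro m hm hs
    rw [e2]
    calc _ ≤ (4 * (2 * m / q) ^ 2)⁻¹ := by gcongr
      _ = _ := by field_simp; norm_num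
  have hpi := Real.pi_pos
  rcases le_total (2 * (k : ℝ)) q with h2 | h2
  · refine (key k hk0' ?_).trans ?_
    · refine le_trans (le_of_eq ?_) (Real.mul_le_sin (x := θ) (by positivity) ?_)
      · rw [hθ]; field_simp
      · rw [hθ, div_le_iff₀ hq]; nlinarith
    · gcongr
      have : 0 ≤ (((q : ℝ) - k) ^ 2)⁻¹ := by positivity
      linarith
  · refine (key (q - k) (by linarith) ?_).trans ?_
    · rw [← Real.sin_pi_sub]
      have e3 : Real.pi - θ = Real.pi * (q - k) / q := by rw [hθ]; field_simp
      rw [e3]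
      refine le_trans (le_of_eq ?_) (Real.mul_le_sin (x := Real.pi * (q - k) / q) ?_ ?_)
      · field_simp
      · exact div_nonneg (mul_nonneg hpi.le (by linarith)) hq.le
      · rw [div_le_iff₀ hq]; nlinarith
    · gcongr
      have : 0 ≤ ((k : ℝ) ^ 2)⁻¹ := by positivity
      linarith

lemma sum_zmod_val {q : ℕ} [NeZero q] (f : ℕ → ℝ) :
    ∑ h : ZMod q, f h.val = ∑ k ∈ Finset.range q, f k :=
  Finset.sum_nbij' (fun h ↦ h.val) (fun k ↦ (k : ZMod q))
    (fun h _ ↦ Finset.mem_range.2 (ZMod.val_lt h)) (fun _ _ ↦ Finset.mem_univ _)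
    (fun h _ ↦ by simp) (fun k hk ↦ ZMod.val_cast_of_lt (Finset.mem_range.1 hk)) (fun _ _ ↦ rfl)

namespace DirichletCharacter

lemma inv_eq_self_of_sq_eq_one {q : ℕ} {χ : DirichletCharacter ℂ q} (h2 : χ ^ 2 = 1) :
    χ⁻¹ = χ :=
  inv_eq_of_mul_eq_one_left (by rw [← sq, h2])

variable {q : ℕ} [NeZero q] {χ : DirichletCharacter ℂ q}

lemma norm_gaussSum_sq (hp : χ.IsPrimitive) (h2 : χ ^ 2 = 1) :
    ‖gaussSum χ ZMod.stdAddChar‖ ^ 2 = q := by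
  set τ := gaussSum χ ZMod.stdAddChar with hτ
  have h1 : ZMod.dft (fun k ↦ χ k) = fun k ↦ (χ (-1) * τ) * χ k := by
    ext k
    rw [hp.fourierTransform_eq_inv_mul_gaussSum, inv_eq_self_of_sq_eq_one h2, ← neg_one_mul,
      map_mul]
    ring
  have h3 := congrFun (ZMod.dft_dft (fun k ↦ χ k)) 1
  rw [h1, ZMod.dft_const_mul, h1] at h3
  simp only [map_one, mul_one, smul_eq_mul] at h3
  have h4 := congrArg (‖·‖) h3
  have h5 : ‖χ (-1)‖ = 1 := by
    have := χ.unit_norm_eq_one (-1)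
    simpa using this
  simp only [norm_mul, h5, one_mul, mul_one, Complex.norm_natCast] at h4
  rw [sq, h4]

lemma gaussSum_mul_eq (hp : χ.IsPrimitive) (h2 : χ ^ 2 = 1) (d : ZMod q) :
    gaussSum χ ZMod.stdAddChar * χ d = ∑ h : ZMod q, χ h * ZMod.stdAddChar (d * h) := by
  have := gaussSum_mulShift_of_isPrimitive ZMod.stdAddChar hp d
  rw [inv_eq_self_of_sq_eq_one h2] at this
  rw [mul_comm, ← this, gaussSum]
  rfl

lemma norm_sum_mul_inv_sinh_sub_le (hχ : χ ≠ 1) (hp : χ.IsPrimitive) (h2 : χ ^ 2 = 1)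
    {y : ℝ} (hy : 0 < y) {N : ℕ} (hN : 0 < N) :
    ‖∑ d ∈ Finset.range N, χ d * (((Real.sinh (d * y))⁻¹ - (d * y)⁻¹ : ℝ) : ℂ)‖
      ≤ (3 * y + 15 / (N * y)) * ((q : ℝ) ^ 2 / 4) / Real.sqrt q := by
  have hq : (0 : ℝ) < q := by exact_mod_cast Nat.pos_of_ne_zero (NeZero.ne q)
  have hq1 : q ≠ 1 := by
    rintro rfl
    exact hχ (level_one χ)
  set τ := gaussSum χ ZMod.stdAddChar with hτ
  have hτn : ‖τ‖ = Real.sqrt q := by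
    rw [← norm_gaussSum_sq hp h2, Real.sqrt_sq (norm_nonneg _)]
  set B := 3 * y + 15 / (N * y) with hB
  have hB0 : 0 ≤ B := by positivity
  set F : ℕ → ℂ := fun d ↦ (((Real.sinh (d * y))⁻¹ - (d * y)⁻¹ : ℝ) : ℂ) with hF
  have e : τ * ∑ d ∈ Finset.range N, χ d * F d
      = ∑ h : ZMod q, χ h * ∑ d ∈ Finset.range N, ZMod.stdAddChar h ^ d * F d := by
    rw [Finset.mul_sum]
    simp_rw [Finset.mul_sum]
    rw [Finset.sum_comm]
    refine Finset.sum_congr rfl fun d _ ↦ ?_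
    rw [← mul_assoc, gaussSum_mul_eq hp h2, Finset.sum_mul]
    refine Finset.sum_congr rfl fun h _ ↦ ?_
    rw [← AddChar.map_nsmul_eq_pow, nsmul_eq_mul]
    ring
  rw [le_div_iff₀ (Real.sqrt_pos.2 hq), mul_comm, ← hτn, ← norm_mul, e]
  have hterm : ∀ h : ZMod q, ‖χ h * ∑ d ∈ Finset.range N, ZMod.stdAddChar h ^ d * F d‖
      ≤ B * ((q : ℝ) ^ 2 / 16 * (((h.val : ℝ) ^ 2)⁻¹ + (((q : ℝ) - h.val) ^ 2)⁻¹)) := by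
    intro h
    rcases eq_or_ne h 0 with rfl | hh
    · have : χ 0 = 0 := by
        have : Fact (1 < q) := ⟨by have := NeZero.ne q; omega⟩
        exact χ.map_zero
      rw [this]
      simp only [zero_mul, norm_zero]
      positivity
    · have h1 := inv_norm_one_sub_stdAddChar_sq_le hh
      have hω : ‖(ZMod.stdAddChar h : ℂ)‖ = 1 := by
        rw [ZMod.stdAddChar_apply, Circle.norm_coe]
      have hne : (0 : ℝ) < ‖1 - (ZMod.stdAddChar h : ℂ)‖ := by
        rw [norm_pos_iff, sub_ne_zero]
        intro h3
        apply hh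
        apply ZMod.injective_stdAddChar
        rw [← h3, AddChar.map_zero_eq_one]
      have h2 := norm_one_sub_sq_mul_sum_inv_sinh_sub_le hω hy hN
      rw [norm_mul, norm_pow] at h2
      rw [norm_mul]
      calc _ ≤ 1 * ‖∑ d ∈ Finset.range N, ZMod.stdAddChar h ^ d * F d‖ :=
            mul_le_mul_of_nonneg_right (χ.norm_le_one h) (norm_nonneg _)
        _ ≤ B * (‖1 - (ZMod.stdAddChar h : ℂ)‖ ^ 2)⁻¹ := by
            rw [one_mul, ← div_eq_mul_inv, le_div_iff₀ (by positivity), mul_comm]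
            exact h2
        _ ≤ _ := mul_le_mul_of_nonneg_left h1 hB0
  refine (norm_sum_le_of_le _ fun h _ ↦ hterm h).trans ?_
  rw [sum_zmod_val (fun k ↦ B * ((q : ℝ) ^ 2 / 16 * (((k : ℝ) ^ 2)⁻¹ + (((q : ℝ) - k) ^ 2)⁻¹))),
    ← Finset.mul_sum, ← Finset.mul_sum, Finset.sum_add_distrib]
  refine mul_le_mul_of_nonneg_left ?_ hB0
  have := sum_range_inv_sq_le q
  have := sum_range_inv_sub_sq_le q
  nlinarith [sq_nonneg (q : ℝ)]

end DirichletCharacter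

end

section

open Complex MeasureTheory Set Filter Topology

namespace DirichletCharacter

open scoped ComplexOrder in
lemma one_le_zetaMul_sq {N : ℕ} {χ : DirichletCharacter ℂ N} (h2 : χ ^ 2 = 1) {m : ℕ}
    (hm : m ≠ 0) : 1 ≤ zetaMul χ (m ^ 2) := by
  rw [χ.isMultiplicative_zetaMul.multiplicative_factorization _ (pow_ne_zero 2 hm)]
  refine Finset.prod_induction _ (fun z ↦ (1 : ℂ) ≤ z)
    (fun a b ha hb ↦ one_le_mul_of_one_le_of_one_le ha hb) le_rfl ?_
  intro p hp
  have hp : p.Prime := Nat.prime_of_mem_primeFactors hp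
  rw [Nat.factorization_pow, Finsupp.smul_apply, smul_eq_mul]
  set j := m.factorization p
  have e : zetaMul χ (p ^ (2 * j)) = ∑ i ∈ Finset.range (2 * j + 1), χ p ^ i := by
    rw [zetaMul, ArithmeticFunction.coe_zeta_mul_apply, Nat.sum_divisors_prime_pow hp]
    refine Finset.sum_congr rfl fun i _ ↦ ?_
    rw [← apply_eq_toArithmeticFunction_apply χ (pow_ne_zero i hp.ne_zero)]
    simp
  simp only
  rw [e]
  rcases MulChar.isQuadratic_iff_sq_eq_one.mpr h2 p with h | h | h
  · rw [h, Finset.sum_range_succ']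
    simp
  · rw [h]
    simp only [one_pow, Finset.sum_const, Finset.card_range, nsmul_eq_mul, mul_one]
    exact_mod_cast Nat.succ_le_succ (Nat.zero_le _)
  · rw [h, neg_one_geom_sum, if_neg (by simp)]

/-- The conditionally convergent series for `L(1, χ)`. -/
lemma tendsto_sum_LFunction_one {q : ℕ} [NeZero q] {χ : DirichletCharacter ℂ q} (hχ : χ ≠ 1) :
    Tendsto (fun N : ℕ ↦ ∑ d ∈ Finset.range N, χ d * (d : ℂ)⁻¹) atTop (𝓝 (χ.LFunction 1)) := by
  have hq1 : q ≠ 1 := by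
    rintro rfl
    exact hχ (level_one χ)
  have h0 : χ ((0 : ℕ) : ZMod q) = 0 := by
    have : Fact (1 < q) := ⟨by have := NeZero.ne q; omega⟩
    rw [Nat.cast_zero]
    exact χ.map_zero
  have hIcc : ∀ n : ℕ, ∑ k ∈ Finset.Icc 0 n, χ k = ∑ k ∈ Finset.Icc 1 n, χ k := by
    intro n
    rw [← Finset.insert_Icc_succ_left_eq_Icc (Nat.zero_le n), Finset.sum_insert (by simp), h0,
      zero_add]
    rfl
  have hd : ∀ t : ℝ, t ≠ 0 → HasDerivAt (fun t : ℝ ↦ (t : ℂ)⁻¹) (-((t : ℂ) ^ 2)⁻¹) t := by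
    intro t ht
    have := (hasDerivAt_inv (ofReal_ne_zero.2 ht)).comp_ofReal
    simpa using this
  have hbd : ∀ n : ℕ, ‖∑ k ∈ Finset.Icc 0 n, χ k‖ ≤ q := fun n ↦ by
    rw [hIcc]; exact norm_sum_Icc_le hχ n
  have main := tendsto_sum_mul_atTop_nhds_one_sub_integral₀ (fun n : ℕ ↦ χ n)
    (f := fun t : ℝ ↦ (t : ℂ)⁻¹) h0
    (fun t ht ↦ (hd t (by have := mem_Ici.1 ht; positivity)).differentiableAt)
    ?_ (l := 0) ?_ (g := fun t ↦ t ^ (-2 : ℝ)) ?_ ?_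
  · rw [← tendsto_add_atTop_iff_nat 1]
    convert! main using 2 with n
    · rw [Nat.range_succ_eq_Icc_zero]
      refine Finset.sum_congr rfl fun d _ ↦ ?_
      rw [mul_comm]
      simp
    · rw [LFunction_eq_mul_integral hχ (by simp), one_mul, zero_sub, ← integral_neg]
      refine setIntegral_congr_fun measurableSet_Ioi fun t ht ↦ ?_
      have ht : (1 : ℝ) < t := ht
      have e : (-(1 + 1) : ℂ) = ((-2 : ℤ) : ℂ) := by norm_num
      rw [(hd t (by positivity)).deriv, hIcc, e, cpow_intCast, neg_mul, neg_neg, mul_comm]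
      congr 1
  · have : ContinuousOn (fun t : ℝ ↦ -((t : ℂ) ^ 2)⁻¹) (Ici 1) := by
      refine ContinuousOn.neg (ContinuousOn.inv₀ (by fun_prop) ?_)
      intro t ht
      have := mem_Ici.1 ht
      exact pow_ne_zero 2 (ofReal_ne_zero.2 (by positivity))
    refine (this.congr fun t ht ↦ ?_).locallyIntegrableOn measurableSet_Ici
    exact (hd t (by have := mem_Ici.1 ht; positivity)).deriv
  · rw [tendsto_zero_iff_norm_tendsto_zero]
    refine squeeze_zero (fun _ ↦ norm_nonneg _) (g := fun n : ℕ ↦ (n : ℝ)⁻¹ * q) ?_ ?_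
    · intro n
      rw [norm_mul, norm_inv]
      simp only [ofReal_natCast, Complex.norm_natCast]
      exact mul_le_mul_of_nonneg_left (hbd n) (by positivity)
    · simpa using (tendsto_inv_atTop_nhds_zero_nat (𝕜 := ℝ)).mul_const (q : ℝ)
  · refine Asymptotics.IsBigO.of_bound q ?_
    filter_upwards [eventually_gt_atTop 0] with t ht
    rw [(hd t ht.ne').deriv, norm_mul, norm_neg, norm_inv, norm_pow, Complex.norm_real, mul_comm,
      Real.rpow_neg ht.le, norm_inv, Real.norm_of_nonneg ht.le]
    refine mul_le_mul (hbd _) (le_of_eq ?_) (by positivity) (by positivity)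
    rw [Real.norm_of_nonneg (by positivity)]
    norm_cast
  · exact (integrableAtFilter_rpow_atTop_iff).2 (by norm_num)

lemma hasSum_pnat_exp_sub {u : ℝ} (hu : 0 < u) :
    HasSum (fun m : ℕ+ ↦ Real.exp (-(m * u)) - Real.exp (-(2 * (m * u))))
      (2 * Real.sinh u)⁻¹ := by
  have hx : ∀ u : ℝ, 0 < u → HasSum (fun m : ℕ+ ↦ Real.exp (-(m * u)))
      (Real.exp (-u) * (1 - Real.exp (-u))⁻¹) := by
    intro u hu
    have h := (hasSum_geometric_of_lt_one (Real.exp_pos (-u)).le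
      (Real.exp_lt_one_iff.2 (neg_lt_zero.2 hu))).mul_left (Real.exp (-u))
    rw [← Equiv.pnatEquivNat.hasSum_iff] at h
    convert! h using 2 with m
    simp only [Function.comp_apply, Equiv.pnatEquivNat_apply]
    rw [← pow_succ', PNat.natPred_add_one, ← Real.exp_nat_mul]
    ring_nf
  have h := (hx u hu).sub (hx (2 * u) (by linarith))
  convert! h using 1
  · ext m
    ring_nf
  · rw [show -(2 * u) = -u + -u by ring, Real.exp_add, Real.sinh_eq]
    have h1 : Real.exp (-u) < 1 := Real.exp_lt_one_iff.2 (neg_lt_zero.2 hu)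
    have h2 := Real.exp_pos (-u)
    have e : Real.exp u = (Real.exp (-u))⁻¹ := by rw [← Real.exp_neg, neg_neg]
    rw [e]
    set x := Real.exp (-u)
    have h3 : 1 - x ≠ 0 := by linarith
    have h4 : 1 - x * x ≠ 0 := by nlinarith
    have h5 : 1 - x ^ 2 ≠ 0 := by nlinarith
    have h6 : x⁻¹ - x ≠ 0 := by
      have : x⁻¹ - x = (1 - x * x) / x := by field_simp
      rw [this]
      exact div_ne_zero h4 h2.ne'
    have e1 : x⁻¹ - x = (1 - x) * (1 + x) / x := by field_simp; ring
    have e2 : 1 - x * x = (1 - x) * (1 + x) := by ring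
    rw [e1, e2]
    have h7 : 1 + x ≠ 0 := by positivity
    field_simp
    ring

end DirichletCharacter

end

section

open Complex MeasureTheory Set Filter Topology

namespace DirichletCharacter

variable {q : ℕ} {χ : DirichletCharacter ℂ q}

/-- The weight `e^{-x} - e^{-2 x}`. -/
noncomputable def expWeight (x : ℝ) : ℝ := Real.exp (-x) - Real.exp (-(2 * x))

lemma expWeight_nonneg {x : ℝ} (hx : 0 ≤ x) : 0 ≤ expWeight x := by
  rw [expWeight, sub_nonneg]
  exact Real.exp_le_exp.2 (by linarith)

lemma le_expWeight {x : ℝ} (hx : 1 / 4 ≤ x) (hx1 : x ≤ 1) : 1 / 32 ≤ expWeight x := by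
  have e : expWeight x = Real.exp (-(2 * x)) * (Real.exp x - 1) := by
    rw [expWeight, mul_sub, ← Real.exp_add]
    ring_nf
  have h1 : Real.exp (-2) ≤ Real.exp (-(2 * x)) := Real.exp_le_exp.2 (by linarith)
  have h2 : 1 / 4 ≤ Real.exp x - 1 := by linarith [Real.add_one_le_exp x]
  have h3 : 1 / 8 ≤ Real.exp (-2) := by
    rw [Real.exp_neg, one_div, inv_le_inv₀ (by norm_num) (Real.exp_pos _),
      show (2 : ℝ) = 1 + 1 by norm_num, Real.exp_add]
    nlinarith [Real.exp_one_lt_d9, Real.exp_pos 1]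
  rw [e]
  nlinarith

lemma summable_mul_expWeight (χ : DirichletCharacter ℂ q) {y : ℝ} (hy : 0 < y) :
    Summable fun x : ℕ+ × ℕ+ ↦ χ (x.1 : ℕ) * (expWeight (x.1 * x.2 * y) : ℂ) := by
  have h1 : Summable fun n : ℕ+ ↦ Real.exp (-(n * (y / 2))) := by
    have := (Real.summable_exp_nat_mul_iff (a := -(y / 2))).2 (by linarith)
    refine (this.comp_injective PNat.coe_injective).congr fun n ↦ ?_
    simp only [Function.comp_apply]
    ring_nf
  refine Summable.of_norm_bounded (h1.mul_of_nonneg h1 (fun _ ↦ (Real.exp_pos _).le)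
    (fun _ ↦ (Real.exp_pos _).le)) fun x ↦ ?_
  obtain ⟨a, b⟩ := x
  have ha : (1 : ℝ) ≤ a := by exact_mod_cast a.2
  have hb : (1 : ℝ) ≤ b := by exact_mod_cast b.2
  rw [norm_mul, Complex.norm_real, Real.norm_of_nonneg (expWeight_nonneg (by positivity))]
  calc _ ≤ 1 * expWeight (a * b * y) := mul_le_mul_of_nonneg_right (χ.norm_le_one _)
        (expWeight_nonneg (by positivity))
    _ ≤ Real.exp (-(a * b * y)) := by
        rw [one_mul, expWeight]
        linarith [Real.exp_pos (-(2 * (a * b * y)))]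
    _ ≤ Real.exp (-(a * (y / 2))) * Real.exp (-(b * (y / 2))) := by
        rw [← Real.exp_add, Real.exp_le_exp]
        nlinarith [mul_nonneg (sub_nonneg.2 ha) (sub_nonneg.2 hb)]

lemma hasSum_mul_inv_sinh (χ : DirichletCharacter ℂ q) {y : ℝ} (hy : 0 < y) :
    HasSum (fun d : ℕ+ ↦ χ (d : ℕ) * ((2 * Real.sinh (d * y) : ℝ) : ℂ)⁻¹)
      (∑' x : ℕ+ × ℕ+, χ (x.1 : ℕ) * (expWeight (x.1 * x.2 * y) : ℂ)) := by
  refine HasSum.prod_fiberwise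
    (g := fun d : ℕ+ ↦ χ (d : ℕ) * ((2 * Real.sinh (d * y) : ℝ) : ℂ)⁻¹)
    (summable_mul_expWeight χ hy).hasSum fun d ↦ ?_
  have hd : (0 : ℝ) < d := by exact_mod_cast d.2
  have h := (Complex.hasSum_ofReal (L := SummationFilter.unconditional _)).2
    (hasSum_pnat_exp_sub (u := d * y) (by positivity))
  have h2 : HasSum (fun m : ℕ+ ↦ (expWeight (d * m * y) : ℂ))
      ((2 * Real.sinh (d * y) : ℝ) : ℂ)⁻¹ := by
    rw [← ofReal_inv]
    convert! h using 2 with m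
    simp only [expWeight]
    ring_nf
  exact h2.mul_left (χ (d : ℕ))

lemma hasSum_zetaMul_mul_expWeight (χ : DirichletCharacter ℂ q) {y : ℝ} (hy : 0 < y) :
    HasSum (fun n : ℕ+ ↦ zetaMul χ n * (expWeight (n * y) : ℂ))
      (∑' x : ℕ+ × ℕ+, χ (x.1 : ℕ) * (expWeight (x.1 * x.2 * y) : ℂ)) := by
  have h := (sigmaAntidiagonalEquivProd.hasSum_iff).2 (summable_mul_expWeight χ hy).hasSum
  refine h.sigma fun n ↦ ?_
  have h2 := hasSum_fintype (fun x : Nat.divisorsAntidiagonal n ↦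
    ((fun x : ℕ+ × ℕ+ ↦ χ (x.1 : ℕ) * (expWeight (x.1 * x.2 * y) : ℂ)) ∘
      sigmaAntidiagonalEquivProd) ⟨n, x⟩)
  convert! h2 using 1
  rw [zetaMul, mul_comm (ArithmeticFunction.zeta : ArithmeticFunction ℂ),
    ArithmeticFunction.mul_apply, Finset.sum_mul, ← Finset.sum_coe_sort]
  refine Finset.sum_congr rfl fun x _ ↦ ?_
  obtain ⟨⟨a, b⟩, hx⟩ := x
  obtain ⟨hab, hn⟩ := Nat.mem_divisorsAntidiagonal.1 hx
  have ha0 : a ≠ 0 := by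
    rintro rfl
    exact hn (by rw [← hab, zero_mul])
  have hb0 : b ≠ 0 := by
    rintro rfl
    exact hn (by rw [← hab, mul_zero])
  have e : ((n : ℕ) : ℝ) = a * b := by exact_mod_cast hab.symm
  simp only [Function.comp_apply, sigmaAntidiagonalEquivProd, Equiv.coe_fn_mk,
    divisorsAntidiagonalFactors, PNat.mk_coe]
  rw [← apply_eq_toArithmeticFunction_apply χ ha0, e, ArithmeticFunction.natCoe_apply,
    ArithmeticFunction.zeta_apply_ne hb0]
  simp

open scoped ComplexOrder in
lemma le_re_tsum_mul_expWeight (h2 : χ ^ 2 = 1) {K : ℕ} (hK : 0 < K) :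
    (K : ℝ) / 32 ≤ (∑' x : ℕ+ × ℕ+, χ (x.1 : ℕ) *
      (expWeight (x.1 * x.2 * (1 / (4 * K ^ 2))) : ℂ)).re := by
  have hK' : (0 : ℝ) < K := by exact_mod_cast hK
  set y : ℝ := 1 / (4 * K ^ 2) with hy
  have hy0 : 0 < y := by positivity
  have h := Complex.hasSum_re (hasSum_zetaMul_mul_expWeight χ hy0)
  have hre : ∀ n : ℕ+, (zetaMul χ n * (expWeight (n * y) : ℂ)).re
      = (zetaMul χ n).re * expWeight (n * y) := fun n ↦ by
    rw [mul_comm, re_ofReal_mul, mul_comm]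
  simp only [hre] at h
  have hnn : ∀ n : ℕ+, 0 ≤ (zetaMul χ n).re * expWeight (n * y) := fun n ↦
    mul_nonneg (Complex.le_def.1 (zetaMul_nonneg h2 n)).1 (expWeight_nonneg (by positivity))
  set g : ℕ → ℕ+ := fun j ↦ ⟨(K + j) ^ 2, by positivity⟩ with hg
  have hinj : Function.Injective g := by
    intro i j hij
    have h3 : (K + i) ^ 2 = (K + j) ^ 2 := congrArg PNat.val hij
    have := Nat.pow_left_injective (n := 2) (by norm_num) h3
    omega
  have hle := sum_le_hasSum ((Finset.range K).image g) (fun n _ ↦ hnn n) h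
  rw [Finset.sum_image hinj.injOn] at hle
  refine le_trans ?_ hle
  have hc : (K : ℝ) / 32 = ∑ j ∈ Finset.range K, (1 / 32 : ℝ) := by
    rw [Finset.sum_const, Finset.card_range, nsmul_eq_mul]
    ring
  rw [hc]
  refine Finset.sum_le_sum fun j hj ↦ ?_
  have hj : (j : ℝ) ≤ K := by exact_mod_cast (Finset.mem_range.1 hj).le
  have e : ((g j : ℕ+) : ℕ) = (K + j) ^ 2 := rfl
  have h1 : 1 ≤ (zetaMul χ (g j)).re :=
    (Complex.le_def.1 (one_le_zetaMul_sq h2 (m := K + j) (by omega))).1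
  have h4 : 1 / 32 ≤ expWeight ((g j : ℕ+) * y) := by
    rw [e, hy]
    push_cast
    have hj0 : (0 : ℝ) ≤ j := by positivity
    refine le_expWeight ?_ ?_
    · rw [mul_one_div, div_le_div_iff₀ (by norm_num) (by positivity)]
      nlinarith
    · rw [mul_one_div, div_le_one (by positivity)]
      nlinarith
  nlinarith

/-- An effective lower bound for the value at `1` of a quadratic `L`-function. -/
lemma le_norm_LFunction_one [NeZero q] (hχ : χ ≠ 1) (hp : χ.IsPrimitive) (h2 : χ ^ 2 = 1) :
    1 / (384 * Real.sqrt q) ≤ ‖χ.LFunction 1‖ := by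
  have hq : (1 : ℝ) ≤ q := by exact_mod_cast Nat.pos_of_ne_zero (NeZero.ne q)
  set w := Real.sqrt q with hw
  have hw1 : 1 ≤ w := Real.one_le_sqrt.2 hq
  have hwq : (q : ℝ) = w ^ 2 := (Real.sq_sqrt (by linarith)).symm
  set K := ⌈2 * w⌉₊ with hK
  have hK1 : 2 * w ≤ K := Nat.le_ceil _
  have hK2 : (K : ℝ) ≤ 3 * w := by
    have := (Nat.ceil_lt_add_one (a := 2 * w) (by linarith)).le
    linarith
  have hK0 : (0 : ℝ) < K := by linarith
  set y : ℝ := 1 / (4 * K ^ 2) with hy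
  have hy0 : 0 < y := by positivity
  set S : ℂ := ∑' x : ℕ+ × ℕ+, χ (x.1 : ℕ) * (expWeight (x.1 * x.2 * y) : ℂ) with hS
  have hSre : (K : ℝ) / 32 ≤ S.re := le_re_tsum_mul_expWeight h2 (by exact_mod_cast hK0)
  have hS1 : Tendsto (fun N : ℕ ↦ ∑ d ∈ Finset.range N,
      χ d * ((2 * Real.sinh (d * y) : ℝ) : ℂ)⁻¹) atTop (𝓝 S) := by
    have h := hasSum_mul_inv_sinh χ hy0
    refine HasSum.tendsto_sum_nat ((PNat.coe_injective.hasSum_iff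
      (f := fun d : ℕ ↦ χ d * ((2 * Real.sinh (d * y) : ℝ) : ℂ)⁻¹) ?_).1 h)
    intro d hd
    have : d = 0 := by
      by_contra h0
      exact hd ⟨⟨d, Nat.pos_of_ne_zero h0⟩, rfl⟩
    simp [this]
  have hlim : Tendsto (fun N : ℕ ↦ ∑ d ∈ Finset.range N,
      χ d * (((Real.sinh (d * y))⁻¹ - (d * y)⁻¹ : ℝ) : ℂ)) atTop
      (𝓝 (2 * S - (y : ℂ)⁻¹ * χ.LFunction 1)) := by
    refine ((hS1.const_mul 2).sub ((tendsto_sum_LFunction_one hχ).const_mul (y : ℂ)⁻¹)).congr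
      fun N ↦ ?_
    rw [Finset.mul_sum, Finset.mul_sum, ← Finset.sum_sub_distrib]
    refine Finset.sum_congr rfl fun d _ ↦ ?_
    push_cast
    rw [mul_inv, mul_inv]
    ring
  have hB : Tendsto (fun N : ℕ ↦ (3 * y + 15 / (N * y)) * ((q : ℝ) ^ 2 / 4) / w) atTop
      (𝓝 ((3 * y + 0) * ((q : ℝ) ^ 2 / 4) / w)) := by
    refine ((tendsto_const_nhds.add ?_).mul_const _).div_const _
    have := (tendsto_inv_atTop_nhds_zero_nat (𝕜 := ℝ)).mul_const (15 / y)
    rw [zero_mul] at this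
    refine this.congr fun N ↦ ?_
    rw [div_mul_eq_div_div_swap, inv_mul_eq_div]
  have hle : ‖2 * S - (y : ℂ)⁻¹ * χ.LFunction 1‖ ≤ (3 * y + 0) * ((q : ℝ) ^ 2 / 4) / w := by
    refine le_of_tendsto_of_tendsto hlim.norm hB ?_
    filter_upwards [eventually_gt_atTop 0] with N hN
    exact norm_sum_mul_inv_sinh_sub_le hχ hp h2 hy0 hN
  have h3 : 2 * S.re ≤ y⁻¹ * ‖χ.LFunction 1‖ + 3 * y * w ^ 3 / 4 := by
    have h4 : 2 * S.re ≤ ‖2 * S‖ := by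
      refine le_trans (le_of_eq ?_) (Complex.re_le_norm (2 * S))
      simp
    have h5 := norm_sub_norm_le (2 * S) ((y : ℂ)⁻¹ * χ.LFunction 1)
    have h6 : ‖(y : ℂ)⁻¹ * χ.LFunction 1‖ = y⁻¹ * ‖χ.LFunction 1‖ := by
      rw [norm_mul, norm_inv, Complex.norm_real, Real.norm_of_nonneg hy0.le]
    have h7 : (3 * y + 0) * ((q : ℝ) ^ 2 / 4) / w = 3 * y * w ^ 3 / 4 := by
      rw [hwq]
      field_simp
      ring
    linarith
  have h8 : y⁻¹ = 4 * K ^ 2 := by rw [hy]; field_simp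
  have h9 : 3 * y * w ^ 3 / 4 ≤ K / 32 := by
    have : w ^ 3 ≤ K ^ 3 / 8 := by
      have := pow_le_pow_left₀ (by linarith : (0 : ℝ) ≤ 2 * w) hK1 3
      nlinarith
    rw [hy]
    calc _ ≤ 3 * (1 / (4 * K ^ 2)) * ((K : ℝ) ^ 3 / 8) / 4 := by gcongr
      _ = 3 * K / 128 := by field_simp; norm_num
      _ ≤ _ := by linarith
  have h10 : (K : ℝ) / 32 ≤ 4 * K ^ 2 * ‖χ.LFunction 1‖ := by
    rw [← h8]
    linarith
  have h11 : 1 / 128 ≤ K * ‖χ.LFunction 1‖ := by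
    have : (K : ℝ) * (1 / 128) ≤ K * (K * ‖χ.LFunction 1‖) := by nlinarith
    exact le_of_mul_le_mul_left this hK0
  rw [div_le_iff₀ (by positivity)]
  nlinarith [norm_nonneg (χ.LFunction 1)]

end DirichletCharacter

end

section

open Complex Filter Topology

namespace DirichletCharacter

variable {T δ : ℝ}

lemma exists_zeroFreeParams (δ₀ : ℝ) (hδ₀ : 0 < δ₀) : ∃ T₀ : ℝ, 0 < T₀ ∧ ∀ T : ℝ, T₀ ≤ T →
    ZeroFreeParams T (1 / (12800 * Real.log T)) ∧ 1 / (12800 * Real.log T) ≤ δ₀ ∧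
      6912 ≤ Real.log T := by
  have h1 : ∀ᶠ T : ℝ in atTop, ‖Real.log T‖ ≤ 1 / 12800 * ‖T‖ :=
    Real.isLittleO_log_id_atTop.bound (by norm_num)
  have h2 := Real.tendsto_log_atTop.eventually_ge_atTop (max 6912 (1 / δ₀))
  obtain ⟨T₀, h⟩ := eventually_atTop.1 (h1.and (h2.and (eventually_ge_atTop (100 : ℝ))))
  refine ⟨max T₀ 1, by positivity, fun T hT ↦ ?_⟩
  obtain ⟨h1, h2, h3⟩ := h T (le_trans (le_max_left _ _) hT)
  obtain ⟨h4, h5⟩ := max_le_iff.1 h2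
  have hl : 0 < Real.log T := by linarith
  have hT0 : 0 < T := by linarith
  rw [Real.norm_of_nonneg hl.le, Real.norm_of_nonneg hT0.le] at h1
  refine ⟨⟨h3, ?_, ?_, ?_⟩, ?_, h4⟩
  · exact one_div_le_one_div_of_le (by positivity) (by linarith)
  · exact one_div_le_one_div_of_le (by norm_num) (by linarith)
  · field_simp
    norm_num
  · rw [div_le_iff₀ hδ₀] at h5
    rw [div_le_iff₀ (by positivity)]
    nlinarith

lemma isReal_of_exceptional (h : ZeroFreeParams T δ)
    (hζ : ∀ ρ : ℂ, 1 - δ / 20 ≤ ρ.re → ρ.re < 1 → |ρ.im| ≤ T → riemannZeta ρ ≠ 0)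
    {q : ℕ} [NeZero q] {χ : DirichletCharacter ℂ q} (hp : χ.IsPrimitive) (hq : (q : ℝ) ≤ T)
    {ρ : ℂ} (hρ : 1 - δ / 20 ≤ ρ.re) (hρ' : ρ.re < 1) (hi : |ρ.im| ≤ T)
    (h0 : χ.LFunction ρ = 0) : χ ≠ 1 ∧ χ ^ 2 = 1 ∧ ρ = (ρ.re : ℂ) := by
  have hχ : χ ≠ 1 := by
    intro h1
    have hq1 : q = 1 := by
      rw [← hp, h1]
      exact conductor_one
    subst hq1
    exact hζ ρ hρ hρ' hi (by rwa [LFunction_modOne_eq] at h0)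
  have hqT : (q : ℝ) ≤ T ^ 2 := hq.trans (by nlinarith [h.le_T])
  obtain ⟨h1, h2⟩ := sq_eq_one_and_im_eq_zero h hqT hχ hρ hρ' hi h0
  exact ⟨hχ, h1, Complex.ext (by simp) (by simp [h2])⟩

lemma le_one_sub_of_zero {q : ℕ} [NeZero q] {χ : DirichletCharacter ℂ q} (hχ : χ ≠ 1)
    (hp : χ.IsPrimitive) (h2 : χ ^ 2 = 1) (hT : 100 ≤ T) (hlog : 6912 ≤ Real.log T)
    (hq : (q : ℝ) ≤ T) {β : ℝ} (hβ : 1 - 1 / (2 * Real.log T) ≤ β) (hβ1 : β < 1)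
    (h0 : χ.LFunction β = 0) : β ≤ 1 - 1 / (Real.sqrt T * Real.log T ^ 3) := by
  have h3 := (le_norm_LFunction_one hχ hp h2).trans (norm_LFunction_one_le hχ hT hq hβ hβ1 h0)
  have hq0 : (0 : ℝ) < q := by exact_mod_cast Nat.pos_of_ne_zero (NeZero.ne q)
  have hs0 : 0 < Real.sqrt q := Real.sqrt_pos.2 hq0
  have hs : Real.sqrt q ≤ Real.sqrt T := Real.sqrt_le_sqrt hq
  have hsT : 0 < Real.sqrt T := hs0.trans_le hs
  have hl : 0 < Real.log T := by linarith
  have hb : 0 < 1 - β := by linarith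
  rw [div_le_iff₀ (by positivity)] at h3
  have h4 : 1 ≤ (1 - β) * (Real.sqrt T * Real.log T ^ 3) := by
    calc 1 ≤ 18 * Real.log T ^ 2 * (1 - β) * (384 * Real.sqrt q) := h3
      _ ≤ 18 * Real.log T ^ 2 * (1 - β) * (384 * Real.sqrt T) := by gcongr
      _ = (1 - β) * (Real.sqrt T * (Real.log T ^ 2 * 6912)) := by ring
      _ ≤ (1 - β) * (Real.sqrt T * (Real.log T ^ 2 * Real.log T)) := by gcongr
      _ = _ := by ring
  have h5 := (div_le_iff₀ (by positivity)).2 h4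
  linarith

end DirichletCharacter

end

/-- Statements (1.1)–(1.2): there are effectively computable `a₀ > 0` and
`T₀ > 0` such that for all `T ≥ T₀`, among the nontrivial zeros `ρ = β + iγ`, `|γ| ≤ T`, of
all Dirichlet L-functions of primitive characters of modulus `q ≤ T`, all satisfy
`β < 1 − a₀/log T` except possibly a single zero `β_T`, which is real and simple, belongs
to a unique primitive character `χ_T`, which is real, and satisfies
`1 − a₀/log T ≤ β_T ≤ 1 − 1/(√T (log T)³)`. -/
theorem exceptional_zero_dichotomy :
    ∃ a₀ : ℝ, 0 < a₀ ∧ ∃ T₀ : ℝ, 0 < T₀ ∧ ∀ T : ℝ, T₀ ≤ T →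
      (∀ (q : ℕ) [NeZero q] (χ : DirichletCharacter ℂ q) (ρ : ℂ),
          χ.IsPrimitive → (q : ℝ) ≤ T → 0 < ρ.re → ρ.re < 1 → |ρ.im| ≤ T →
          χ.LFunction ρ = 0 → ρ.re < 1 - a₀ / Real.log T) ∨
      (∃ (q : ℕ) (iq : NeZero q) (χ : DirichletCharacter ℂ q) (β : ℝ),
          χ.IsPrimitive ∧ (q : ℝ) ≤ T ∧
          -- the exceptional character is real
          (∀ a : ZMod q, (χ a).im = 0) ∧
          -- the exceptional zero is a real nontrivial zero of `L(s, χ)`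
          0 < β ∧ β < 1 ∧ @DirichletCharacter.LFunction q iq χ (β : ℂ) = 0 ∧
          -- the exceptional zero is simple
          deriv (@DirichletCharacter.LFunction q iq χ) (β : ℂ) ≠ 0 ∧
          1 - a₀ / Real.log T ≤ β ∧ β ≤ 1 - 1 / (Real.sqrt T * (Real.log T) ^ 3) ∧
          -- all other zeros in `Z_T` satisfy `β < 1 − a₀ / log T`, and the exception
          -- belongs only to the unique character `χ_T`
          (∀ (q' : ℕ) [NeZero q'] (χ' : DirichletCharacter ℂ q') (ρ : ℂ),
              χ'.IsPrimitive → (q' : ℝ) ≤ T → 0 < ρ.re → ρ.re < 1 → |ρ.im| ≤ T →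
              χ'.LFunction ρ = 0 → ¬ ρ.re < 1 - a₀ / Real.log T →
              ρ = (β : ℂ) ∧ q' = q ∧ HEq χ' χ)) := by
  obtain ⟨δ₀, hδ₀, hζ⟩ := DirichletCharacter.exists_riemannZeta_ne_zero
  obtain ⟨T₀, hT₀, hT⟩ := DirichletCharacter.exists_zeroFreeParams δ₀ hδ₀
  refine ⟨1 / 256000, by norm_num, T₀, hT₀, fun T hTT ↦ ?_⟩
  obtain ⟨h, hδ, hlog⟩ := hT T hTT
  have hζ := hζ T _ h hδ
  have e : 1 / 256000 / Real.log T = 1 / (12800 * Real.log T) / 20 := by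
    field_simp
    norm_num
  rw [e]
  set δ := 1 / (12800 * Real.log T) with hδd
  rw [or_iff_not_imp_left]
  intro hne
  push Not at hne
  obtain ⟨q, iq, χ, ρ, hp, hq, hρ0, hρ1, hi, h0, hρ⟩ := hne
  obtain ⟨hχ, h2, hre⟩ := DirichletCharacter.isReal_of_exceptional h hζ hp hq hρ hρ1 hi h0
  have h0' : χ.LFunction (ρ.re : ℂ) = 0 := by rwa [← hre]
  have hqT : (q : ℝ) ≤ T ^ 2 := hq.trans (by nlinarith [h.le_T])
  refine ⟨q, iq, χ, ρ.re, hp, hq, fun a ↦ ?_, hρ0, hρ1, h0',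
    DirichletCharacter.deriv_ne_zero_of_zero h hqT hχ hρ hρ1 h0', hρ, ?_, ?_⟩
  · rcases DirichletCharacter.eq_real_of_sq_eq_one h2 a with h | h | h <;> simp [h]
  · refine DirichletCharacter.le_one_sub_of_zero hχ hp h2 h.le_T hlog hq ?_ hρ1 h0'
    refine le_trans ?_ hρ
    rw [← e, div_div]
    gcongr
    norm_num
  · intro q' _ χ' ρ' hp' hq' _ hρ1' hi' h0'' hρ'
    rw [not_lt] at hρ'
    obtain ⟨hχ', h2', hre'⟩ :=
      DirichletCharacter.isReal_of_exceptional h hζ hp' hq' hρ' hρ1' hi' h0''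
    rw [hre'] at h0''
    obtain ⟨hqq, hh⟩ := DirichletCharacter.heq_of_zeros h hq hq' hp hp' hχ hχ' h2 h2' hρ hρ1 h0'
      hρ' hρ1' h0''
    refine ⟨?_, hqq, hh⟩
    subst hqq
    obtain rfl := eq_of_heq hh
    rw [hre', DirichletCharacter.zero_unique h hqT hχ hρ' hρ1' h0'' hρ hρ1 h0']
end

section
/- For every ε > 0 there exists a constant c(ε) > 0 such that for every real primitive Dirichlet character χ of modulus q ≥ 3 and every real β with L(β,χ) = 0 and 0 < β < 1, one has β ≤ 1 − c(ε) q^{-ε}. -/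
section

open Finset MeasureTheory Filter Topology Asymptotics
open scoped ComplexOrder

namespace DirichletCharacter

variable {N : ℕ} [NeZero N] {χ : DirichletCharacter ℂ N}

lemma sum_range_level_eq_zero (hχ : χ ≠ 1) : ∑ k ∈ range N, χ (k : ZMod N) = 0 := by
  rw [← MulChar.sum_eq_zero_of_ne_one hχ]
  refine sum_bij' (fun k _ ↦ (k : ZMod N)) (fun a _ ↦ a.val) (by simp)
    (fun a _ ↦ mem_range.mpr a.val_lt) (fun k hk ↦ ?_) (by simp) (by simp)
  exact ZMod.val_cast_of_lt (mem_range.mp hk)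

lemma norm_sum_range_le_level (hχ : χ ≠ 1) (n : ℕ) :
    ‖∑ k ∈ range n, χ (k : ZMod N)‖ ≤ N := by
  induction n using Nat.strong_induction_on with
  | _ n ih =>
    rcases lt_or_ge n N with h | h
    · calc ‖∑ k ∈ range n, χ (k : ZMod N)‖ ≤ ∑ k ∈ range n, 1 :=
            norm_sum_le_of_le _ fun k _ ↦ χ.norm_le_one _
        _ ≤ N := by simpa using h.le
    · obtain ⟨m, rfl⟩ := Nat.exists_eq_add_of_le h
      rw [sum_range_add, sum_range_level_eq_zero hχ, zero_add]
      simpa using ih m (by have := NeZero.pos N; omega)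

lemma norm_sum_Icc_one_le_self {M : ℕ} (χ : DirichletCharacter ℂ M) (n : ℕ) :
    ‖∑ k ∈ Icc 1 n, χ (k : ZMod M)‖ ≤ n :=
  calc ‖∑ k ∈ Icc 1 n, χ (k : ZMod M)‖ ≤ ∑ k ∈ Icc 1 n, 1 :=
        norm_sum_le_of_le _ fun k _ ↦ χ.norm_le_one _
    _ = n := by simp

lemma norm_sum_Icc_one_le_level (hχ : χ ≠ 1) (n : ℕ) :
    ‖∑ k ∈ Icc 1 n, χ (k : ZMod N)‖ ≤ N := by
  have hN : N ≠ 1 := fun h ↦ hχ (level_one' χ h)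
  have h : ∑ k ∈ range (n + 1), χ (k : ZMod N) = ∑ k ∈ Icc 1 n, χ (k : ZMod N) := by
    rw [range_eq_Ico, sum_eq_sum_Ico_succ_bot n.succ_pos, Nat.cast_zero, χ.map_zero' hN, zero_add]
    rfl
  exact h ▸ norm_sum_range_le_level hχ (n + 1)

lemma norm_sum_Icc_one_le_rpow (hχ : χ ≠ 1) {θ : ℝ} (h0 : 0 ≤ θ) (h1 : θ ≤ 1) {t : ℝ}
    (ht : 0 < t) :
    ‖∑ k ∈ Icc 1 ⌊t⌋₊, χ (k : ZMod N)‖ ≤ (N : ℝ) ^ θ * t ^ (1 - θ) := by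
  set x := ‖∑ k ∈ Icc 1 ⌊t⌋₊, χ (k : ZMod N)‖ with hx
  have hx0 : 0 ≤ x := norm_nonneg _
  calc x = x ^ θ * x ^ (1 - θ) := by
        rw [← Real.rpow_add_of_nonneg hx0 h0 (sub_nonneg.mpr h1), add_sub_cancel, Real.rpow_one]
    _ ≤ (N : ℝ) ^ θ * t ^ (1 - θ) := by
        gcongr
        · exact norm_sum_Icc_one_le_level hχ _
        · exact (norm_sum_Icc_one_le_self χ _).trans (Nat.floor_le ht.le)

lemma mellin_indicator_Ioi_one (f : ℝ → ℂ) (s : ℂ) :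
    mellin ((Set.Ioi (1 : ℝ)).indicator f) (-s) =
      ∫ t in Set.Ioi (1 : ℝ), f t * (t : ℂ) ^ (-(s + 1)) := by
  have h (t : ℝ) : (t : ℂ) ^ (-s - 1) • (Set.Ioi (1 : ℝ)).indicator f t =
      (Set.Ioi (1 : ℝ)).indicator (fun t ↦ f t * (t : ℂ) ^ (-(s + 1))) t := by
    rw [neg_add']
    by_cases ht : t ∈ Set.Ioi (1 : ℝ) <;> simp [ht, mul_comm]
  simp_rw [mellin, h]
  rw [setIntegral_indicator measurableSet_Ioi, Set.inter_eq_right.mpr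
    (Set.Ioi_subset_Ioi zero_le_one)]

lemma differentiableAt_mellin_indicator_sum (hχ : χ ≠ 1) {s : ℂ} (hs : s.re < 0) :
    DifferentiableAt ℂ
      (mellin ((Set.Ioi (1 : ℝ)).indicator fun t ↦ ∑ k ∈ Icc 1 ⌊t⌋₊, χ (k : ZMod N))) s := by
  refine mellin_differentiableAt_of_isBigO_rpow (a := 0) (b := s.re - 1) ?_ ?_ hs ?_ (by linarith)
  · have h := locallyIntegrableOn_mul_sum_Icc (m := 1) (fun k : ℕ ↦ χ (k : ZMod N)) le_rfl
      (locallyIntegrableOn_const (1 : ℂ))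
    simp only [one_mul] at h
    refine fun x hx ↦ ?_
    obtain ⟨U, hU, hi⟩ := h x (Set.Ioi_subset_Ici_self hx)
    refine ⟨U, nhdsWithin_mono _ Set.Ioi_subset_Ici_self hU, hi.indicator measurableSet_Ioi⟩
  · refine IsBigO.of_bound N (Eventually.of_forall fun t ↦ ?_)
    simp only [neg_zero, Real.rpow_zero, norm_one, mul_one]
    exact (norm_indicator_le_norm_self _ _).trans (norm_sum_Icc_one_le_level hχ _)
  · refine IsBigO.of_bound 0 ?_
    filter_upwards [Ioo_mem_nhdsGT (zero_lt_one' ℝ)] with t ht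
    simp [Set.indicator_of_notMem (s := Set.Ioi (1 : ℝ)) (not_lt.mpr ht.2.le)]

lemma LFunction_eq_mul_integral_s15 (hχ : χ ≠ 1) {s : ℂ} (hs : 0 < s.re) :
    LFunction χ s = s * ∫ t in Set.Ioi (1 : ℝ),
      (∑ k ∈ Icc 1 ⌊t⌋₊, χ (k : ZMod N)) * (t : ℂ) ^ (-(s + 1)) := by
  have hU : IsOpen {z : ℂ | 0 < z.re} := isOpen_lt continuous_const Complex.continuous_re
  have hV : {z : ℂ | 1 < z.re} ∈ 𝓝 (2 : ℂ) :=
    (isOpen_lt continuous_const Complex.continuous_re).mem_nhds (by simp)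
  rw [← mellin_indicator_Ioi_one]
  refine AnalyticOnNhd.eqOn_of_preconnected_of_eventuallyEq (z₀ := 2) (U := {z : ℂ | 0 < z.re})
    (g := fun z ↦ z * mellin _ (-z))
    ((differentiable_LFunction hχ).differentiableOn.analyticOnNhd hU)
    (DifferentiableOn.analyticOnNhd (fun z hz ↦ ?_) hU)
    (convex_halfSpace_re_gt 0).isPreconnected (by simp) ?_ hs
  · have h := differentiableAt_mellin_indicator_sum (s := -z) hχ (by simpa using hz)
    exact (differentiableAt_id.mul (h.comp z differentiableAt_id.neg)).differentiableWithinAt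
  · filter_upwards [hV] with z hz
    rw [mellin_indicator_Ioi_one, LFunction_eq_LSeries χ hz]
    refine LSeries_eq_mul_integral _ zero_le_one hz (LSeriesSummable_of_one_lt_re χ hz) ?_
    refine IsBigO.of_bound 1 (Eventually.of_forall fun n ↦ ?_)
    simpa using norm_sum_Icc_one_le_self χ n

/-- A convexity-type bound for `L(s, χ)` to the right of the line `Re s = 1 - θ`. -/
lemma norm_LFunction_le_s15 (hχ : χ ≠ 1) {θ : ℝ} (h0 : 0 ≤ θ) (h1 : θ ≤ 1) {s : ℂ}
    (hs : 1 - θ < s.re) :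
    ‖LFunction χ s‖ ≤ ‖s‖ * ((N : ℝ) ^ θ / (s.re + θ - 1)) := by
  rw [LFunction_eq_mul_integral_s15 hχ (by linarith), norm_mul]
  gcongr
  have hlt : -θ - s.re < -1 := by linarith
  calc _ ≤ ∫ t in Set.Ioi (1 : ℝ), (N : ℝ) ^ θ * t ^ (-θ - s.re) := by
        refine norm_integral_le_of_norm_le
          ((integrableOn_Ioi_rpow_of_lt hlt one_pos).const_mul _) ?_
        filter_upwards [ae_restrict_mem measurableSet_Ioi] with t ht
        have ht0 : 0 < t := one_pos.trans ht
        rw [norm_mul, Complex.norm_cpow_eq_rpow_re_of_pos ht0]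
        calc _ ≤ ((N : ℝ) ^ θ * t ^ (1 - θ)) * t ^ (-(s + 1)).re := by
              gcongr
              exact norm_sum_Icc_one_le_rpow hχ h0 h1 ht0
          _ = _ := by
              rw [mul_assoc, ← Real.rpow_add ht0]
              congr 2
              simp
              ring
    _ = (N : ℝ) ^ θ / (s.re + θ - 1) := by
        rw [integral_const_mul, integral_Ioi_rpow_of_lt hlt one_pos, Real.one_rpow, neg_div,
          ← div_neg, mul_one_div]
        congr 1
        ring

end DirichletCharacter

lemma iteratedDeriv_inv_sub_one_two (n : ℕ) :
    iteratedDeriv n (fun z : ℂ ↦ (z - 1)⁻¹) 2 = (-1) ^ n * (n.factorial : ℂ) := by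
  have h := congrFun (iteratedDeriv_comp_sub_const n (fun z : ℂ ↦ z⁻¹) 1) 2
  rw [h, iteratedDeriv_eq_iterate, show (fun z : ℂ ↦ z⁻¹) = Inv.inv from rfl, iter_deriv_inv]
  norm_num

lemma one_le_LSeries_of_nonneg {a : ℕ → ℂ} (ha : 0 ≤ a) (ha1 : a 1 = 1) {x : ℝ}
    (hs : LSeriesSummable a x) : 1 ≤ LSeries a x := by
  have h := Summable.le_tsum hs 1 fun n _ ↦ LSeries.term_nonneg (ha n) x
  rwa [LSeries.term_of_ne_zero one_ne_zero, ha1, Nat.cast_one, Complex.one_cpow, div_one] at h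

lemma iteratedDeriv_dslope_one {a : ℕ → ℂ} (hs : ∀ s : ℂ, 1 < s.re → LSeriesSummable a s)
    {G : ℂ → ℂ} (hGa : ∀ s : ℂ, 1 < s.re → G s = (s - 1) * LSeries a s) (n : ℕ) :
    iteratedDeriv n (dslope G 1) 2 =
      iteratedDeriv n (LSeries a) 2 - G 1 * ((-1) ^ n * (n.factorial : ℂ)) := by
  have hV : {z : ℂ | 1 < z.re} ∈ 𝓝 (2 : ℂ) :=
    (isOpen_lt continuous_const Complex.continuous_re).mem_nhds (by simp)
  have habs : LSeries.abscissaOfAbsConv a ≤ 1 :=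
    LSeries.abscissaOfAbsConv_le_of_forall_lt_LSeriesSummable fun y hy ↦ hs y (by simpa using hy)
  have hH : dslope G 1 =ᶠ[𝓝 2] fun z ↦ LSeries a z - G 1 * (z - 1)⁻¹ := by
    filter_upwards [hV] with z hz
    have hz1 : z ≠ 1 := by rintro rfl; simp at hz
    have := sub_ne_zero.mpr hz1
    rw [dslope_of_ne _ hz1, slope_def_field, hGa z hz]
    field_simp
  have hinv : ContDiffAt ℂ n (fun z : ℂ ↦ (z - 1)⁻¹) 2 :=
    (contDiffAt_id.sub contDiffAt_const).inv (by norm_num)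
  have hL : ContDiffAt ℂ n (LSeries a) 2 := by
    refine AnalyticAt.contDiffAt (LSeries_analyticOnNhd a 2 ?_)
    exact habs.trans_lt (by simpa using EReal.coe_lt_coe_iff.mpr (one_lt_two (α := ℝ)))
  rw [hH.iteratedDeriv_eq, iteratedDeriv_fun_sub hL (contDiffAt_const.mul hinv),
    iteratedDeriv_const_mul _ hinv, iteratedDeriv_inv_sub_one_two]

/-- **Estermann's inequality**. If `(s - 1) ∑ aₙ n⁻ˢ` with `aₙ ≥ 0`, `a₁ = 1` extends to an entire
function `G` which vanishes at a point `β` slightly to the left of `1`, then the residue `G 1` of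
the Dirichlet series at `1` is not too small. -/
lemma residue_lower_bound {a : ℕ → ℂ} (ha : 0 ≤ a) (ha1 : a 1 = 1)
    (hs : ∀ s : ℂ, 1 < s.re → LSeriesSummable a s)
    {G : ℂ → ℂ} (hG : Differentiable ℂ G) (hGa : ∀ s : ℂ, 1 < s.re → G s = (s - 1) * LSeries a s)
    {B : ℝ} (hB : ∀ z ∈ Metric.closedBall (2 : ℂ) (3 / 2), ‖G z‖ ≤ B)
    {β : ℝ} (hβ : 7 / 8 ≤ β) (hβ1 : β < 1) (h0 : G β = 0)
    {M : ℕ} (hM : M ≠ 0) (hMB : 32 * B * (3 / 4) ^ M ≤ 1) :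
    (1 - β) / 2 ≤ ‖G 1‖ * (2 - β) ^ M := by
  set H := dslope G 1 with hHdef
  have hH : Differentiable ℂ H := by
    rw [← differentiableOn_univ, Complex.differentiableOn_dslope univ_mem]
    exact hG.differentiableOn
  have hB0 : 0 ≤ B := (norm_nonneg _).trans (hB 2 (by simp; norm_num))
  have hHB : ∀ z ∈ Metric.sphere (2 : ℂ) (3 / 2), ‖H z‖ ≤ 4 * B := by
    intro z hz
    have hz2 : ‖z - 2‖ = 3 / 2 := mem_sphere_iff_norm.mp hz
    have hz1 : 1 / 2 ≤ ‖z - 1‖ := by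
      have := norm_sub_norm_le (z - 2) (-1)
      rw [hz2, show z - 2 - -1 = z - 1 by ring, norm_neg, norm_one] at this
      linarith
    have hne : z ≠ 1 := by rintro rfl; norm_num at hz1
    rw [hHdef, dslope_of_ne _ hne, slope_def_field, norm_div, div_le_iff₀ (by linarith)]
    have h1 := hB z (Metric.sphere_subset_closedBall hz)
    have h2 := hB 1 (by simp [dist_eq_norm]; norm_num)
    have h3 := norm_sub_le (G z) (G 1)
    nlinarith
  set c : ℕ → ℝ := fun n ↦
    (((n.factorial : ℂ)⁻¹ • ((β : ℂ) - 2) ^ n • iteratedDeriv n H 2)).re with hc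
  set b : ℕ → ℝ := fun n ↦
    (((n.factorial : ℝ)⁻¹ : ℝ) * ((-1) ^ n * iteratedDeriv n (LSeries a) 2) : ℂ).re with hb
  have habs : LSeries.abscissaOfAbsConv a ≤ 1 :=
    LSeries.abscissaOfAbsConv_le_of_forall_lt_LSeriesSummable fun y hy ↦ hs y (by simpa using hy)
  have hb0 (n : ℕ) : 0 ≤ b n := by
    have h : LSeries.abscissaOfAbsConv a < (2 : ℝ) :=
      habs.trans_lt (by exact_mod_cast one_lt_two (α := ℝ))
    have h' := LSeries.iteratedDeriv_alternating ha h n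
    simp only [hb, Complex.re_ofReal_mul]
    exact mul_nonneg (by positivity) (Complex.nonneg_iff.mp (by simpa using h')).1
  have hb1 : 1 ≤ b 0 := by
    have h := one_le_LSeries_of_nonneg ha ha1 (hs (2 : ℝ) (by simp))
    simpa [hb] using (Complex.le_def.mp h).1
  set l := (G 1).re with hl
  have hcb (n : ℕ) : c n = (2 - β) ^ n * (b n - l) := by
    have : (n.factorial : ℂ)⁻¹ • ((β : ℂ) - 2) ^ n • iteratedDeriv n H 2 =
        (((2 - β) ^ n : ℝ) : ℂ) * ((((n.factorial : ℝ)⁻¹ : ℝ) *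
          ((-1) ^ n * iteratedDeriv n (LSeries a) 2)) - G 1) := by
      rw [hHdef, iteratedDeriv_dslope_one hs hGa,
        show (β : ℂ) - 2 = (-1) * ((2 - β : ℝ) : ℂ) by push_cast; ring, mul_pow]
      have h1 : ((-1 : ℂ) ^ n) * (-1) ^ n = 1 := by rw [← mul_pow]; simp
      have h2 : (n.factorial : ℂ) ≠ 0 := by exact_mod_cast n.factorial_ne_zero
      simp only [smul_eq_mul]
      push_cast
      field_simp
      linear_combination (-(2 - (β : ℂ)) ^ n * n.factorial * G 1) * h1
    simp only [hc, hb, hl, this, Complex.re_ofReal_mul, Complex.sub_re]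
  have hcB (n : ℕ) : ‖c n‖ ≤ 4 * B * (3 / 4) ^ n := by
    have h := Complex.norm_iteratedDeriv_le_of_forall_mem_sphere_norm_le n (by norm_num)
      hH.diffContOnCl hHB
    have hf : (0 : ℝ) < n.factorial := by exact_mod_cast n.factorial_pos
    calc ‖c n‖ ≤ ‖(n.factorial : ℂ)⁻¹ • ((β : ℂ) - 2) ^ n • iteratedDeriv n H 2‖ :=
          Complex.abs_re_le_norm _
      _ = (n.factorial : ℝ)⁻¹ * ((2 - β) ^ n * ‖iteratedDeriv n H 2‖) := by
          rw [norm_smul, norm_smul, norm_inv, norm_pow, Complex.norm_natCast,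
            show (β : ℂ) - 2 = ((β - 2 : ℝ) : ℂ) by push_cast; ring, Complex.norm_real,
            Real.norm_eq_abs, abs_of_neg (by linarith), neg_sub]
      _ ≤ (n.factorial : ℝ)⁻¹ * ((9 / 8) ^ n * (n.factorial * (4 * B) / (3 / 2) ^ n)) := by
          gcongr <;> linarith
      _ = 4 * B * (3 / 4) ^ n := by
          rw [show (9 / 8 : ℝ) = 3 / 4 * (3 / 2) by norm_num, mul_pow]
          field_simp
  have hsum : HasSum c (l / (1 - β)) := by
    have h := Complex.hasSum_re (Complex.hasSum_taylorSeries_of_entire hH 2 (β : ℂ))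
    convert h using 1
    have hne : (β : ℂ) ≠ 1 := by exact_mod_cast hβ1.ne
    rw [hHdef, dslope_of_ne _ hne, slope_def_field, h0, zero_sub,
      show (β : ℂ) - 1 = -((1 - β : ℝ) : ℂ) by push_cast; ring, neg_div_neg_eq,
      Complex.div_ofReal_re]
  have hgeo : HasSum (fun n : ℕ ↦ 4 * B * (3 / 4 : ℝ) ^ (n + M)) (16 * B * (3 / 4) ^ M) := by
    have h := (hasSum_geometric_of_lt_one (r := (3 / 4 : ℝ)) (by norm_num)
      (by norm_num)).mul_left (4 * B * (3 / 4) ^ M)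
    rw [show (fun n : ℕ ↦ 4 * B * (3 / 4 : ℝ) ^ (n + M)) =
      fun n ↦ 4 * B * (3 / 4) ^ M * (3 / 4) ^ n from funext fun n ↦ by ring]
    rwa [show 4 * B * (3 / 4) ^ M * (1 - 3 / 4 : ℝ)⁻¹ = 16 * B * (3 / 4) ^ M by
      norm_num; ring] at h
  have htail : -(1 / 2) ≤ ∑' n, c (n + M) := by
    have h := tsum_of_norm_bounded hgeo fun n ↦ hcB (n + M)
    rw [Real.norm_eq_abs, abs_le] at h
    linarith
  have hhead : 1 - l * (((2 - β) ^ M - 1) / (1 - β)) ≤ ∑ n ∈ range M, c n := by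
    have hg := geom_sum_eq (show 2 - β ≠ 1 by linarith) M
    rw [show 2 - β - 1 = 1 - β by ring] at hg
    rw [← hg, mul_sum]
    simp_rw [hcb, mul_sub, sum_sub_distrib]
    have h1 : 1 ≤ ∑ n ∈ range M, (2 - β) ^ n * b n := by
      refine hb1.trans ?_
      simpa using single_le_sum (f := fun n ↦ (2 - β) ^ n * b n)
        (fun n _ ↦ mul_nonneg (pow_nonneg (by linarith) _) (hb0 n))
        (mem_range.mpr (Nat.pos_of_ne_zero hM))
    simp_rw [mul_comm l]
    linarith
  have hsplit := hsum.summable.sum_add_tsum_nat_add M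
  rw [hsum.tsum_eq] at hsplit
  have hβ0 : 0 < 1 - β := by linarith
  have hfin : (1 - β) / 2 ≤ l * (2 - β) ^ M := by
    have h : 1 / 2 ≤ l / (1 - β) + l * (((2 - β) ^ M - 1) / (1 - β)) := by linarith
    have h' : l / (1 - β) + l * (((2 - β) ^ M - 1) / (1 - β)) = l * (2 - β) ^ M / (1 - β) := by
      field_simp; ring
    rw [h', le_div_iff₀ hβ0] at h
    linarith
  exact hfin.trans (mul_le_mul_of_nonneg_right (Complex.re_le_norm _)
    (pow_nonneg (by linarith) _))

open ArithmeticFunction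

/-- Pointwise multiplication by the logarithm is a derivation for Dirichlet convolution. -/
lemma log_mul_arithmeticFunction_mul (f g : ArithmeticFunction ℂ) {n : ℕ} :
    Complex.log n * (f * g) n = ∑ p ∈ n.divisorsAntidiagonal,
      ((Complex.log p.1 * f p.1) * g p.2 + f p.1 * (Complex.log p.2 * g p.2)) := by
  rw [mul_apply, mul_sum]
  refine sum_congr rfl fun p hp ↦ ?_
  obtain ⟨h1, h2⟩ := Nat.ne_zero_of_mem_divisorsAntidiagonal hp
  have h : Complex.log n = Complex.log p.1 + Complex.log p.2 := by
    rw [← (Nat.mem_divisorsAntidiagonal.mp hp).1]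
    simp only [← Complex.ofReal_natCast, ← Complex.ofReal_log (Nat.cast_nonneg _)]
    rw [Nat.cast_mul, Real.log_mul (by exact_mod_cast h1) (by exact_mod_cast h2)]
    push_cast
    rfl
  rw [h]
  ring

/-- `f` has logarithmic derivative `k`, i.e. `f · log = k * f` as a Dirichlet convolution. -/
def HasLogMul (f k : ArithmeticFunction ℂ) : Prop := ∀ n : ℕ, Complex.log n * f n = (k * f) n

lemma HasLogMul.mul {f g k l : ArithmeticFunction ℂ} (hf : HasLogMul f k) (hg : HasLogMul g l) :
    HasLogMul (f * g) (k + l) := by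
  intro n
  have h : (k + l) * (f * g) = (k * f) * g + f * (l * g) := by ring
  rw [log_mul_arithmeticFunction_mul, h, ArithmeticFunction.add_apply, mul_apply, mul_apply, sum_add_distrib]
  simp_rw [hf _, hg _]

lemma HasLogMul.nonneg {f k : ArithmeticFunction ℂ} (h : HasLogMul f k) (hf1 : 0 ≤ f 1)
    (hk : ∀ n, 0 ≤ k n) (hk1 : k 1 = 0) (n : ℕ) : 0 ≤ f n := by
  induction n using Nat.strong_induction_on with
  | _ n ih =>
    rcases lt_or_ge n 2 with hn | hn
    · interval_cases n
      · simp
      · exact hf1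
    · have hlog : 0 < Real.log n := Real.log_pos (by exact_mod_cast hn)
      have hsum : 0 ≤ ∑ p ∈ n.divisorsAntidiagonal, k p.1 * f p.2 := by
        refine sum_nonneg fun p hp ↦ ?_
        rcases eq_or_ne p.1 1 with h1 | h1
        · simp [h1, hk1]
        · refine mul_nonneg (hk _) (ih _ ?_)
          obtain ⟨hp1, hp2⟩ := Nat.ne_zero_of_mem_divisorsAntidiagonal hp
          rw [← (Nat.mem_divisorsAntidiagonal.mp hp).1]
          exact lt_mul_left (Nat.pos_of_ne_zero hp2) (by omega)
      rw [← mul_apply, ← h n, ← Complex.natCast_log] at hsum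
      have := mul_nonneg (Complex.zero_le_real.mpr (inv_nonneg.mpr hlog.le)) hsum
      rwa [← mul_assoc, ← Complex.ofReal_mul, inv_mul_cancel₀ hlog.ne', Complex.ofReal_one,
        one_mul] at this

namespace DirichletCharacter

/-- The values of a Dirichlet character as an arithmetic function. -/
noncomputable def arith {N : ℕ} (χ : DirichletCharacter ℂ N) : ArithmeticFunction ℂ :=
  toArithmeticFunction fun n ↦ χ n

/-- The arithmetic function `χ · Λ`. -/
noncomputable def arithMangoldt {N : ℕ} (χ : DirichletCharacter ℂ N) : ArithmeticFunction ℂ :=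
  toArithmeticFunction fun n ↦ χ n * vonMangoldt n

lemma arith_apply {N : ℕ} (χ : DirichletCharacter ℂ N) {n : ℕ} (hn : n ≠ 0) :
    χ.arith n = χ n := by
  simp [arith, toArithmeticFunction, hn]

lemma arithMangoldt_apply {N : ℕ} (χ : DirichletCharacter ℂ N) (n : ℕ) :
    χ.arithMangoldt n = χ n * vonMangoldt n := by
  rcases eq_or_ne n 0 with rfl | hn
  · simp
  · simp [arithMangoldt, toArithmeticFunction, hn]

lemma hasLogMul_arith {N : ℕ} (χ : DirichletCharacter ℂ N) :
    HasLogMul χ.arith χ.arithMangoldt := by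
  intro n
  have h := congrFun χ.convolution_twist_vonMangoldt n
  rcases eq_or_ne n 0 with rfl | hn
  · simp
  · rw [arith_apply χ hn, mul_comm]
    exact h.symm

lemma LSeriesHasSum_arith {N : ℕ} (χ : DirichletCharacter ℂ N) {s : ℂ} (hs : 1 < s.re) :
    LSeriesHasSum (χ.arith ·) s (LSeries (χ ·) s) :=
  (LSeriesHasSum_congr s _ fun hn ↦ arith_apply χ hn).mpr
    (LSeriesSummable_of_one_lt_re χ hs).LSeriesHasSum

lemma one_add_nonneg {N : ℕ} {χ : DirichletCharacter ℂ N} (hχ : ∀ a, (χ a).im = 0) (a : ZMod N) :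
    0 ≤ 1 + χ a := by
  have h := (Complex.abs_re_le_norm (χ a)).trans (χ.norm_le_one a)
  rw [Complex.nonneg_iff]
  simp only [Complex.add_re, Complex.one_re, Complex.add_im, Complex.one_im, hχ a]
  exact ⟨by linarith [(abs_le.mp h).1], by simp⟩

variable {N₁ N₂ N₃ : ℕ} {χ₁ : DirichletCharacter ℂ N₁} {χ₂ : DirichletCharacter ℂ N₂}
  {χ₃ : DirichletCharacter ℂ N₃}

/-- The coefficients of `ζ(s) L(s, χ₁) L(s, χ₂) L(s, χ₃)`. -/
noncomputable def biquadraticCoeff (χ₁ : DirichletCharacter ℂ N₁) (χ₂ : DirichletCharacter ℂ N₂)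
    (χ₃ : DirichletCharacter ℂ N₃) : ArithmeticFunction ℂ :=
  (1 : DirichletCharacter ℂ 1).arith * χ₁.arith * χ₂.arith * χ₃.arith

lemma biquadraticCoeff_one : biquadraticCoeff χ₁ χ₂ χ₃ 1 = 1 := by
  simp [biquadraticCoeff, arith_apply, MulChar.one_apply (isUnit_of_subsingleton _)]

lemma biquadraticCoeff_nonneg (h₁ : ∀ a, (χ₁ a).im = 0) (h₂ : ∀ a, (χ₂ a).im = 0)
    (h₃ : ∀ n : ℕ, χ₃ n = χ₁ n * χ₂ n) (n : ℕ) : 0 ≤ biquadraticCoeff χ₁ χ₂ χ₃ n := by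
  have h := (((hasLogMul_arith (1 : DirichletCharacter ℂ 1)).mul (hasLogMul_arith χ₁)).mul
    (hasLogMul_arith χ₂)).mul (hasLogMul_arith χ₃)
  have h1 (n : ℕ) : (1 : DirichletCharacter ℂ 1) n = 1 :=
    congrFun (modOne_eq_one (χ := (1 : DirichletCharacter ℂ 1))) n
  refine h.nonneg (biquadraticCoeff_one (χ₁ := χ₁) (χ₂ := χ₂) (χ₃ := χ₃) ▸ zero_le_one)
    (fun n ↦ ?_) ?_ n
  · have hK : (1 + χ₁ n) * (1 + χ₂ n) * (vonMangoldt n : ℂ) =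
        ((1 : DirichletCharacter ℂ 1).arithMangoldt + χ₁.arithMangoldt + χ₂.arithMangoldt +
          χ₃.arithMangoldt) n := by
      simp only [ArithmeticFunction.add_apply, arithMangoldt_apply, h1, h₃]
      ring
    rw [← hK]
    exact mul_nonneg (mul_nonneg (one_add_nonneg h₁ _) (one_add_nonneg h₂ _))
      (Complex.zero_le_real.mpr vonMangoldt_nonneg)
  · simp [arithMangoldt_apply]

lemma LSeriesHasSum_biquadraticCoeff {s : ℂ} (hs : 1 < s.re) :
    LSeriesHasSum (biquadraticCoeff χ₁ χ₂ χ₃ ·) s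
      (LSeries 1 s * LSeries (χ₁ ·) s * LSeries (χ₂ ·) s * LSeries (χ₃ ·) s) := by
  rw [← modOne_eq_one (χ := (1 : DirichletCharacter ℂ 1))]
  exact LSeriesHasSum_mul (LSeriesHasSum_mul (LSeriesHasSum_mul (LSeriesHasSum_arith _ hs)
    (LSeriesHasSum_arith _ hs)) (LSeriesHasSum_arith _ hs)) (LSeriesHasSum_arith _ hs)

section product

variable {q₁ q₂ : ℕ}

/-- The product of two Dirichlet characters, as a character modulo the product of the moduli. -/
noncomputable def mulLevel (χ₁ : DirichletCharacter ℂ q₁) (χ₂ : DirichletCharacter ℂ q₂) :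
    DirichletCharacter ℂ (q₁ * q₂) :=
  changeLevel (dvd_mul_right q₁ q₂) χ₁ * changeLevel (dvd_mul_left q₂ q₁) χ₂

lemma mulLevel_natCast (χ₁ : DirichletCharacter ℂ q₁) (χ₂ : DirichletCharacter ℂ q₂) (n : ℕ) :
    mulLevel χ₁ χ₂ n = χ₁ n * χ₂ n := by
  by_cases hn : n.Coprime (q₁ * q₂)
  · have h : IsCoprime (n : ℤ) ((q₁ * q₂ : ℕ) : ℤ) := Nat.isCoprime_iff_coprime.mpr hn
    have h₁ := changeLevel_eq_cast_of_dvd' χ₁ (dvd_mul_right q₁ q₂) h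
    have h₂ := changeLevel_eq_cast_of_dvd' χ₂ (dvd_mul_left q₂ q₁) h
    simp only [Int.cast_natCast] at h₁ h₂
    rw [mulLevel, MulChar.mul_apply, h₁, h₂]
  · rw [MulChar.map_nonunit _ (mt (ZMod.isUnit_iff_coprime _ _).mp hn)]
    rw [Nat.coprime_mul_iff_right, not_and_or] at hn
    rcases hn with hn | hn
    · rw [MulChar.map_nonunit χ₁ (mt (ZMod.isUnit_iff_coprime _ _).mp hn), zero_mul]
    · rw [MulChar.map_nonunit χ₂ (mt (ZMod.isUnit_iff_coprime _ _).mp hn), mul_zero]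

lemma mulLevel_ne_one [NeZero q₁] [NeZero q₂] {χ₁ : DirichletCharacter ℂ q₁}
    {χ₂ : DirichletCharacter ℂ q₂} (h₁ : χ₁.IsPrimitive) (h₂ : χ₂.IsPrimitive) (hne : q₂ ≠ q₁) :
    mulLevel χ₁ χ₂ ≠ 1 := by
  intro h
  have h' := congrArg conductor (eq_inv_of_mul_eq_one_right h)
  rw [conductor_inv, conductor_changeLevel, conductor_changeLevel] at h'
  exact hne (h₂.symm.trans (h'.trans h₁))

end product

lemma IsPrimitive.ne_one {q : ℕ} [NeZero q] {χ : DirichletCharacter ℂ q} (h : χ.IsPrimitive)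
    (hq : q ≠ 1) : χ ≠ 1 := by
  rintro rfl
  exact hq (h.symm.trans conductor_one)

/-- Estermann's inequality for `ζ(s) L(s, χ₁) L(s, χ₂) L(s, χ₁χ₂)`. -/
lemma exists_LFunction_one_lower_bound :
    ∃ B : ℝ, 1 ≤ B ∧ ∀ (q₁ q₂ : ℕ) [NeZero q₁] [NeZero q₂] (χ₁ : DirichletCharacter ℂ q₁)
      (χ₂ : DirichletCharacter ℂ q₂), χ₁ ≠ 1 → χ₂ ≠ 1 → mulLevel χ₁ χ₂ ≠ 1 →
      (∀ a, (χ₁ a).im = 0) → (∀ a, (χ₂ a).im = 0) →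
      ∀ β : ℝ, 7 / 8 ≤ β → β < 1 → LFunction χ₁ β = 0 →
      ∀ M : ℕ, M ≠ 0 → B * ((q₁ : ℝ) * q₂) ^ 2 * (3 / 4) ^ M ≤ 1 →
      (1 - β) / 2 ≤ ‖LFunction χ₁ 1‖ * ‖LFunction χ₂ 1‖ * ‖LFunction (mulLevel χ₁ χ₂) 1‖ *
        (2 - β) ^ M := by
  obtain ⟨C, hC⟩ := (isCompact_closedBall (2 : ℂ) (3 / 2)).exists_bound_of_continuousOn
    (differentiable_LFunctionTrivChar₁ 1).continuous.continuousOn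
  refine ⟨32 * 343 * max C 1, by linarith [le_max_right C 1], ?_⟩
  intro q₁ q₂ _ _ χ₁ χ₂ h₁ h₂ h₃ hr₁ hr₂ β hβ hβ1 h0 M hM hMB
  set G : ℂ → ℂ := fun s ↦ LFunctionTrivChar₁ 1 s * LFunction χ₁ s * LFunction χ₂ s *
    LFunction (mulLevel χ₁ χ₂) s with hG
  have hL {q : ℕ} [NeZero q] {χ : DirichletCharacter ℂ q} (hχ : χ ≠ 1) {z : ℂ}
      (hz : z ∈ Metric.closedBall (2 : ℂ) (3 / 2)) : ‖LFunction χ z‖ ≤ 7 * q := by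
    rw [mem_closedBall_iff_norm] at hz
    have hre : 1 / 2 ≤ z.re := by
      have h := (abs_le.mp ((Complex.abs_re_le_norm (z - 2)).trans hz)).1
      norm_num at h
      linarith
    have hn : ‖z‖ ≤ 7 / 2 := by
      have h := norm_add_le (z - 2) 2
      norm_num at h
      linarith
    calc _ ≤ ‖z‖ * ((q : ℝ) ^ (1 : ℝ) / (z.re + 1 - 1)) :=
          norm_LFunction_le_s15 hχ zero_le_one le_rfl (by linarith)
      _ ≤ 7 / 2 * (q / (1 / 2)) := by
          rw [Real.rpow_one, add_sub_cancel_right]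
          gcongr
      _ = 7 * q := by ring
  have hGa (s : ℂ) (hs : 1 < s.re) :
      G s = (s - 1) * LSeries (biquadraticCoeff χ₁ χ₂ (mulLevel χ₁ χ₂) ·) s := by
    have hs1 : s ≠ 1 := by rintro rfl; simp at hs
    rw [(LSeriesHasSum_biquadraticCoeff hs).LSeries_eq, hG]
    simp only [LFunctionTrivChar₁, LFunctionTrivChar, Function.update_of_ne hs1,
      LFunction_eq_LSeries _ hs, modOne_eq_one]
    ring
  have hB : ∀ z ∈ Metric.closedBall (2 : ℂ) (3 / 2),
      ‖G z‖ ≤ 343 * max C 1 * ((q₁ : ℝ) * q₂) ^ 2 := by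
    intro z hz
    simp only [hG, norm_mul]
    calc _ ≤ max C 1 * (7 * q₁) * (7 * q₂) * (7 * (q₁ * q₂ : ℕ)) := by
          gcongr
          · exact (hC z hz).trans (le_max_left _ _)
          · exact hL h₁ hz
          · exact hL h₂ hz
          · exact hL h₃ hz
      _ = _ := by push_cast; ring
  have h := residue_lower_bound (M := M)
    (biquadraticCoeff_nonneg (χ₃ := mulLevel χ₁ χ₂) hr₁ hr₂ (mulLevel_natCast χ₁ χ₂))
    biquadraticCoeff_one (fun s hs ↦ (LSeriesHasSum_biquadraticCoeff hs).LSeriesSummable)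
    (((((differentiable_LFunctionTrivChar₁ 1).mul (differentiable_LFunction h₁)).mul
      (differentiable_LFunction h₂)).mul (differentiable_LFunction h₃))) hGa hB hβ hβ1
    (by simp [h0]) hM (le_of_eq_of_le (by ring) hMB)
  simpa [hG] using h

lemma norm_LFunction_one_le_s15 {q : ℕ} [NeZero q] {χ : DirichletCharacter ℂ q} (hχ : χ ≠ 1) {δ : ℝ}
    (hδ : 0 < δ) (hδ1 : δ ≤ 1) : ‖LFunction χ 1‖ ≤ (q : ℝ) ^ δ / δ := by
  simpa using norm_LFunction_le_s15 (s := 1) hχ hδ.le hδ1 (by simpa using hδ)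

lemma norm_LFunction_one_le_of_zero {q : ℕ} [NeZero q] {χ : DirichletCharacter ℂ q} (hχ : χ ≠ 1)
    {δ : ℝ} (hδ : 0 < δ) (hδ1 : 3 * δ ≤ 1) {β : ℝ} (hβ : 1 - δ ≤ β) (hβ1 : β < 1)
    (h0 : LFunction χ β = 0) :
    ‖LFunction χ 1‖ ≤ 2 * (q : ℝ) ^ (3 * δ) / δ ^ 2 * (1 - β) := by
  have hderiv : ∀ z ∈ Metric.closedBall (1 : ℂ) δ,
      ‖deriv (LFunction χ) z‖ ≤ 2 * (q : ℝ) ^ (3 * δ) / δ ^ 2 := by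
    intro z hz
    have h := Complex.norm_deriv_le_of_forall_mem_sphere_norm_le (c := z)
      (C := 2 * ((q : ℝ) ^ (3 * δ) / δ)) hδ (differentiable_LFunction hχ).diffContOnCl ?_
    · exact h.trans_eq (by field_simp)
    intro w hw
    have hw1 : ‖w - 1‖ ≤ 2 * δ := by
      rw [mem_sphere_iff_norm] at hw
      rw [mem_closedBall_iff_norm] at hz
      have := norm_add_le (w - z) (z - 1)
      rw [sub_add_sub_cancel] at this
      linarith
    have hre : 1 - 2 * δ ≤ w.re := by
      have h := (abs_le.mp ((Complex.abs_re_le_norm (w - 1)).trans hw1)).1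
      norm_num at h
      linarith
    have hn : ‖w‖ ≤ 2 := by
      have h := norm_add_le (w - 1) 1
      norm_num at h
      linarith
    refine (norm_LFunction_le_s15 hχ (θ := 3 * δ) (by linarith) hδ1 (by linarith)).trans ?_
    gcongr
    · exact div_nonneg (by positivity) (by linarith)
    · linarith
  have h := (convex_closedBall (1 : ℂ) δ).norm_image_sub_le_of_norm_deriv_le
    (fun z _ ↦ (differentiable_LFunction hχ).differentiableAt) hderiv
    (x := (β : ℂ)) (y := 1) ?_ (by simp [hδ.le])
  · rw [h0, sub_zero, ← Complex.ofReal_one, ← Complex.ofReal_sub, Complex.norm_real,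
      Real.norm_eq_abs, abs_of_pos (by linarith)] at h
    exact_mod_cast h
  · rw [mem_closedBall_iff_norm, ← Complex.ofReal_one, ← Complex.ofReal_sub, Complex.norm_real,
      Real.norm_eq_abs, abs_le]
    constructor <;> linarith

lemma exists_nat_pow_bounds {X δ : ℝ} (hX : 1 ≤ X) (hδ : 0 ≤ δ) (hδ1 : δ ≤ 1) :
    ∃ M : ℕ, M ≠ 0 ∧ X * (3 / 4) ^ M ≤ 1 ∧ (1 + δ) ^ M ≤ Real.exp 2 * X ^ (4 * δ) := by
  have hX0 : 0 < X := by linarith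
  have hlog : 0 ≤ Real.log X := Real.log_nonneg hX
  refine ⟨⌈4 * Real.log X⌉₊ + 1, by omega, ?_, ?_⟩
  all_goals set M := ⌈4 * Real.log X⌉₊ + 1 with hM
  · have h1 : 4 * Real.log X ≤ M := (Nat.le_ceil _).trans (by exact_mod_cast Nat.le_succ _)
    calc X * (3 / 4) ^ M ≤ Real.exp (Real.log X) * Real.exp (-(1 / 4)) ^ M := by
          rw [Real.exp_log hX0]
          gcongr
          linarith [Real.add_one_le_exp (-(1 / 4) : ℝ)]
      _ = Real.exp (Real.log X - M / 4) := by
          rw [← Real.exp_nat_mul, ← Real.exp_add]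
          ring_nf
      _ ≤ 1 := Real.exp_le_one_iff.mpr (by linarith)
  · have h2 : (M : ℝ) ≤ 4 * Real.log X + 2 := by
      have := Nat.ceil_lt_add_one (show 0 ≤ 4 * Real.log X by positivity)
      push_cast [hM]
      linarith
    calc (1 + δ) ^ M ≤ Real.exp δ ^ M := by
          gcongr
          linarith [Real.add_one_le_exp δ]
      _ = Real.exp (M * δ) := (Real.exp_nat_mul _ _).symm
      _ ≤ Real.exp (2 + Real.log X * (4 * δ)) := Real.exp_le_exp.mpr (by nlinarith)
      _ = _ := by rw [Real.exp_add, Real.rpow_def_of_pos hX0]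

/-- A single real zero close to `1` repels the real zeros of the other real characters. -/
lemma exists_repulsion {δ : ℝ} (hδ : 0 < δ) (hδ1 : δ ≤ 1 / 8) {q₁ : ℕ} [NeZero q₁] (hq₁ : q₁ ≠ 1)
    {χ₁ : DirichletCharacter ℂ q₁} (hp₁ : χ₁.IsPrimitive) (hr₁ : ∀ a, (χ₁ a).im = 0)
    {β₁ : ℝ} (hβ₁ : 1 - δ ≤ β₁) (hβ₁1 : β₁ < 1) (h0₁ : LFunction χ₁ β₁ = 0) :
    ∃ c : ℝ, 0 < c ∧ ∀ (q : ℕ) [NeZero q], q ≠ 1 → q ≠ q₁ → ∀ χ : DirichletCharacter ℂ q,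
      χ.IsPrimitive → (∀ a, (χ a).im = 0) → ∀ β : ℝ, 1 - δ ≤ β → β < 1 → LFunction χ β = 0 →
      c * (q : ℝ) ^ (-(12 * δ)) ≤ 1 - β := by
  obtain ⟨B, hB1, hB⟩ := exists_LFunction_one_lower_bound
  have hq₁0 : (1 : ℝ) ≤ q₁ := by exact_mod_cast NeZero.one_le
  set A : ℝ := (‖LFunction χ₁ 1‖ + 1) * (2 / δ ^ 2) * ((q₁ : ℝ) ^ δ / δ) *
    (Real.exp 2 * (B * (q₁ : ℝ) ^ 2) ^ (4 * δ)) with hA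
  have hA0 : 0 < A := by positivity
  refine ⟨(1 - β₁) / (2 * A), div_pos (by linarith) (by positivity), ?_⟩
  intro q _ hq hqq χ hp hr β hβ hβ1 h0
  have hq0 : (1 : ℝ) ≤ q := by exact_mod_cast NeZero.one_le
  have hq0' : (0 : ℝ) < q := by linarith
  have hne := mulLevel_ne_one hp₁ hp hqq
  have hX : 1 ≤ B * ((q₁ : ℝ) * q) ^ 2 :=
    one_le_mul_of_one_le_of_one_le hB1 (one_le_pow₀ (one_le_mul_of_one_le_of_one_le hq₁0 hq0))
  obtain ⟨M, hM, hM1, hM2⟩ := exists_nat_pow_bounds hX hδ.le (by linarith)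
  have hmain := hB q₁ q χ₁ χ (hp₁.ne_one hq₁) (hp.ne_one hq) hne hr₁ hr β₁ (by linarith) hβ₁1 h0₁
    M hM hM1
  have hbound : (1 - β₁) / 2 ≤ A * (q : ℝ) ^ (12 * δ) * (1 - β) := by
    calc (1 - β₁) / 2 ≤ _ := hmain
      _ ≤ (‖LFunction χ₁ 1‖ + 1) * (2 * (q : ℝ) ^ (3 * δ) / δ ^ 2 * (1 - β)) *
          (((q₁ * q : ℕ) : ℝ) ^ δ / δ) * (Real.exp 2 * (B * ((q₁ : ℝ) * q) ^ 2) ^ (4 * δ)) := by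
        have hβ0 : 0 ≤ 1 - β := by linarith
        gcongr
        · exact pow_nonneg (by linarith) _
        · linarith
        · exact norm_LFunction_one_le_of_zero (hp.ne_one hq) hδ (by linarith) hβ hβ1 h0
        · exact norm_LFunction_one_le_s15 hne hδ (by linarith)
        · refine le_trans ?_ hM2
          gcongr <;> linarith
      _ = _ := by
        have e : (q : ℝ) ^ (12 * δ) =
            (q : ℝ) ^ (3 * δ) * (q : ℝ) ^ δ * ((q : ℝ) ^ 2) ^ (4 * δ) := by
          rw [← Real.rpow_natCast, ← Real.rpow_mul hq0'.le, ← Real.rpow_add hq0',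
            ← Real.rpow_add hq0']
          congr 1
          push_cast
          ring
        rw [hA, e, Nat.cast_mul, Real.mul_rpow (by positivity) (by positivity), mul_pow,
          ← mul_assoc B, Real.mul_rpow (x := B * (q₁ : ℝ) ^ 2) (by positivity) (by positivity)]
        ring
  have hqp : 0 < (q : ℝ) ^ (12 * δ) := by positivity
  rw [Real.rpow_neg hq0'.le, ← div_eq_mul_inv, div_le_iff₀ hqp, div_le_iff₀ (by positivity)]
  linarith

lemma exists_zero_free_interval (q : ℕ) [NeZero q] :
    ∃ c : ℝ, 0 < c ∧ ∀ χ : DirichletCharacter ℂ q, χ ≠ 1 → ∀ β : ℝ, β < 1 → LFunction χ β = 0 →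
      c ≤ 1 - β := by
  have h : ∀ᶠ x : ℝ in 𝓝 1, ∀ χ : DirichletCharacter ℂ q, χ ≠ 1 → LFunction χ x ≠ 0 := by
    refine eventually_all.mpr fun χ ↦ ?_
    by_cases hχ : χ = 1
    · simp [hχ]
    have hc : ContinuousAt (fun x : ℝ ↦ LFunction χ x) 1 :=
      ((differentiable_LFunction hχ).continuous.comp Complex.continuous_ofReal).continuousAt
    have := hc.eventually_ne (by simpa using LFunction_apply_one_ne_zero hχ)
    filter_upwards [this] with x hx _ using hx
  obtain ⟨c, hc, hball⟩ := Metric.eventually_nhds_iff.mp h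
  refine ⟨c, hc, fun χ hχ β hβ h0 ↦ ?_⟩
  by_contra! hlt
  refine hball ?_ χ hχ h0
  rw [Real.dist_eq, abs_sub_comm, abs_of_pos (by linarith)]
  exact hlt

end DirichletCharacter

end

/-- Siegel's theorem (1.3): for every `ε > 0` there is `c(ε) > 0` such
that every real zero `β ∈ (0,1)` of the L-function of a real primitive Dirichlet character
of modulus `q ≥ 3` satisfies `β ≤ 1 − c(ε) q^{-ε}`. -/
theorem siegel_theorem (ε : ℝ) (hε : 0 < ε) :
    ∃ c : ℝ, 0 < c ∧ ∀ (q : ℕ) [NeZero q], 3 ≤ q →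
      ∀ χ : DirichletCharacter ℂ q, χ.IsPrimitive → (∀ a : ZMod q, (χ a).im = 0) →
        ∀ β : ℝ, 0 < β → β < 1 → χ.LFunction (β : ℂ) = 0 →
          β ≤ 1 - c * (q : ℝ) ^ (-ε) := by
  set δ : ℝ := min ε 1 / 12 with hδdef
  have hδ : 0 < δ := by positivity
  have hδ1 : δ ≤ 1 / 8 := by linarith [min_le_right ε 1]
  have hδε : 12 * δ ≤ ε := by linarith [min_le_left ε 1]
  have hpow {q : ℕ} (hq : 3 ≤ q) : (q : ℝ) ^ (-ε) ≤ 1 :=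
    Real.rpow_le_one_of_one_le_of_nonpos (by exact_mod_cast (by omega : 1 ≤ q)) (by linarith)
  have hpow0 (q : ℕ) : 0 ≤ (q : ℝ) ^ (-ε) := by positivity
  by_cases hex : ∃ q₁ : ℕ, ∃ _ : NeZero q₁, 3 ≤ q₁ ∧ ∃ χ₁ : DirichletCharacter ℂ q₁,
      χ₁.IsPrimitive ∧ (∀ a, (χ₁ a).im = 0) ∧ ∃ β₁ : ℝ, 1 - δ ≤ β₁ ∧ β₁ < 1 ∧
        χ₁.LFunction (β₁ : ℂ) = 0
  · obtain ⟨q₁, _, hq₁, χ₁, hp₁, hr₁, β₁, hβ₁, hβ₁1, h0₁⟩ := hex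
    obtain ⟨c, hc, hrep⟩ := DirichletCharacter.exists_repulsion hδ hδ1 (by omega) hp₁ hr₁ hβ₁
      hβ₁1 h0₁
    obtain ⟨d, hd, hfree⟩ := DirichletCharacter.exists_zero_free_interval q₁
    refine ⟨min c (min d δ), by positivity, fun q _ hq χ hp hr β _ hβ1 h0 ↦ ?_⟩
    rw [le_sub_comm]
    have hone {x : ℝ} (hx : min c (min d δ) ≤ x) : min c (min d δ) * (q : ℝ) ^ (-ε) ≤ x :=
      (mul_le_of_le_one_right (by positivity) (hpow hq)).trans hx
    rcases lt_or_ge β (1 - δ) with hβ | hβ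
    · exact (hone ((min_le_right _ _).trans (min_le_right _ _))).trans (by linarith)
    rcases eq_or_ne q q₁ with rfl | hqq
    · exact (hone ((min_le_right _ _).trans (min_le_left _ _))).trans
        (hfree χ (hp.ne_one (by omega)) β hβ1 h0)
    · refine le_trans ?_ (hrep q (by omega) hqq χ hp hr β hβ hβ1 h0)
      gcongr
      · exact min_le_left _ _
      · exact_mod_cast (by omega : 1 ≤ q)
  · push Not at hex
    refine ⟨δ, hδ, fun q _ hq χ hp hr β _ hβ1 h0 ↦ ?_⟩
    by_contra! hlt
    refine hex q inferInstance hq χ hp hr β ?_ hβ1 h0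
    have := mul_le_of_le_one_right hδ.le (hpow hq)
    linarith
end
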